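/- Assume the local multiplier setup with g of the standard form, and let ε, d be the ball exponents of g with ε < 1/2. Let l be a line through the origin with unit direction v, and let δ_v, e_v be the strip exponents of g in direction v. Suppose v is NOT perpendicular to any of the lines l₁,…,l_p. Then δ_v = ε, and provided the support of φ is sufficiently small (depending on v), there is a constant C such that for all (t,u) ∈ l_H one has |K_φ(t,u)| ≤ C (2+|(t,u)|)^{−ε} (ln(2+|(t,u)|))^{d}. -/

import Mathlib

open MeasureTheory Real Set Filter Metric
open scoped Topology ENNReal

noncomputable section

/-- The Euclidean magnitude `|(x,y)| = √(x²+y²)` of a point of `ℝ²`. -/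
def nrm2 (p : ℝ × ℝ) : ℝ := Real.sqrt (p.1 ^ 2 + p.2 ^ 2)

/-- The open Euclidean disk `{(x,y) : x²+y² < r²}` centered at the origin. -/
def disk2 (r : ℝ) : Set (ℝ × ℝ) := {p : ℝ × ℝ | p.1 ^ 2 + p.2 ^ 2 < r ^ 2}

/-- The closed Euclidean disk `{(x,y) : x²+y² ≤ r²}` centered at the origin. -/
def closedDisk2 (r : ℝ) : Set (ℝ × ℝ) := {p : ℝ × ℝ | p.1 ^ 2 + p.2 ^ 2 ≤ r ^ 2}

/-- The circle `{(x,y) : x²+y² = r²}` centered at the origin. -/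
def circle2 (r : ℝ) : Set (ℝ × ℝ) := {p : ℝ × ℝ | p.1 ^ 2 + p.2 ^ 2 = r ^ 2}

/-- Dot product on `ℝ²`. -/
def dot2 (p q : ℝ × ℝ) : ℝ := p.1 * q.1 + p.2 * q.2

/-- The perpendicular vector `v^⊥ = (v₂, −v₁)`. -/
def perp2 (v : ℝ × ℝ) : ℝ × ℝ := (v.2, -v.1)

/-- The function `g = χ_E · ∏ᵢ |fᵢ|^(γᵢ)`. -/
def stdFun (n : ℕ) (f : Fin n → ℝ × ℝ → ℝ) (γ : Fin n → ℝ) (E : Set (ℝ × ℝ)) :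
    ℝ × ℝ → ℝ :=
  E.indicator fun p => ∏ i, |f i p| ^ (γ i)

/-- A boundary curve for the region `E`: one half of a graph `y = h(|x|^{1/N})` or
`x = h(|y|^{1/N})` with `h` real analytic, `h 0 = 0`, joining the origin to the circle
of radius `r₀`. -/
def IsPuiseuxBdryCurve (r₀ : ℝ) (C : Set (ℝ × ℝ)) : Prop :=
  ∃ (N : ℕ) (h : ℝ → ℝ) (I : Set ℝ) (σ : ℝ),
    0 < N ∧ (σ = 1 ∨ σ = -1) ∧ IsOpen I ∧ Icc (0:ℝ) (r₀ ^ ((N:ℝ)⁻¹)) ⊆ I ∧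
    AnalyticOnNhd ℝ h I ∧ h 0 = 0 ∧
    (C = {p : ℝ × ℝ | p ∈ closedDisk2 r₀ ∧ 0 ≤ σ * p.1 ∧
            p.2 = h (|p.1| ^ ((N:ℝ)⁻¹))} ∨
     C = {p : ℝ × ℝ | p ∈ closedDisk2 r₀ ∧ 0 ≤ σ * p.2 ∧
            p.1 = h (|p.2| ^ ((N:ℝ)⁻¹))}) ∧
    (0:ℝ×ℝ) ∈ C ∧ ∃ p ∈ C, nrm2 p = r₀

/-- The admissible form of the set `E`: either a disk centered at the origin, or a finite
disjoint union of open regions, each bounded by two Puiseux boundary curves joining the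
origin to the circle of radius `r₀` together with an arc of that circle, where all the
boundary curves are pairwise disjoint in the closed disk minus the origin. -/
def IsStdDomain (E : Set (ℝ × ℝ)) : Prop :=
  (∃ r₀ > (0:ℝ), E = disk2 r₀) ∨
  (∃ r₀ > (0:ℝ), ∃ m : ℕ, ∃ Es : Fin m → Set (ℝ × ℝ), ∃ Cs : Fin m → Fin 2 → Set (ℝ × ℝ),
    E = Set.iUnion Es ∧
    (Pairwise fun i j => Disjoint (Es i) (Es j)) ∧
    (∀ i, IsOpen (Es i) ∧ Es i ⊆ disk2 r₀ ∧ (0:ℝ×ℝ) ∈ closure (Es i) ∧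
      frontier (Es i) ⊆ Cs i 0 ∪ Cs i 1 ∪ circle2 r₀) ∧
    (∀ i j, IsPuiseuxBdryCurve r₀ (Cs i j)) ∧
    (Pairwise fun (q q' : Fin m × Fin 2) =>
      Disjoint (Cs q.1 q.2 ∩ (closedDisk2 r₀ \ {0}))
               (Cs q'.1 q'.2 ∩ (closedDisk2 r₀ \ {0}))))

/-- The standard form of the paper: the `fᵢ` are real analytic and not identically zero
near the origin, `g = χ_E ∏ |fᵢ|^(γᵢ)` is integrable near the origin, and `E` is an
admissible domain. -/
structure StandardForm (n : ℕ) (f : Fin n → ℝ × ℝ → ℝ) (γ : Fin n → ℝ)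
    (E : Set (ℝ × ℝ)) : Prop where
  analytic : ∃ U ∈ 𝓝 (0 : ℝ × ℝ), ∀ i, AnalyticOnNhd ℝ (f i) U
  nontriv : ∀ i, ¬ (∀ᶠ p in 𝓝 (0 : ℝ × ℝ), f i p = 0)
  integ : ∃ U ∈ 𝓝 (0 : ℝ × ℝ), IntegrableOn (stdFun n f γ E) U
  domain : IsStdDomain E

/-- The two-sided bound `c₁ rᵉ |log r|^d ≤ ∫_{x²+y²<r²} g ≤ c₂ rᵉ |log r|^d` for all small
`r` ("ball exponents" `ε`, `d` of `g`, as in Lemma 1.1). -/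
def BallBound (g : ℝ × ℝ → ℝ) (ε : ℝ) (d : ℕ) : Prop :=
  0 < ε ∧ d ≤ 1 ∧ ∃ c₁ > (0:ℝ), ∃ c₂ > (0:ℝ), ∃ c₃ > (0:ℝ), ∀ r : ℝ, 0 < r → r < c₃ →
    c₁ * r ^ ε * |Real.log r| ^ d ≤ (∫ p in disk2 r, g p) ∧
    (∫ p in disk2 r, g p) ≤ c₂ * r ^ ε * |Real.log r| ^ d

/-- The strip `{(x,y) : |(x,y)·v| < r, |(x,y)·v^⊥| < c}`. -/
def strip2 (v : ℝ × ℝ) (r c : ℝ) : Set (ℝ × ℝ) :=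
  {p : ℝ × ℝ | |dot2 p v| < r ∧ |dot2 p (perp2 v)| < c}

/-- The two-sided bound `a r^δ |log r|^e ≤ ∫_{strip} g ≤ b r^δ |log r|^e` for all small `r`,
for every small `c` ("strip exponents" `δ_v`, `e_v` of `g` in the direction `v`, as in
Lemma 1.2). -/
def StripBound (g : ℝ × ℝ → ℝ) (v : ℝ × ℝ) (δ : ℝ) (e : ℕ) : Prop :=
  0 < δ ∧ e ≤ 1 ∧ ∃ cv > (0:ℝ), ∀ c : ℝ, 0 < c → c < cv →
    ∃ a > (0:ℝ), ∃ b > (0:ℝ), ∀ r : ℝ, 0 < r → r < c →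
      a * r ^ δ * |Real.log r| ^ e ≤ (∫ p in strip2 v r c, g p) ∧
      (∫ p in strip2 v r c, g p) ≤ b * r ^ δ * |Real.log r| ^ e

/-- The order of vanishing of `f` at the origin. -/
def vanishingOrder (f : ℝ × ℝ → ℝ) : ℕ :=
  sInf {k : ℕ | iteratedFDeriv ℝ k f 0 ≠ 0}

/-- (A constant multiple of) the sum of the terms of lowest total degree in the Taylor
expansion of `f` at the origin, as a homogeneous function on `ℝ²`. -/
def lowestPart (f : ℝ × ℝ → ℝ) (p : ℝ × ℝ) : ℝ :=
  iteratedFDeriv ℝ (vanishingOrder f) f 0 (fun _ => p)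

/-- `w` is a tangent direction of the set `C` at the origin. -/
def IsTangentDirAt (C : Set (ℝ × ℝ)) (w : ℝ × ℝ) : Prop :=
  ∃ p : ℕ → ℝ × ℝ, (∀ k, p k ∈ C ∧ p k ≠ 0) ∧
    Tendsto p atTop (𝓝 (0:ℝ×ℝ)) ∧
    (Tendsto (fun k => (nrm2 (p k))⁻¹ • p k) atTop (𝓝 w) ∨
     Tendsto (fun k => (nrm2 (p k))⁻¹ • p k) atTop (𝓝 (-w)))

/-- `w` is the direction of one of the lines `l₁, …, l_p`: a line through the origin in the
zero set of the lowest-degree Taylor part of some `fᵢ`, or a tangent line at the origin to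
one of the boundary curves of `E`. -/
def ExceptionalDir (n : ℕ) (f : Fin n → ℝ × ℝ → ℝ) (E : Set (ℝ × ℝ)) (w : ℝ × ℝ) : Prop :=
  (∃ i, lowestPart (f i) w = 0) ∨ IsTangentDirAt (frontier E) w

/-- Conditions (1.2)-(1.3) on the factor `α`: `C¹` away from the origin, bounded by `A`,
with gradient bounded by `A (x²+y²)^{-1/2}`. -/
def AlphaBound (α : ℝ × ℝ → ℝ) (A : ℝ) : Prop :=
  ContDiffOn ℝ 1 α {(0:ℝ×ℝ)}ᶜ ∧ (∀ p, |α p| ≤ A) ∧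
  ∀ p : ℝ × ℝ, p ≠ 0 → ‖fderiv ℝ α p‖ ≤ A * (nrm2 p)⁻¹

/-- A smooth bump function equal to `1` near `(x₀, y₀)`, supported within (Euclidean)
distance `r` of `(x₀, y₀)`. -/
def IsBump (φ : ℝ × ℝ → ℝ) (x₀ y₀ : ℝ) (r : ℝ) : Prop :=
  ContDiff ℝ (⊤ : ℕ∞) φ ∧ HasCompactSupport φ ∧ (∀ᶠ p in 𝓝 ((x₀, y₀) : ℝ × ℝ), φ p = 1) ∧
    tsupport φ ⊆ {p : ℝ × ℝ | (p.1 - x₀) ^ 2 + (p.2 - y₀) ^ 2 < r ^ 2}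

/-- The oscillatory integral `∫_S h(x,y) e^{i(tx+uy)} dx dy`. -/
def oscInt (h : ℝ × ℝ → ℝ) (S : Set (ℝ × ℝ)) (t u : ℝ) : ℂ :=
  ∫ p in S, (h p : ℂ) * Complex.exp (Complex.I * ((t : ℂ) * (p.1 : ℂ) + (u : ℂ) * (p.2 : ℂ)))

/-- The convolution kernel `K(t,u) = ∫ m(x,y) e^{i(tx+uy)} dx dy`. -/
def Kfull (m : ℝ × ℝ → ℝ) (t u : ℝ) : ℂ :=
  oscInt m Set.univ t u

/-- The localized kernel `K_φ(t,u) = ∫ φ(x,y) m(x,y) e^{i(tx+uy)} dx dy`. -/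
def Kphi (φ m : ℝ × ℝ → ℝ) (t u : ℝ) : ℂ :=
  oscInt (fun p => φ p * m p) Set.univ t u

/-- `k` is a Puiseux function of index `N` on `[0,a]`: `k(x) = k'(x^{1/N})` for a function
`k'` real analytic on an open set containing `[0, a^{1/N}]`; equivalently `x ↦ k(x^N)` is
real analytic. -/
def PuiseuxOn (N : ℕ) (a : ℝ) (k : ℝ → ℝ) : Prop :=
  ∃ (k' : ℝ → ℝ) (I : Set ℝ), IsOpen I ∧ Icc (0:ℝ) (a ^ ((N:ℝ)⁻¹)) ⊆ I ∧
    AnalyticOnNhd ℝ k' I ∧ ∀ x ∈ Icc (0:ℝ) a, k x = k' (x ^ ((N:ℝ)⁻¹))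

/-- `k(x) = l·x^s + higher order terms` as `x → 0⁺`. -/
def LeadingTerm (k : ℝ → ℝ) (l s : ℝ) : Prop :=
  Tendsto (fun x => k x / x ^ s) (𝓝[>] (0:ℝ)) (𝓝 l)

/-- The mixed partial derivative `∂_x^l ∂_y^m F`. -/
def pderiv2 (l m : ℕ) (F : ℝ × ℝ → ℝ) (p : ℝ × ℝ) : ℝ :=
  iteratedDeriv l (fun x => iteratedDeriv m (fun y => F (x, y)) p.2) p.1

/-- The descending product `α(α−1)⋯(α−l+1)`. -/
def descProd (α : ℝ) (l : ℕ) : ℝ := ∏ j ∈ Finset.range l, (α - (j : ℝ))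

/-- The sliver `{(x,y) : 0 < x < a, g(x) < y < G(x)}`. -/
def sliverSet (a : ℝ) (g G : ℝ → ℝ) : Set (ℝ × ℝ) :=
  {q : ℝ × ℝ | 0 < q.1 ∧ q.1 < a ∧ g q.1 < q.2 ∧ q.2 < G q.1}

/-- A wedge of radius `r₀` at the origin: a region bounded by two lines through the origin
and the circle of radius `r₀`. -/
def IsWedge (r₀ : ℝ) (W : Set (ℝ × ℝ)) : Prop :=
  ∃ θ₁ θ₂ : ℝ, θ₁ < θ₂ ∧ θ₂ ≤ θ₁ + 2 * π ∧
    W = {p : ℝ × ℝ | ∃ ρ θ : ℝ, 0 < ρ ∧ ρ < r₀ ∧ θ₁ < θ ∧ θ < θ₂ ∧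
      p = (ρ * Real.cos θ, ρ * Real.sin θ)}

/-- `h` is nonnegative and log-Lipschitz with constant `C` on `(-∞, x₁)`. -/
def LL (C x₁ : ℝ) (h : ℝ → ℝ) : Prop :=
  ∀ x < x₁, 0 ≤ h x ∧ ∃ h' : ℝ, HasDerivAt h h' x ∧ |h'| ≤ C * h x

theorem norm_one_add_I_mul (y : ℝ) : ‖(1 : ℂ) + Complex.I * y‖ = Real.sqrt (1 + y ^ 2) := by
  rw [Complex.norm_def, Complex.normSq_apply]
  simp
  ring_nf

theorem osc1d {C₀ x₁ : ℝ} {G : ℝ → ℝ} (hG : LL C₀ x₁ G) (hGi : IntegrableOn G (Iio x₁))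
    (N : ℕ) (hN : 1 ≤ N) (hC₀ : 0 ≤ C₀) {C₁ M x₂ : ℝ} (hC₁ : 0 ≤ C₁) (hM : 0 ≤ M) (hx : x₂ < x₁)
    {ψ : ℝ → ℂ}
    (hψ : ∀ x < x₁, ‖ψ x‖ ≤ M ∧ ∃ ψ' : ℂ, HasDerivAt ψ ψ' x ∧ ‖ψ'‖ ≤ C₁ * M)
    (hψ0 : ∀ x, x₂ ≤ x → x < x₁ → ψ x = 0) (s : ℝ) :
    ‖∫ x in Iio x₁, (G x : ℂ) * ψ x * Complex.exp (Complex.I * ((s * rexp (N * x) : ℝ) : ℂ))‖ ≤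
      (C₀ + C₁ + 1 + N) * M * ∫ x in Iio x₁, G x / Real.sqrt (1 + (s * rexp (N * x)) ^ 2) := by
  classical
  set y : ℝ → ℝ := fun x => s * rexp (N * x) with hy
  set E : ℝ → ℂ := fun x => Complex.exp (Complex.I * (y x : ℂ)) with hE
  set q : ℝ → ℂ := fun x => 1 + Complex.I * ((N * y x : ℝ) : ℂ) with hq
  have hNr : (1:ℝ) ≤ N := by exact_mod_cast hN
  have hyd : ∀ x, HasDerivAt y (N * y x) x := by
    intro x
    have h1 : HasDerivAt (fun x : ℝ => (N:ℝ) * x) N x := by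
      simpa using (hasDerivAt_id x).const_mul (N:ℝ)
    have := (h1.exp).const_mul s
    exact this.congr_deriv (by simp only [hy]; ring)
  have hyc : ∀ x, HasDerivAt (fun x => (y x : ℂ)) ((N * y x : ℝ) : ℂ) x := fun x =>
    (hyd x).ofReal_comp
  have hEd : ∀ x, HasDerivAt E (E x * (q x - 1)) x := by
    intro x
    have := ((hyc x).const_mul Complex.I).cexp
    exact this.congr_deriv (by simp only [hE, hq]; ring)
  have hqd : ∀ x, HasDerivAt q (N * (q x - 1)) x := by
    intro x
    have := ((((hyd x).const_mul (N:ℝ)).ofReal_comp).const_mul Complex.I).const_add (1:ℂ)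
    exact this.congr_deriv (by simp only [hq]; push_cast; ring)
  have hqn : ∀ x, ‖q x‖ = Real.sqrt (1 + (N * y x) ^ 2) := fun x => norm_one_add_I_mul _
  have hq1 : ∀ x, 1 ≤ ‖q x‖ := by
    intro x; rw [hqn]; apply Real.one_le_sqrt.mpr; nlinarith [sq_nonneg (N * y x)]
  have hq0 : ∀ x, q x ≠ 0 := by
    intro x h; have := hq1 x; rw [h] at this; norm_num at this
  have hqy : ∀ x, Real.sqrt (1 + (y x) ^ 2) ≤ ‖q x‖ := by
    intro x; rw [hqn]; apply Real.sqrt_le_sqrt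
    have : (y x) ^ 2 * 1 ≤ (y x) ^ 2 * N ^ 2 := by
      apply mul_le_mul_of_nonneg_left _ (sq_nonneg _); nlinarith
    nlinarith
  have hsqy : ∀ x, 0 < Real.sqrt (1 + (y x) ^ 2) := by
    intro x; apply Real.sqrt_pos.mpr; positivity
  have hqm : ∀ x, ‖q x - 1‖ ≤ ‖q x‖ := by
    intro x
    rw [hqn]
    have : q x - 1 = Complex.I * ((N * y x : ℝ) : ℂ) := by simp [hq]
    rw [this, norm_mul, Complex.norm_I, one_mul, Complex.norm_real, Real.norm_eq_abs]
    apply Real.abs_le_sqrt; linarith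
  have hEn : ∀ x, ‖E x‖ = 1 := by
    intro x; simp only [hE]; rw [mul_comm]; exact Complex.norm_exp_ofReal_mul_I _
  -- derivative data
  choose! hG0 G' hG' hGb using hG
  choose! hψb ψ' hψ' hψ'b using hψ
  -- target function extended by zero
  set B : ℝ → ℂ := (Iio x₁).indicator fun x => (G x : ℂ) * ψ x * E x / q x with hB
  set B' : ℝ → ℂ := (Iio x₁).indicator fun x =>
    ((G' x : ℂ) * ψ x + G x * ψ' x) * E x / q x + (G x : ℂ) * ψ x * (E x * (q x - 1)) / q x
      - (G x : ℂ) * ψ x * E x * (N * (q x - 1)) / (q x) ^ 2 with hB'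
  have hBd : ∀ x, HasDerivAt B (B' x) x := by
    intro x
    rcases lt_or_ge x x₁ with hlt | hge
    · have h1 := (((hG' x hlt).ofReal_comp.mul (hψ' x hlt)).mul (hEd x)).div (hqd x) (hq0 x)
      have h2 : B =ᶠ[𝓝 x] fun x => (G x : ℂ) * ψ x * E x / q x := by
        filter_upwards [Iio_mem_nhds hlt] with z hz
        simp only [hB]; rw [indicator_of_mem hz]
      have h3 := h1.congr_of_eventuallyEq h2
      refine h3.congr_deriv ?_
      simp only [hB']; rw [indicator_of_mem (show x ∈ Iio x₁ from hlt)]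
      have := hq0 x
      simp only [Pi.mul_apply]
      field_simp
    · have h2 : B =ᶠ[𝓝 x] fun _ => 0 := by
        filter_upwards [Ioi_mem_nhds (lt_of_lt_of_le hx hge)] with z hz
        simp only [hB]
        by_cases hz1 : z < x₁
        · rw [indicator_of_mem (show z ∈ Iio x₁ from hz1), hψ0 z (le_of_lt hz) hz1]; simp
        · rw [indicator_of_notMem (show z ∉ Iio x₁ from hz1)]
      have h3 : B' x = 0 := by
        simp only [hB']; rw [indicator_of_notMem (show x ∉ Iio x₁ from not_lt.mpr hge)]
      rw [h3]
      exact (hasDerivAt_const x (0:ℂ)).congr_of_eventuallyEq h2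
  have hBm : Measurable B := by
    have : Continuous B := continuous_iff_continuousAt.mpr fun x => (hBd x).continuousAt
    exact this.measurable
  have hB'm : Measurable B' := by
    have : B' = deriv B := by ext x; exact (hBd x).deriv.symm
    rw [this]; exact measurable_deriv B
  have hGi' : Integrable ((Iio x₁).indicator G) := hGi.integrable_indicator measurableSet_Iio
  have hBi : Integrable B := by
    refine (hGi'.const_mul M).mono' hBm.aestronglyMeasurable (ae_of_all _ fun x => ?_)
    by_cases hx1 : x ∈ Iio x₁
    · simp only [hB]; rw [indicator_of_mem hx1, indicator_of_mem hx1]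
      rw [norm_div, norm_mul, norm_mul, hEn, Complex.norm_real, Real.norm_eq_abs,
        abs_of_nonneg (hG0 x hx1)]
      rw [div_le_iff₀ (by linarith [hq1 x])]
      have h1 := hψb x hx1
      have h2 := hq1 x
      have h3 := hG0 x hx1
      calc G x * ‖ψ x‖ * 1 ≤ G x * M := by rw [mul_one]; gcongr
        _ = M * G x * 1 := by ring
        _ ≤ M * G x * ‖q x‖ := by gcongr
    · simp only [hB]; rw [indicator_of_notMem hx1, indicator_of_notMem hx1]; simp
  -- pointwise bound on remainder
  have key : ∀ x ∈ Iio x₁, ‖(G x : ℂ) * ψ x * E x - B' x‖ ≤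
      (C₀ + C₁ + 1 + N) * M * (G x / Real.sqrt (1 + (y x) ^ 2)) := by
    intro x hx1
    have e1 : (G x : ℂ) * ψ x * E x - B' x =
        (-((G' x : ℂ) * ψ x + G x * ψ' x) + (G x : ℂ) * ψ x
          + (G x : ℂ) * ψ x * N * ((q x - 1) / q x)) * E x / q x := by
      simp only [hB']; rw [indicator_of_mem hx1]
      have := hq0 x
      field_simp
      ring
    rw [e1, norm_div, norm_mul, hEn, mul_one]
    have h3 := hG0 x hx1
    have g1 : ‖(G x : ℂ)‖ = G x := by
      rw [Complex.norm_real, Real.norm_eq_abs, abs_of_nonneg h3]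
    have h4 : ‖(q x - 1) / q x‖ ≤ 1 := by
      rw [norm_div]; exact div_le_one_of_le₀ (hqm x) (norm_nonneg _)
    have t1 : ‖(G' x : ℂ) * ψ x‖ ≤ (C₀ * G x) * M := by
      rw [norm_mul, Complex.norm_real, Real.norm_eq_abs]
      exact mul_le_mul (hGb x hx1) (hψb x hx1) (norm_nonneg _) (by positivity)
    have t2 : ‖(G x : ℂ) * ψ' x‖ ≤ G x * (C₁ * M) := by
      rw [norm_mul, g1]; gcongr; exact hψ'b x hx1
    have t3 : ‖(G x : ℂ) * ψ x‖ ≤ G x * M := by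
      rw [norm_mul, g1]; gcongr; exact hψb x hx1
    have t4 : ‖(G x : ℂ) * ψ x * N * ((q x - 1) / q x)‖ ≤ G x * M * N * 1 := by
      rw [norm_mul, norm_mul ((G x : ℂ) * ψ x)]
      have : ‖(N:ℂ)‖ = N := by simp
      rw [this]
      gcongr
    have num : ‖-((G' x : ℂ) * ψ x + G x * ψ' x) + (G x : ℂ) * ψ x
          + (G x : ℂ) * ψ x * N * ((q x - 1) / q x)‖ ≤ (C₀ + C₁ + 1 + N) * M * G x := by
      refine (norm_add₃_le).trans ?_
      rw [norm_neg]
      have := norm_add_le ((G' x : ℂ) * ψ x) (G x * ψ' x)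
      nlinarith
    calc _ ≤ ((C₀ + C₁ + 1 + N) * M * G x) / ‖q x‖ := by gcongr
      _ ≤ ((C₀ + C₁ + 1 + N) * M * G x) / Real.sqrt (1 + (y x) ^ 2) := by
          apply div_le_div_of_nonneg_left _ (hsqy x) (hqy x); positivity
      _ = _ := by ring
  have hyct : Continuous y := by simp only [hy]; fun_prop
  have hki : IntegrableOn (fun x => G x / Real.sqrt (1 + (y x) ^ 2)) (Iio x₁) := by
    have hm : AEStronglyMeasurable (fun x => (Real.sqrt (1 + (y x) ^ 2))⁻¹)
        (volume.restrict (Iio x₁)) := by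
      apply Continuous.aestronglyMeasurable
      exact (Continuous.sqrt (by fun_prop)).inv₀ fun x => (hsqy x).ne'
    refine Integrable.mono' hGi (hGi.aestronglyMeasurable.mul hm) ?_
    filter_upwards [ae_restrict_mem measurableSet_Iio] with x hx1
    have h3 := hG0 x hx1
    rw [Real.norm_eq_abs, div_eq_mul_inv, abs_mul, abs_of_nonneg h3, abs_of_nonneg (by positivity)]
    apply mul_le_of_le_one_right h3
    apply inv_le_one_of_one_le₀
    apply Real.one_le_sqrt.mpr; nlinarith [sq_nonneg (y x)]
  have hGψi : IntegrableOn (fun x => (G x : ℂ) * ψ x * E x) (Iio x₁) := by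
    have e : EqOn (fun x => B x * q x) (fun x => (G x : ℂ) * ψ x * E x) (Iio x₁) := by
      intro x hx1
      simp only [hB]; rw [indicator_of_mem hx1]
      have := hq0 x; field_simp
    have hm : AEStronglyMeasurable (fun x => (G x : ℂ) * ψ x * E x) (volume.restrict (Iio x₁)) := by
      have hqc : Continuous q := continuous_iff_continuousAt.mpr fun x => (hqd x).continuousAt
      refine AEStronglyMeasurable.congr
        ((hBm.mul hqc.measurable).aestronglyMeasurable) ?_
      filter_upwards [ae_restrict_mem measurableSet_Iio] with x hx1
      exact e hx1
    refine Integrable.mono' (hGi.const_mul M) hm ?_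
    filter_upwards [ae_restrict_mem measurableSet_Iio] with x hx1
    rw [norm_mul, norm_mul, hEn, Complex.norm_real, Real.norm_eq_abs, abs_of_nonneg (hG0 x hx1),
      mul_one, mul_comm M]
    have := hG0 x hx1
    gcongr; exact hψb x hx1
  have hB'i' : IntegrableOn B' (Iio x₁) := by
    have h1 : IntegrableOn (fun x => (G x : ℂ) * ψ x * E x - B' x) (Iio x₁) := by
      refine Integrable.mono' (hki.const_mul ((C₀ + C₁ + 1 + N) * M)) 
        (hGψi.aestronglyMeasurable.sub hB'm.aestronglyMeasurable) ?_
      filter_upwards [ae_restrict_mem measurableSet_Iio] with x hx1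
      exact key x hx1
    have := hGψi.sub h1
    refine this.congr (ae_of_all _ fun x => ?_)
    simp
  have hB'i : Integrable B' := by
    have := hB'i'.integrable_indicator measurableSet_Iio
    refine this.congr (ae_of_all _ fun x => ?_)
    by_cases hx1 : x ∈ Iio x₁
    · rw [indicator_of_mem hx1]
    · rw [indicator_of_notMem hx1]; simp only [hB']; rw [indicator_of_notMem hx1]
  have hzero : ∫ x, B' x = 0 := integral_eq_zero_of_hasDerivAt_of_integrable hBd hB'i hBi
  have hzero' : ∫ x in Iio x₁, B' x = 0 := by
    rw [← hzero, ← integral_indicator measurableSet_Iio]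
    congr 1; ext x
    by_cases hx1 : x ∈ Iio x₁
    · rw [indicator_of_mem hx1]
    · rw [indicator_of_notMem hx1]; simp only [hB']; rw [indicator_of_notMem hx1]
  have : ∫ x in Iio x₁, (G x : ℂ) * ψ x * E x = ∫ x in Iio x₁, ((G x : ℂ) * ψ x * E x - B' x) := by
    rw [integral_sub hGψi hB'i', hzero', sub_zero]
  rw [this]
  rw [← integral_const_mul]
  refine norm_integral_le_of_norm_le (hki.const_mul _) ?_
  filter_upwards [ae_restrict_mem measurableSet_Iio] with x hx1
  exact key x hx1

def lpol (m : ℕ) (x : Fin m → ℂ) : Polynomial ℂ :=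
  ∑ i : Fin m, Polynomial.C (x i) * Polynomial.X ^ (i : ℕ)

def mpol (m : ℕ) (x : Fin m → ℂ) : Polynomial ℂ := Polynomial.X ^ m + lpol m x

lemma lpol_degree (m : ℕ) (x : Fin m → ℂ) : (lpol m x).degree < m :=
  Polynomial.degree_sum_fin_lt x

lemma lpol_coeff (m : ℕ) (x : Fin m → ℂ) (j : ℕ) :
    (lpol m x).coeff j = if h : j < m then x ⟨j, h⟩ else 0 := by
  unfold lpol
  rw [Polynomial.finsetSum_coeff]
  simp only [Polynomial.coeff_C_mul_X_pow]
  split_ifs with h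
  · rw [Finset.sum_eq_single ⟨j, h⟩]
    · simp
    · intro b _ hb
      rw [if_neg]
      rintro rfl
      exact hb rfl
    · simp
  · apply Finset.sum_eq_zero
    intro i _
    rw [if_neg]
    have := i.2
    omega

lemma lpol_add (m : ℕ) (x y : Fin m → ℂ) : lpol m (x + y) = lpol m x + lpol m y := by
  simp [lpol, add_mul, Finset.sum_add_distrib]

lemma lpol_smul (m : ℕ) (s : ℝ) (x : Fin m → ℂ) :
    lpol m (s • x) = Polynomial.C (s : ℂ) * lpol m x := by
  simp [lpol, Finset.mul_sum, mul_assoc]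

lemma lpol_eq_zero (m : ℕ) (x : Fin m → ℂ) (h : lpol m x = 0) : x = 0 := by
  ext i
  have := lpol_coeff m x i
  rw [h] at this
  simpa using this.symm

lemma mpol_monic (m : ℕ) (x : Fin m → ℂ) : (mpol m x).Monic :=
  Polynomial.monic_X_pow_add (lpol_degree m x)

lemma mpol_natDegree (m : ℕ) (x : Fin m → ℂ) : (mpol m x).natDegree = m := by
  rw [Polynomial.natDegree_eq_of_degree_eq_some]
  unfold mpol
  rw [Polynomial.degree_add_eq_left_of_degree_lt, Polynomial.degree_X_pow]
  rw [Polynomial.degree_X_pow]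
  exact lpol_degree m x

lemma mpol_of_monic (m : ℕ) (p : Polynomial ℂ) (hp : p.Monic) (hd : p.natDegree = m) :
    p = mpol m (fun i => p.coeff i) := by
  have := hp.as_sum
  rw [hd] at this
  conv_lhs => rw [this]
  unfold mpol lpol
  rw [← Fin.sum_univ_eq_sum_range (fun i => Polynomial.C (p.coeff i) * Polynomial.X ^ i)]

lemma mpol_coeff_contDiff (m j : ℕ) :
    ContDiff ℝ ⊤ (fun x : Fin m → ℂ => (mpol m x).coeff j) := by
  unfold mpol
  simp only [Polynomial.coeff_add, lpol_coeff]
  by_cases h : j < m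
  · simp only [h, dif_pos]
    fun_prop
  · simp only [h, dif_neg, not_false_eq_true]
    fun_prop

def PhiMul (m n : ℕ) (z : (Fin m → ℂ) × (Fin n → ℂ)) : Fin (m + n) → ℂ :=
  fun i => (mpol m z.1 * mpol n z.2).coeff i

lemma PhiMul_contDiff (m n : ℕ) : ContDiff ℝ ⊤ (PhiMul m n) := by
  rw [contDiff_pi]
  intro i
  simp only [PhiMul, Polynomial.coeff_mul]
  apply ContDiff.sum
  intro j _
  exact ((mpol_coeff_contDiff m j.1).comp contDiff_fst).mul
    ((mpol_coeff_contDiff n j.2).comp contDiff_snd)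

lemma PhiMul_fderiv (m n : ℕ) (z w : (Fin m → ℂ) × (Fin n → ℂ)) (i : Fin (m + n)) :
    fderiv ℝ (PhiMul m n) z w i
      = (lpol m w.1 * mpol n z.2 + mpol m z.1 * lpol n w.2).coeff i := by
  have h1 : HasFDerivAt (PhiMul m n) (fderiv ℝ (PhiMul m n) z) z :=
    ((PhiMul_contDiff m n).differentiable (by simp)).differentiableAt.hasFDerivAt
  have h2 : HasDerivAt (fun s : ℝ => z + s • w) w 0 := by
    simpa using ((hasDerivAt_id (0:ℝ)).smul_const w).const_add z
  have h3 : HasDerivAt (fun s : ℝ => PhiMul m n (z + s • w)) (fderiv ℝ (PhiMul m n) z w) 0 := by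
    have := HasFDerivAt.comp_hasDerivAt (x := (0:ℝ)) (l := PhiMul m n)
      (l' := fderiv ℝ (PhiMul m n) z) (f := fun s : ℝ => z + s • w) (f' := w)
      (by simpa using h1) h2
    exact this
  have h4 := (hasDerivAt_pi.1 h3) i
  have h5 : (fun s : ℝ => PhiMul m n (z + s • w) i) = fun s : ℝ =>
      (mpol m z.1 * mpol n z.2).coeff i
      + (s : ℂ) * (lpol m w.1 * mpol n z.2 + mpol m z.1 * lpol n w.2).coeff i
      + (s : ℂ) ^ 2 * (lpol m w.1 * lpol n w.2).coeff i := by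
    ext s
    have : mpol m (z + s • w).1 * mpol n (z + s • w).2 = mpol m z.1 * mpol n z.2
      + Polynomial.C (s : ℂ) * (lpol m w.1 * mpol n z.2 + mpol m z.1 * lpol n w.2)
      + Polynomial.C ((s : ℂ) ^ 2) * (lpol m w.1 * lpol n w.2) := by
      simp only [mpol, Prod.fst_add, Prod.snd_add, Prod.smul_fst, Prod.smul_snd, lpol_add,
        lpol_smul, map_pow]
      ring
    simp only [PhiMul, this, Polynomial.coeff_add, Polynomial.coeff_C_mul]
  rw [h5] at h4
  have h6 : HasDerivAt (fun s : ℝ =>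
      (mpol m z.1 * mpol n z.2).coeff i
      + (s : ℂ) * (lpol m w.1 * mpol n z.2 + mpol m z.1 * lpol n w.2).coeff i
      + (s : ℂ) ^ 2 * (lpol m w.1 * lpol n w.2).coeff i)
      ((lpol m w.1 * mpol n z.2 + mpol m z.1 * lpol n w.2).coeff (i : ℕ)) 0 := by
    have hs : HasDerivAt (fun s : ℝ => (s : ℂ)) 1 0 := Complex.ofRealCLM.hasDerivAt
    have := ((hs.mul_const ((lpol m w.1 * mpol n z.2 + mpol m z.1 * lpol n w.2).coeff i)).const_add
      ((mpol m z.1 * mpol n z.2).coeff i)).add ((hs.pow 2).mul_const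
        ((lpol m w.1 * lpol n w.2).coeff i))
    exact this.congr_deriv (by simp)
  exact h4.unique h6

lemma PhiMul_injective (m n : ℕ) (z : (Fin m → ℂ) × (Fin n → ℂ))
    (hc : IsCoprime (mpol m z.1) (mpol n z.2)) :
    Function.Injective (fderiv ℝ (PhiMul m n) z) := by
  rw [injective_iff_map_eq_zero]
  intro w hw
  have h0 : lpol m w.1 * mpol n z.2 + mpol m z.1 * lpol n w.2 = 0 := by
    ext j
    by_cases hj : j < m + n
    · have := PhiMul_fderiv m n z w ⟨j, hj⟩
      rw [hw] at this
      simpa using this.symm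
    · rw [Polynomial.coeff_zero]
      apply Polynomial.coeff_eq_zero_of_degree_lt
      have hm : (mpol m z.1).degree = m := by
        rw [Polynomial.degree_eq_natDegree (mpol_monic m z.1).ne_zero, mpol_natDegree]
      have hn : (mpol n z.2).degree = n := by
        rw [Polynomial.degree_eq_natDegree (mpol_monic n z.2).ne_zero, mpol_natDegree]
      have hmn : ((m + n : ℕ) : WithBot ℕ) ≤ (j : WithBot ℕ) := by
        exact_mod_cast not_lt.1 hj
      refine lt_of_lt_of_le ?_ hmn
      refine lt_of_le_of_lt (Polynomial.degree_add_le _ _) (max_lt ?_ ?_)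
      · rw [Polynomial.degree_mul, hn]
        push_cast
        exact WithBot.add_lt_add_right (WithBot.natCast_ne_bot n) (lpol_degree m w.1)
      · rw [Polynomial.degree_mul, hm]
        push_cast
        exact WithBot.add_lt_add_left (WithBot.natCast_ne_bot m) (lpol_degree n w.2)
  have h1 : mpol m z.1 ∣ lpol m w.1 := by
    apply hc.dvd_of_dvd_mul_right
    exact ⟨-lpol n w.2, by linear_combination h0⟩
  have h2 : lpol m w.1 = 0 := by
    apply Polynomial.eq_zero_of_dvd_of_degree_lt h1
    rw [Polynomial.degree_eq_natDegree (mpol_monic m z.1).ne_zero, mpol_natDegree]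
    exact lpol_degree m w.1
  have h3 : lpol n w.2 = 0 := by
    rw [h2] at h0
    simpa [(mpol_monic m z.1).ne_zero] using h0
  exact Prod.ext (lpol_eq_zero _ _ h2) (lpol_eq_zero _ _ h3)

/-- Analytic family of monic polynomials of degree k. -/
def MonFam (k : ℕ) (P : ℝ → Polynomial ℂ) : Prop :=
  (∀ t, (P t).Monic) ∧ (∀ t, (P t).natDegree = k) ∧ ∀ j, AnalyticAt ℝ (fun t => (P t).coeff j) 0

lemma monFam_mpol (m : ℕ) (x : ℝ → Fin m → ℂ) (hx : AnalyticAt ℝ x 0) :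
    MonFam m (fun t => mpol m (x t)) := by
  refine ⟨fun t => mpol_monic _ _, fun t => mpol_natDegree _ _, fun j => ?_⟩
  exact (((mpol_coeff_contDiff m j).contDiffAt (x := x 0)).analyticAt).comp hx

lemma hensel (m n : ℕ) (P : ℝ → Polynomial ℂ) (hP : MonFam (m + n) P)
    (g0 h0 : Polynomial ℂ) (hg : g0.Monic) (hh : h0.Monic) (hgd : g0.natDegree = m)
    (hhd : h0.natDegree = n) (hc : IsCoprime g0 h0) (hP0 : P 0 = g0 * h0) :
    ∃ G K : ℝ → Polynomial ℂ, MonFam m G ∧ MonFam n K ∧ ∀ᶠ t in 𝓝 (0:ℝ), P t = G t * K t := by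
  set z : (Fin m → ℂ) × (Fin n → ℂ) := (fun i => g0.coeff i, fun i => h0.coeff i) with hz
  have hg' : mpol m z.1 = g0 := (mpol_of_monic m g0 hg hgd).symm
  have hh' : mpol n z.2 = h0 := (mpol_of_monic n h0 hh hhd).symm
  have hinj := PhiMul_injective m n z (by rw [hg', hh']; exact hc)
  have hfr : Module.finrank ℝ ((Fin m → ℂ) × (Fin n → ℂ)) = Module.finrank ℝ (Fin (m+n) → ℂ) := by
    rw [Module.finrank_prod, Module.finrank_pi_fintype, Module.finrank_pi_fintype,
      Module.finrank_pi_fintype]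
    simp [add_mul]
  let L := (LinearEquiv.ofInjectiveOfFinrankEq
    ((fderiv ℝ (PhiMul m n) z) : _ →ₗ[ℝ] _) hinj hfr).toContinuousLinearEquiv
  have hL : HasFDerivAt (PhiMul m n) (L : _ →L[ℝ] _) z := by
    have h1 : HasFDerivAt (PhiMul m n) (fderiv ℝ (PhiMul m n) z) z :=
      ((PhiMul_contDiff m n).differentiable (by simp)).differentiableAt.hasFDerivAt
    have : (L : _ →L[ℝ] _) = fderiv ℝ (PhiMul m n) z := by
      ext w
      all_goals rfl
    rw [this]; exact h1
  have hcd : ContDiffAt ℝ ⊤ (PhiMul m n) z := (PhiMul_contDiff m n).contDiffAt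
  have hS := hcd.hasStrictFDerivAt' hL (by simp)
  have hinv := (hcd.to_localInverse hL (by simp)).analyticAt
  have hri := hS.eventually_right_inverse
  set c : ℝ → Fin (m + n) → ℂ := fun t i => (P t).coeff i with hcdef
  have hca : AnalyticAt ℝ c 0 := by
    rw [analyticAt_pi_iff]
    intro i
    exact hP.2.2 i
  have hc0 : c 0 = PhiMul m n z := by
    ext i
    simp only [hcdef, PhiMul, hg', hh', hP0]
  rw [← hc0] at hinv hri
  set Y := hcd.localInverse hL (by simp) with hY
  have hYc : AnalyticAt ℝ (fun t => Y (c t)) 0 := hinv.comp hca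
  refine ⟨fun t => mpol m (Y (c t)).1, fun t => mpol n (Y (c t)).2, monFam_mpol m _ ?_,
    monFam_mpol n _ ?_, ?_⟩
  · exact analyticAt_fst.comp hYc
  · exact analyticAt_snd.comp hYc
  · filter_upwards [hca.continuousAt.eventually hri] with t ht
    have hmon : (mpol m (Y (c t)).1 * mpol n (Y (c t)).2).Monic := (mpol_monic _ _).mul (mpol_monic _ _)
    have hdeg : (mpol m (Y (c t)).1 * mpol n (Y (c t)).2).natDegree = m + n := by
      rw [(mpol_monic _ _).natDegree_mul (mpol_monic _ _), mpol_natDegree, mpol_natDegree]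
    rw [mpol_of_monic (m+n) (P t) (hP.1 t) (hP.2.1 t), mpol_of_monic (m+n) _ hmon hdeg]
    congr 1
    exact ht.symm

def HasPx (P : ℝ → Polynomial ℂ) : Prop :=
  ∃ N : ℕ, 0 < N ∧ ∃ l : List (ℝ → ℂ), (∀ ρ ∈ l, AnalyticAt ℝ ρ 0) ∧
    ∀ᶠ t in 𝓝 (0:ℝ), P (t ^ N) = (l.map (fun ρ => Polynomial.X - Polynomial.C (ρ t))).prod

lemma tendsto_pow_zero (N : ℕ) (hN : 0 < N) : Tendsto (fun t : ℝ => t ^ N) (𝓝 0) (𝓝 0) := by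
  have : ContinuousAt (fun t : ℝ => t ^ N) 0 := by fun_prop
  simpa [ContinuousAt, hN.ne'] using this

lemma analyticAt_comp_pow {F : Type*} [NormedAddCommGroup F] [NormedSpace ℝ F]
    (N : ℕ) (hN : 0 < N) (ρ : ℝ → F) (h : AnalyticAt ℝ ρ 0) :
    AnalyticAt ℝ (fun t : ℝ => ρ (t ^ N)) 0 := by
  have h1 : AnalyticAt ℝ (fun t : ℝ => t ^ N) 0 := by fun_prop
  exact AnalyticAt.fun_comp (g := ρ) (f := fun t : ℝ => t ^ N) (by simpa [hN.ne'] using h) h1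

lemma HasPx.ramify {P : ℝ → Polynomial ℂ} (M : ℕ) (hM : 0 < M) (h : HasPx (fun t => P (t ^ M))) :
    HasPx P := by
  obtain ⟨N, hN, l, hl, h⟩ := h
  refine ⟨N * M, by positivity, l, hl, ?_⟩
  filter_upwards [h] with t ht
  rw [pow_mul]; exact ht

lemma HasPx.congr {P Q : ℝ → Polynomial ℂ} (h : HasPx P) (hPQ : ∀ᶠ t in 𝓝 (0:ℝ), Q t = P t) :
    HasPx Q := by
  obtain ⟨N, hN, l, hl, h⟩ := h
  refine ⟨N, hN, l, hl, ?_⟩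
  filter_upwards [h, (tendsto_pow_zero N hN).eventually hPQ] with t ht ht2
  rw [ht2, ht]

lemma HasPx.mul {G K : ℝ → Polynomial ℂ} (hG : HasPx G) (hK : HasPx K) :
    HasPx (fun t => G t * K t) := by
  obtain ⟨N, hN, l, hl, h⟩ := hG
  obtain ⟨N', hN', l', hl', h'⟩ := hK
  refine ⟨N * N', by positivity, (l.map (fun ρ t => ρ (t ^ N'))) ++ (l'.map (fun ρ t => ρ (t ^ N))),
    ?_, ?_⟩
  · intro ρ hρ
    rw [List.mem_append, List.mem_map, List.mem_map] at hρ
    rcases hρ with ⟨ρ', h1, rfl⟩ | ⟨ρ', h1, rfl⟩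
    · exact analyticAt_comp_pow N' hN' ρ' (hl _ h1)
    · exact analyticAt_comp_pow N hN ρ' (hl' _ h1)
  · filter_upwards [(tendsto_pow_zero N' hN').eventually h, (tendsto_pow_zero N hN).eventually h']
      with t h1 h2
    rw [← pow_mul] at h1 h2
    rw [mul_comm N N', h1, mul_comm N' N, h2]
    simp [List.map_map, Function.comp_def]

lemma HasPx.shift {Q : ℝ → Polynomial ℂ} (hQ : HasPx Q) (c : ℝ → ℂ) (hc : AnalyticAt ℝ c 0) :
    HasPx (fun t => (Q t).comp (Polynomial.X + Polynomial.C (c t))) := by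
  obtain ⟨N, hN, l, hl, h⟩ := hQ
  refine ⟨N, hN, l.map (fun ρ t => ρ t - c (t ^ N)), ?_, ?_⟩
  · intro ρ hρ
    rw [List.mem_map] at hρ
    obtain ⟨ρ', h1, rfl⟩ := hρ
    exact (hl _ h1).sub (analyticAt_comp_pow N hN c hc)
  · filter_upwards [h] with t ht
    rw [ht]
    clear h ht hl
    induction l with
    | nil => simp
    | cons a l ih =>
      simp only [List.map_cons, List.prod_cons, Polynomial.mul_comp, ih]
      congr 1
      simp
      ring

lemma HasPx.scale {Q : ℝ → Polynomial ℂ} (hQ : HasPx Q) (c : ℝ → ℂ) (hc : AnalyticAt ℝ c 0) :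
    HasPx (fun t => (Q t).scaleRoots (c t)) := by
  obtain ⟨N, hN, l, hl, h⟩ := hQ
  refine ⟨N, hN, l.map (fun ρ t => c (t ^ N) * ρ t), ?_, ?_⟩
  · intro ρ hρ
    rw [List.mem_map] at hρ
    obtain ⟨ρ', h1, rfl⟩ := hρ
    exact (analyticAt_comp_pow N hN c hc).mul (hl _ h1)
  · filter_upwards [h] with t ht
    rw [ht]
    clear h ht hl
    induction l with
    | nil => simp
    | cons a l ih =>
      simp only [List.map_cons, List.prod_cons, Polynomial.mul_scaleRoots_of_noZeroDivisors, ih]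
      congr 1
      rw [Polynomial.X_sub_C_scaleRoots, mul_comm]

lemma coeff_X_sub_C_pow' (c : ℂ) (i j : ℕ) : ((Polynomial.X - Polynomial.C c) ^ i).coeff j
    = (-c) ^ (i - j) * (i.choose j : ℂ) := by
  rw [sub_eq_add_neg, ← Polynomial.C_neg, Polynomial.coeff_X_add_C_pow]

lemma comp_coeff (k : ℕ) (p : Polynomial ℂ) (hp : p.natDegree = k) (c : ℂ) (j : ℕ) :
    (p.comp (Polynomial.X - Polynomial.C c)).coeff j
      = ∑ i ∈ Finset.range (k + 1), p.coeff i * ((-c) ^ (i - j) * (i.choose j : ℂ)) := by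
  rw [Polynomial.comp, Polynomial.eval₂_eq_sum_range, hp, Polynomial.finsetSum_coeff]
  apply Finset.sum_congr rfl
  intro i _
  rw [Polynomial.coeff_C_mul, coeff_X_sub_C_pow']

lemma px_reduced (k : ℕ) (hk : 0 < k) (ih : ∀ m < k, ∀ P, MonFam m P → HasPx P)
    (Q : ℝ → Polynomial ℂ) (hQ : MonFam k Q) (hQ1 : ∀ t, (Q t).coeff (k - 1) = 0) : HasPx Q := by
  classical
  by_cases hall : ∀ j < k, ∀ᶠ t in 𝓝 (0:ℝ), (Q t).coeff j = 0
  · refine ⟨1, one_pos, List.replicate k (fun _ => 0), ?_, ?_⟩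
    · intro ρ hρ
      rw [List.eq_of_mem_replicate hρ]
      exact analyticAt_const
    · have : ∀ᶠ t in 𝓝 (0:ℝ), ∀ j ∈ Finset.range k, (Q t).coeff j = 0 := by
        rw [Filter.eventually_all_finset]
        intro j hj
        exact hall j (Finset.mem_range.1 hj)
      filter_upwards [this] with t ht
      rw [pow_one, List.map_replicate, List.prod_replicate, Polynomial.C_0, sub_zero]
      ext j
      rw [Polynomial.coeff_X_pow]
      split_ifs with h
      · have h1 := hQ.1 t
        rw [Polynomial.Monic, Polynomial.leadingCoeff, hQ.2.1 t] at h1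
        rw [h]; exact h1
      · rcases lt_or_gt_of_ne h with h | h
        · exact ht j (Finset.mem_range.2 h)
        · apply Polynomial.coeff_eq_zero_of_natDegree_lt
          rw [hQ.2.1 t]; exact h
  push Not at hall
  have hfac : ∀ j, ∃ m : ℕ, ∃ u : ℝ → ℂ, (¬ (∀ᶠ t in 𝓝 (0:ℝ), (Q t).coeff j = 0)) →
      AnalyticAt ℝ u 0 ∧ u 0 ≠ 0 ∧ ∀ᶠ t in 𝓝 (0:ℝ), (Q t).coeff j = t ^ m • u t := by
    intro j
    by_cases hj : ∀ᶠ t in 𝓝 (0:ℝ), (Q t).coeff j = 0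
    · exact ⟨0, 0, fun h => absurd hj h⟩
    · obtain ⟨m, u, h1, h2, h3⟩ := (hQ.2.2 j).exists_eventuallyEq_pow_smul_nonzero_iff.2 hj
      exact ⟨m, u, fun _ => ⟨h1, h2, by simpa using h3⟩⟩
  choose m u hmu using hfac
  set J := (Finset.range k).filter (fun j => ¬ (∀ᶠ t in 𝓝 (0:ℝ), (Q t).coeff j = 0)) with hJ
  have hJne : J.Nonempty := by
    obtain ⟨j, hj, hj2⟩ := hall
    exact ⟨j, by rw [hJ, Finset.mem_filter, Finset.mem_range]; exact ⟨hj, by simpa using hj2⟩⟩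
  set F := k.factorial with hF
  have hFpos : 0 < F := Nat.factorial_pos k
  set w : ℕ → ℕ := fun j => m j * (F / (k - j)) with hw
  obtain ⟨j0, hj0, hmin⟩ := J.exists_min_image w hJne
  set p := w j0 with hp
  have hwF : ∀ j < k, F * m j = (k - j) * w j := by
    intro j hj
    have : (k - j) ∣ F := Nat.dvd_factorial (by omega) (by omega)
    obtain ⟨q, hq⟩ := this
    simp only [hw]
    rw [hq, Nat.mul_div_cancel_left _ (by omega)]
    ring
  set dd : ℝ → Fin k → ℂ := fun t j => if (j : ℕ) ∈ J then
    ((t ^ ((k - j) * (w j - p)) : ℝ) : ℂ) * u j (t ^ F) else 0 with hdd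
  have hdda : AnalyticAt ℝ dd 0 := by
    rw [analyticAt_pi_iff]
    intro j
    by_cases hj : (j : ℕ) ∈ J
    · simp only [hdd, hj, if_true]
      have h1 := (hmu j (Finset.mem_filter.1 hj).2).1
      have h2 : AnalyticAt ℝ (fun t : ℝ => ((t ^ ((k - j) * (w j - p)) : ℝ) : ℂ)) 0 := by
        have : AnalyticAt ℝ (fun t : ℝ => (t ^ ((k - (j:ℕ)) * (w j - p)) : ℝ)) 0 := by fun_prop
        exact (Complex.ofRealCLM.analyticAt _).comp this
      exact h2.mul (analyticAt_comp_pow F hFpos _ h1)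
    · simp only [hdd, hj, if_false]
      exact analyticAt_const
  set R : ℝ → Polynomial ℂ := fun t => mpol k (dd t) with hR
  have hRfam : MonFam k R := monFam_mpol k dd hdda
  have hRcoeff : ∀ t, ∀ j : Fin k, (R t).coeff j = dd t j := by
    intro t j
    simp only [hR, mpol, Polynomial.coeff_add, Polynomial.coeff_X_pow, lpol_coeff]
    rw [if_neg (by have := j.2; omega)]
    simp
  suffices HasPx R by
    refine HasPx.ramify F hFpos ((this.scale (fun t => ((t ^ p : ℝ) : ℂ)) ?_).congr ?_)
    · have : AnalyticAt ℝ (fun t : ℝ => (t ^ p : ℝ)) 0 := by fun_prop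
      exact (Complex.ofRealCLM.analyticAt _).comp this
    · have : ∀ᶠ t in 𝓝 (0:ℝ), ∀ j ∈ Finset.range k, (Q (t ^ F)).coeff j =
          if j ∈ J then (t ^ F) ^ (m j) • u j (t ^ F) else 0 := by
        rw [Filter.eventually_all_finset]
        intro j hj
        by_cases hjJ : j ∈ J
        · simp only [hjJ, if_true]
          exact (tendsto_pow_zero F hFpos).eventually (hmu j (Finset.mem_filter.1 hjJ).2).2.2
        · simp only [hjJ, if_false]
          apply (tendsto_pow_zero F hFpos).eventually (p := fun t => (Q t).coeff j = 0)
          by_contra hcon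
          exact hjJ (Finset.mem_filter.2 ⟨hj, hcon⟩)
      filter_upwards [this] with t ht
      ext j
      rw [Polynomial.coeff_scaleRoots, hRfam.2.1]
      rcases lt_trichotomy j k with h | h | h
      · rw [ht j (Finset.mem_range.2 h), hRcoeff t ⟨j, h⟩]
        simp only [hdd]
        by_cases hjJ : j ∈ J
        · simp only [hjJ, if_true]
          have h1 : (t ^ F) ^ m j = t ^ ((k - j) * (w j - p)) * (t ^ p) ^ (k - j) := by
            rw [← pow_mul, ← pow_mul, ← pow_add, hwF j h]
            congr 1
            have := hmin j hjJ
            rw [mul_comm p, ← mul_add]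
            congr 1
            omega
          rw [h1]
          simp only [Complex.real_smul]
          push_cast
          ring
        · simp only [hjJ, if_false, zero_mul]
      · have h1 := hQ.1 (t ^ F)
        rw [Polynomial.Monic, Polynomial.leadingCoeff, hQ.2.1] at h1
        have h2 := hRfam.1 t
        rw [Polynomial.Monic, Polynomial.leadingCoeff, hRfam.2.1] at h2
        rw [h, h1, h2]; simp
      · rw [Polynomial.coeff_eq_zero_of_natDegree_lt (by rw [hQ.2.1]; exact h),
          Polynomial.coeff_eq_zero_of_natDegree_lt (by rw [hRfam.2.1]; exact h), zero_mul]
  have hR1 : (R 0).coeff (k - 1) = 0 := by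
    rw [hRcoeff 0 ⟨k - 1, by omega⟩]
    simp only [hdd]
    rw [if_neg]
    intro h
    exact (Finset.mem_filter.1 h).2 (Eventually.of_forall hQ1)
  have hj0k : j0 < k := Finset.mem_range.1 (Finset.mem_filter.1 hj0).1
  have hR2 : (R 0).coeff j0 ≠ 0 := by
    rw [hRcoeff 0 ⟨j0, hj0k⟩]
    simp only [hdd, hj0, if_true, hp, Nat.sub_self, mul_zero, pow_zero, ne_eq, hFpos.ne',
      not_false_eq_true, zero_pow]
    simpa using (hmu j0 (Finset.mem_filter.1 hj0).2).2.1
  have hR0 : R 0 ≠ 0 := (hRfam.1 0).ne_zero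
  obtain ⟨z, hz⟩ := IsAlgClosed.exists_root (R 0) (by
    rw [Polynomial.degree_eq_natDegree hR0, hRfam.2.1]
    exact_mod_cast hk.ne')
  obtain ⟨h0, hfac, hnd⟩ := Polynomial.exists_eq_pow_rootMultiplicity_mul_and_not_dvd (R 0) hR0 z
  set mm := (R 0).rootMultiplicity z with hmm
  have hmpos : 0 < mm := (Polynomial.rootMultiplicity_pos hR0).2 hz
  have hXm : ((Polynomial.X - Polynomial.C z) ^ mm).Monic := (Polynomial.monic_X_sub_C z).pow mm
  have hh0 : h0.Monic := hXm.of_mul_monic_left (by rw [← hfac]; exact hRfam.1 0)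
  have hdeg : k = mm + h0.natDegree := by
    have := hRfam.2.1 0
    rw [hfac, hXm.natDegree_mul hh0, Polynomial.natDegree_pow, Polynomial.natDegree_X_sub_C] at this
    omega
  have hmk : mm < k := by
    by_contra hcon
    have h1 : h0.natDegree = 0 := by omega
    have h2 : mm = k := by omega
    have h3 : h0 = 1 := Polynomial.eq_one_of_monic_natDegree_zero hh0 h1
    rw [h3, mul_one, h2] at hfac
    rw [hfac, coeff_X_sub_C_pow'] at hR1
    have h4 : k - (k - 1) = 1 := by omega
    rw [h4, Nat.choose_symm_of_eq_add (b := 1) (by omega)] at hR1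
    have hz0 : z = 0 := by
      have : (k : ℂ) ≠ 0 := by exact_mod_cast hk.ne'
      simpa [this] using hR1
    apply hR2
    rw [hfac, hz0, Polynomial.C_0, sub_zero, Polynomial.coeff_X_pow, if_neg hj0k.ne]
  have hcop : IsCoprime ((Polynomial.X - Polynomial.C z) ^ mm) h0 :=
    (((Polynomial.irreducible_X_sub_C z).coprime_iff_not_dvd).2 hnd).pow_left
  obtain ⟨G, K, hG, hK, hGK⟩ := hensel mm h0.natDegree R (by rw [← hdeg]; exact hRfam)
    _ h0 hXm hh0 (by rw [Polynomial.natDegree_pow, Polynomial.natDegree_X_sub_C, mul_one]) rfl hcop hfac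
  exact ((ih _ hmk G hG).mul (ih _ (by omega) K hK)).congr hGK

theorem puiseux (k : ℕ) : ∀ P, MonFam k P → HasPx P := by
  induction k using Nat.strong_induction_on with
  | _ k ih =>
    intro P hP
    rcases Nat.eq_zero_or_pos k with rfl | hk
    · refine ⟨1, one_pos, [], by simp, Eventually.of_forall fun t => ?_⟩
      simpa using Polynomial.eq_one_of_monic_natDegree_zero (hP.1 _) (hP.2.1 _)
    · set c : ℝ → ℂ := fun t => (P t).coeff (k - 1) / k with hc
      have hca : AnalyticAt ℝ c 0 := by
        have := hP.2.2 (k - 1)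
        simp only [hc, div_eq_mul_inv]
        exact this.mul analyticAt_const
      have hred := px_reduced k hk ih (fun t => (P t).comp (Polynomial.X - Polynomial.C (c t))) ?_ ?_
      · refine (hred.shift c hca).congr (Eventually.of_forall fun t => ?_)
        rw [Polynomial.comp_assoc]
        simp
      · refine ⟨fun t => (hP.1 t).comp (Polynomial.monic_X_sub_C _) (by simp), fun t => ?_, fun j => ?_⟩
        · rw [Polynomial.natDegree_comp, hP.2.1]; simp
        · have : (fun t => ((P t).comp (Polynomial.X - Polynomial.C (c t))).coeff j) = fun t =>
            ∑ i ∈ Finset.range (k + 1), (P t).coeff i * ((-c t) ^ (i - j) * (i.choose j : ℂ)) := by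
            ext t; exact comp_coeff k _ (hP.2.1 t) _ j
          rw [this]
          apply Finset.analyticAt_fun_sum
          intro i _
          exact (hP.2.2 i).mul ((hca.neg.pow _).mul analyticAt_const)
      · intro t
        rw [comp_coeff k _ (hP.2.1 t)]
        obtain ⟨k', rfl⟩ : ∃ k', k = k' + 1 := ⟨k - 1, by omega⟩
        have h1 := hP.1 t
        rw [Polynomial.Monic, Polynomial.leadingCoeff, hP.2.1 t] at h1
        rw [Finset.sum_range_succ, Finset.sum_range_succ, Finset.sum_eq_zero, h1]
        · simp only [hc]
          have : ((k' : ℂ) + 1) ≠ 0 := by exact_mod_cast Nat.succ_ne_zero k'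
          simp
          field_simp
          ring
        · intro i hi
          rw [Nat.add_sub_cancel, Nat.choose_eq_zero_of_lt (Finset.mem_range.1 hi)]
          simp

lemma double_series (f : ℝ × ℝ → ℝ) (hf : AnalyticAt ℝ f 0) :
    ∃ (c : ℕ → ℕ → ℝ) (M κ : ℝ), 0 < M ∧ 0 < κ ∧ (∀ i j, |c i j| ≤ M * κ ^ (i + j)) ∧
    ∀ᶠ p in 𝓝 (0 : ℝ × ℝ), HasSum (fun q : ℕ × ℕ => c q.1 q.2 * (p.1 ^ q.1 * p.2 ^ q.2)) (f p) := by
  classical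
  obtain ⟨P, hP⟩ := hf
  obtain ⟨R, hR⟩ := hP
  obtain ⟨r, hr0, hrR⟩ : ∃ r : NNReal, 0 < r ∧ (r : ℝ≥0∞) < P.radius := by
    obtain ⟨r, h1, h2⟩ := ENNReal.lt_iff_exists_nnreal_btwn.1 (lt_of_lt_of_le hR.r_pos hR.r_le)
    exact ⟨r, by exact_mod_cast h1, h2⟩
  obtain ⟨M, hM, hPM⟩ := P.norm_le_div_pow_of_pos_of_lt_radius hr0 hrR
  have hr0' : (0:ℝ) < r := hr0
  set e : (n : ℕ) → Finset (Fin n) → Fin n → ℝ × ℝ := fun n s => s.piecewise (fun _ => (1, 0)) (fun _ => (0, 1))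
    with he
  set q : ℕ → ℕ → ℝ := fun n i => ∑ s ∈ Finset.powersetCard i (Finset.univ : Finset (Fin n)), P n (e n s)
    with hq
  have hPn : ∀ n (a b : ℝ), P n (fun _ => (a, b)) =
      ∑ ij ∈ Finset.HasAntidiagonal.antidiagonal n, q (ij.1 + ij.2) ij.1 * (a ^ ij.1 * b ^ ij.2) := by
    intro n a b
    have h1 : (fun _ : Fin n => ((a, b) : ℝ × ℝ)) = (fun _ => a • ((1:ℝ), (0:ℝ))) + (fun _ => b • ((0:ℝ), (1:ℝ))) := by
      ext i <;> simp
    rw [h1, ContinuousMultilinearMap.map_add_univ, ← Finset.powerset_univ, Finset.sum_powerset,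
      Finset.Nat.sum_antidiagonal_eq_sum_range_succ (fun i j => q (i + j) i * (a ^ i * b ^ j))]
    simp only [Finset.card_univ, Fintype.card_fin]
    apply Finset.sum_congr rfl
    intro i hi
    have hi' : i ≤ n := by simpa [Nat.lt_succ_iff] using hi
    rw [Nat.add_sub_cancel' hi', hq]
    simp only [Finset.sum_mul]
    apply Finset.sum_congr rfl
    intro s hs
    have hs' : s.card = i := (Finset.mem_powersetCard.1 hs).2
    have h2 : s.piecewise (fun _ => a • ((1:ℝ), (0:ℝ))) (fun _ => b • ((0:ℝ), (1:ℝ)))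
        = fun k => (if k ∈ s then a else b) • e n s k := by
      ext k <;> by_cases hk : k ∈ s <;> simp [he, hk]
    rw [h2, ContinuousMultilinearMap.map_smul_univ, Finset.prod_ite]
    simp only [Finset.prod_const, smul_eq_mul]
    have h3 : (Finset.univ.filter (fun x => x ∈ s)).card = i := by
      rw [← hs']; congr 1; ext; simp
    have h4 : (Finset.univ.filter (fun x => x ∉ s)).card = n - i := by
      have := Finset.card_compl s
      rw [hs', Fintype.card_fin] at this
      rw [← this]; congr 1; ext; simp
    rw [h3, h4]
    ring
  have hbound : ∀ i j, |q (i + j) i| ≤ M * (2 / r) ^ (i + j) := by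
    intro i j
    set n := i + j
    have hes : ∀ s, ‖P n (e n s)‖ ≤ M / r ^ n := by
      intro s
      have h1 := (P n).le_opNorm (e n s)
      have h2 : ∏ k, ‖e n s k‖ ≤ 1 := by
        apply Finset.prod_le_one
        · intros; exact norm_nonneg _
        · intro k _
          by_cases hk : k ∈ s <;> simp [he, hk, Prod.norm_def]
      calc _ ≤ ‖P n‖ * ∏ k, ‖e n s k‖ := h1
        _ ≤ ‖P n‖ * 1 := by gcongr
        _ ≤ _ := by rw [mul_one]; exact hPM n
    calc |q n i| ≤ ∑ s ∈ Finset.powersetCard i (Finset.univ : Finset (Fin n)), ‖P n (e n s)‖ :=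
          Finset.abs_sum_le_sum_abs _ _
      _ ≤ ∑ s ∈ Finset.powersetCard i (Finset.univ : Finset (Fin n)), M / r ^ n :=
          Finset.sum_le_sum fun s _ => hes s
      _ ≤ ∑ s ∈ (Finset.univ : Finset (Finset (Fin n))), M / r ^ n := by
          apply Finset.sum_le_sum_of_subset_of_nonneg (Finset.subset_univ _)
          intros; positivity
      _ = M * (2 / r) ^ n := by
          simp only [Finset.sum_const, Finset.card_univ, Fintype.card_finset, Fintype.card_fin, nsmul_eq_mul]
          push_cast
          rw [div_pow]; ring
  refine ⟨fun i j => q (i + j) i, M, 2 / r, hM, by positivity, hbound, ?_⟩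
  have hball : ∀ᶠ p in 𝓝 (0 : ℝ × ℝ), p ∈ Metric.eball (0 : ℝ × ℝ) R :=
    Metric.eball_mem_nhds _ hR.r_pos
  have hball2 : ∀ᶠ p in 𝓝 (0 : ℝ × ℝ), p ∈ Metric.ball (0 : ℝ × ℝ) (r / 2) :=
    Metric.ball_mem_nhds _ (by positivity)
  filter_upwards [hball, hball2] with p hp hp2
  have hs := hR.hasSum hp
  rw [zero_add] at hs
  have hp2' : ‖p‖ < r / 2 := by simpa using hp2
  have ha : |p.1| * (2 / r) < 1 := by
    have : |p.1| ≤ ‖p‖ := norm_fst_le p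
    rw [mul_div_assoc', div_lt_one hr0']; linarith
  have hb : |p.2| * (2 / r) < 1 := by
    have : |p.2| ≤ ‖p‖ := norm_snd_le p
    rw [mul_div_assoc', div_lt_one hr0']; linarith
  have hsum : Summable (fun w : ℕ × ℕ => q (w.1 + w.2) w.1 * (p.1 ^ w.1 * p.2 ^ w.2)) := by
    have h1 := (summable_geometric_of_lt_one (by positivity) ha).mul_of_nonneg
      (summable_geometric_of_lt_one (by positivity) hb) (fun _ => by positivity) (fun _ => by positivity)
    refine Summable.of_norm_bounded (h1.mul_left M) ?_
    intro w
    rw [norm_mul, norm_mul, norm_pow, norm_pow]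
    simp only [Real.norm_eq_abs]
    calc _ ≤ M * (2 / r) ^ (w.1 + w.2) * (|p.1| ^ w.1 * |p.2| ^ w.2) := by
          gcongr; exact hbound _ _
      _ = _ := by rw [mul_pow, mul_pow, pow_add]; ring
  have h2 := (Finset.HasAntidiagonal.sigmaAntidiagonalEquivProd (A := ℕ)).hasSum_iff.2 hsum.hasSum
  have h3 := h2.sigma (g := fun n => P n (fun _ => p)) (by
    intro n
    rw [show p = (p.1, p.2) from rfl, hPn n p.1 p.2]
    have := Finset.hasSum (Finset.HasAntidiagonal.antidiagonal n)
      (fun ij : ℕ × ℕ => q (ij.1 + ij.2) ij.1 * (p.1 ^ ij.1 * p.2 ^ ij.2))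
    exact this)
  rw [hs.unique h3]
  exact hsum.hasSum

lemma analyticAt_series {F : Type*} [NormedAddCommGroup F] [NormedSpace ℝ F] [CompleteSpace F]
    (C : ℕ → F) (M κ : ℝ) (hκ : 0 < κ) (hC : ∀ i, ‖C i‖ ≤ M * κ ^ i) :
    AnalyticAt ℝ (fun a : ℝ => ∑' i, a ^ i • C i) 0 ∧
    ∀ a : ℝ, |a| * κ < 1 → HasSum (fun i => a ^ i • C i) (∑' i, a ^ i • C i) := by
  have hs : ∀ a : ℝ, |a| * κ < 1 → HasSum (fun i => a ^ i • C i) (∑' i, a ^ i • C i) := by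
    intro a ha
    apply Summable.hasSum
    refine Summable.of_norm_bounded
      ((summable_geometric_of_lt_one (by positivity) ha).mul_left M) ?_
    intro i
    rw [norm_smul, norm_pow, Real.norm_eq_abs]
    calc _ ≤ |a| ^ i * (M * κ ^ i) := by gcongr; exact hC i
      _ = _ := by rw [mul_pow]; ring
  refine ⟨?_, hs⟩
  set p : FormalMultilinearSeries ℝ ℝ F := fun n => ContinuousMultilinearMap.mkPiRing ℝ (Fin n) (C n)
  have : HasFPowerSeriesAt (fun a : ℝ => ∑' i, a ^ i • C i) p 0 := by
    rw [hasFPowerSeriesAt_iff]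
    have hev : ∀ᶠ a : ℝ in 𝓝 0, |a| * κ < 1 := by
      have : ContinuousAt (fun a : ℝ => |a| * κ) 0 := by fun_prop
      exact this.eventually_lt continuousAt_const (by simp)
    filter_upwards [hev] with a ha
    have hc : ∀ n, p.coeff n = C n := by
      intro n
      simp [p, FormalMultilinearSeries.coeff]
    simp only [hc, zero_add]
    exact hs a ha
  exact this.analyticAt

abbrev SeqB := BoundedContinuousFunction ℕ ℝ

def shiftR : SeqB →L[ℝ] SeqB :=
  LinearMap.mkContinuous
    { toFun := fun x => BoundedContinuousFunction.ofNormedAddCommGroupDiscrete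
        (fun n => if n = 0 then 0 else x (n - 1)) ‖x‖ (by
          intro n
          split_ifs
          · simp
          · exact x.norm_coe_le_norm _)
      map_add' := by
        intro x y
        ext n
        by_cases h : n = 0 <;> simp [h]
      map_smul' := by
        intro c x
        ext n
        by_cases h : n = 0 <;> simp [h] } 1 (by
    intro x
    rw [one_mul]
    refine (BoundedContinuousFunction.norm_le (norm_nonneg _)).2 ?_
    intro n
    simp only [LinearMap.coe_mk, AddHom.coe_mk, BoundedContinuousFunction.coe_ofNormedAddCommGroupDiscrete]
    split_ifs
    · simp
    · exact x.norm_coe_le_norm _)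

def shiftS : SeqB →L[ℝ] SeqB :=
  LinearMap.mkContinuous
    { toFun := fun x => BoundedContinuousFunction.ofNormedAddCommGroupDiscrete
        (fun n => x (n + 1)) ‖x‖ (fun n => x.norm_coe_le_norm _)
      map_add' := by
        intro x y
        ext n
        simp
      map_smul' := by
        intro c x
        ext n
        simp } 1 (by
    intro x
    rw [one_mul]
    refine (BoundedContinuousFunction.norm_le (norm_nonneg _)).2 ?_
    intro n
    exact x.norm_coe_le_norm _)

lemma shiftR_apply (x : SeqB) (n : ℕ) : shiftR x n = if n = 0 then 0 else x (n - 1) := rfl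
lemma shiftS_apply (x : SeqB) (n : ℕ) : shiftS x n = x (n + 1) := rfl
lemma shiftR_norm : ‖shiftR‖ ≤ 1 := LinearMap.mkContinuous_norm_le _ zero_le_one _
lemma shiftS_norm : ‖shiftS‖ ≤ 1 := LinearMap.mkContinuous_norm_le _ zero_le_one _
lemma shiftS_R (x : SeqB) : shiftS (shiftR x) = x := by
  ext n
  rw [shiftS_apply, shiftR_apply]; simp
def seqE0 : SeqB := BoundedContinuousFunction.ofNormedAddCommGroupDiscrete
        (fun n => if n = 0 then 1 else 0) 1 (by intro n; split_ifs <;> simp)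
lemma seqE0_apply (n : ℕ) : seqE0 n = if n = 0 then 1 else 0 := rfl
lemma shiftS_E0 : shiftS seqE0 = 0 := by
  ext n
  rw [shiftS_apply, seqE0_apply]; simp

structure ShiftData (B : Type) [NormedAddCommGroup B] [NormedSpace ℝ B] where
  R : B →L[ℝ] B
  S : B →L[ℝ] B
  pi0 : B →L[ℝ] ℝ
  e0 : B
  hR : ‖R‖ ≤ 1
  hS : ‖S‖ ≤ 1
  hpi : ‖pi0‖ ≤ 1
  he : ‖e0‖ ≤ 1
  hSR : ∀ x, S (R x) = x
  hdec : ∀ x, x = R (S x) + pi0 x • e0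
  hpR : ∀ x, pi0 (R x) = 0
  hpe : pi0 e0 = 1
  hSe : S e0 = 0

def seqShift : ShiftData SeqB where
  R := shiftR
  S := shiftS
  pi0 := BoundedContinuousFunction.evalCLM ℝ 0
  e0 := seqE0
  hR := shiftR_norm
  hS := shiftS_norm
  hpi := by
    refine ContinuousLinearMap.opNorm_le_bound _ zero_le_one ?_
    intro x
    rw [one_mul]
    exact x.norm_coe_le_norm 0
  he := by
    refine (BoundedContinuousFunction.norm_le zero_le_one).2 ?_
    intro n
    rw [seqE0_apply]
    split_ifs <;> simp
  hSR := shiftS_R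
  hdec := by
    intro x
    ext n
    simp only [BoundedContinuousFunction.coe_add, Pi.add_apply, shiftR_apply, shiftS_apply,
        BoundedContinuousFunction.coe_smul, seqE0_apply]
    rcases n with _ | n <;> simp
  hpR := by
    intro x
    exact shiftR_apply x 0
  hpe := by
    exact seqE0_apply 0
  hSe := shiftS_E0

namespace ShiftData

variable {B : Type} [NormedAddCommGroup B] [NormedSpace ℝ B] [CompleteSpace B] (D : ShiftData B)

lemma opow_norm (A : B →L[ℝ] B) (hA : ‖A‖ ≤ 1) (n : ℕ) : ‖A ^ n‖ ≤ 1 := by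
  induction n with
  | zero => exact ContinuousLinearMap.norm_id_le
  | succ n ih =>
    rw [pow_succ]
    exact (norm_mul_le _ _).trans (mul_le_one₀ ih (norm_nonneg _) hA)

lemma decomp (k : ℕ) (x : B) :
    x = (D.R ^ k) ((D.S ^ k) x)
      + ∑ j ∈ Finset.range k, D.pi0 ((D.S ^ j) x) • (D.R ^ j) D.e0 := by
  induction k generalizing x with
  | zero => simp
  | succ k ih =>
    conv_lhs => rw [D.hdec x, ih (D.S x), map_add, map_sum]
    rw [Finset.sum_range_succ', pow_succ', pow_succ, mul_apply_eq_comp,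
      mul_apply_eq_comp, add_assoc]
    simp only [map_smul, pow_succ D.S, pow_succ' D.R, mul_apply_eq_comp, pow_zero,
      one_apply_eq_self]

/-- evaluation functional -/
def evB (b : ℝ) : B →L[ℝ] ℝ :=
  D.pi0.comp (Ring.inverse (1 - b • D.S))

lemma evB_unit (b : ℝ) (hb : |b| < 1) : IsUnit (1 - b • D.S) := by
  apply isUnit_one_sub_of_norm_lt_one
  rw [norm_smul, Real.norm_eq_abs]
  calc |b| * ‖D.S‖ ≤ |b| * 1 := by gcongr; exact D.hS
    _ < 1 := by linarith

lemma evB_of (b : ℝ) (hb : |b| < 1) (x y : B) (h : y - b • D.S y = x) : D.evB b x = D.pi0 y := by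
  have h1 : (Ring.inverse (1 - b • D.S)) x = y := by
    have h2 : x = (1 - b • D.S) y := by rw [← h]; simp
    rw [h2, ← mul_apply_eq_comp, Ring.inverse_mul_cancel _ (D.evB_unit b hb)]
    simp
  unfold evB
  rw [ContinuousLinearMap.comp_apply, h1]

lemma evB_E0 (b : ℝ) (hb : |b| < 1) : D.evB b D.e0 = 1 := by
  rw [D.evB_of b hb D.e0 D.e0 (by rw [D.hSe]; simp), D.hpe]

lemma evB_R (b : ℝ) (hb : |b| < 1) (x : B) : D.evB b (D.R x) = b * D.evB b x := by
  set y := (Ring.inverse (1 - b • D.S)) x with hy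
  have h1 : y - b • D.S y = x := by
    have : (1 - b • D.S) y = x := by
      rw [hy, ← mul_apply_eq_comp, Ring.mul_inverse_cancel _ (D.evB_unit b hb)]
      simp
    simpa using this
  rw [D.evB_of b hb x y h1, D.evB_of b hb (D.R x) (D.R x + b • y)]
  · simp [D.hpR]
  · rw [map_add, D.hSR, map_smul]
    nth_rewrite 2 [← h1]
    module

lemma evB_Rpow (b : ℝ) (hb : |b| < 1) (j : ℕ) (x : B) :
    D.evB b ((D.R ^ j) x) = b ^ j * D.evB b x := by
  induction j generalizing x with
  | zero => simp
  | succ j ih =>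
    rw [pow_succ, mul_apply_eq_comp, ih, D.evB_R b hb]
    ring

lemma analyticAt_clm_apply {E F G : Type*} [NormedAddCommGroup E] [NormedSpace ℝ E]
    [NormedAddCommGroup F] [NormedSpace ℝ F] [NormedAddCommGroup G] [NormedSpace ℝ G]
    (A : E → F →L[ℝ] G) (x : E → F) (p : E) (hA : AnalyticAt ℝ A p) (hx : AnalyticAt ℝ x p) :
    AnalyticAt ℝ (fun q => A q (x q)) p := by
  have := ContinuousLinearMap.analyticAt_bilinear (𝕜 := ℝ) (ContinuousLinearMap.id ℝ (F →L[ℝ] G)) (A p, x p)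
  exact AnalyticAt.fun_comp (f := fun q => (A q, x q)) this (hA.prod hx)

set_option maxHeartbeats 1000000 in
theorem weier (D : ShiftData B) (f : ℝ × ℝ → ℝ) (hf : AnalyticAt ℝ f 0)
    (h0 : ¬ ∀ᶠ b in 𝓝 (0:ℝ), f (0, b) = 0) :
    ∃ (k : ℕ) (X : ℕ → ℝ → ℝ) (q : ℝ × ℝ → ℝ), (∀ j, AnalyticAt ℝ (X j) 0) ∧ AnalyticAt ℝ q 0 ∧
      q 0 ≠ 0 ∧ ∀ᶠ p in 𝓝 (0 : ℝ × ℝ), f p * q p = p.2 ^ k + ∑ j ∈ Finset.range k, X j p.1 * p.2 ^ j := by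
  obtain ⟨c, M, κ, hM, hκ, hc, hsum⟩ := double_series f hf
  have hex : ∃ k, c 0 k ≠ 0 := by
    by_contra hcon
    push Not at hcon
    apply h0
    have hcont : Tendsto (fun b : ℝ => ((0:ℝ), b)) (𝓝 0) (𝓝 (0 : ℝ × ℝ)) := by
      have : ContinuousAt (fun b : ℝ => ((0:ℝ), b)) 0 := by fun_prop
      exact this
    have := hcont.eventually hsum
    filter_upwards [this] with b hb
    apply hb.unique
    convert hasSum_zero using 1
    ext ⟨i, j⟩
    rcases i with _ | i
    · simp [hcon]
    · simp
  classical
  obtain ⟨k, hk, hk'⟩ : ∃ k, c 0 k ≠ 0 ∧ ∀ j < k, c 0 j = 0 :=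
    ⟨Nat.find hex, Nat.find_spec hex, fun j hj => by simpa using Nat.find_min hex hj⟩
  set γ := c 0 k with hγ
  have hγ0 : 0 < |γ| := abs_pos.2 hk
  -- choose r
  obtain ⟨r, hr, hr1, hr2⟩ : ∃ r : ℝ, 0 < r ∧ κ * r ≤ 1 / 2 ∧ M * κ ^ (k + 1) * r * 2 ≤ |γ| / 4 := by
    have hpos : 0 < M * κ ^ (k + 1) * 8 := by positivity
    refine ⟨min (1 / (2 * κ)) (|γ| / (M * κ ^ (k + 1) * 8)), by positivity, ?_, ?_⟩
    · calc κ * _ ≤ κ * (1 / (2 * κ)) := by gcongr; exact min_le_left _ _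
        _ = 1 / 2 := by field_simp
    · calc _ ≤ M * κ ^ (k + 1) * (|γ| / (M * κ ^ (k + 1) * 8)) * 2 := by gcongr; exact min_le_right _ _
        _ = _ := by field_simp; norm_num
  set c' : ℕ → ℕ → ℝ := fun i j => c i j * r ^ j / (γ * r ^ k) with hc'
  set M' := M / (|γ| * r ^ k) with hM'
  have hM'0 : 0 < M' := by positivity
  have hcb : ∀ i j, |c' i j| ≤ M' * κ ^ i * (κ * r) ^ j := by
    intro i j
    simp only [hc', hM']
    rw [abs_div, abs_mul, abs_mul, abs_of_pos (pow_pos hr j), abs_of_pos (pow_pos hr k)]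
    calc _ ≤ (M * κ ^ (i + j)) * r ^ j / (|γ| * r ^ k) := by gcongr; exact hc i j
      _ = _ := by rw [mul_pow, pow_add]; ring
  have hκr : κ * r < 1 := by linarith
  have hRn : ∀ j, ‖D.R ^ j‖ ≤ 1 := opow_norm D.R D.hR
  have hCsum : ∀ i, Summable (fun j => c' i j • D.R ^ j) := by
    intro i
    refine Summable.of_norm_bounded
      ((summable_geometric_of_lt_one (by positivity) hκr).mul_left (M' * κ ^ i)) ?_
    intro j
    rw [norm_smul, Real.norm_eq_abs]
    calc _ ≤ |c' i j| * 1 := by gcongr; exact hRn j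
      _ ≤ _ := by rw [mul_one]; exact hcb i j
  set C : ℕ → B →L[ℝ] B := fun i => ∑' j, c' i j • D.R ^ j with hC
  have hCn : ∀ i, ‖C i‖ ≤ (M' * 2) * κ ^ i := by
    intro i
    have h1 : HasSum (fun j => M' * κ ^ i * (κ * r) ^ j) (M' * κ ^ i * (1 - κ * r)⁻¹) :=
      (hasSum_geometric_of_lt_one (by positivity) hκr).mul_left _
    have h2 := tsum_of_norm_bounded h1 (f := fun j => c' i j • D.R ^ j) (by
      intro j
      rw [norm_smul, Real.norm_eq_abs]
      calc _ ≤ |c' i j| * 1 := by gcongr; exact hRn j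
        _ ≤ _ := by rw [mul_one]; exact hcb i j)
    refine h2.trans ?_
    have : (1 - κ * r)⁻¹ ≤ 2 := by
      rw [inv_le_comm₀ (by linarith) (by norm_num)]; linarith
    calc _ ≤ M' * κ ^ i * 2 := by gcongr
      _ = _ := by ring
  obtain ⟨hTan, hTsum⟩ := analyticAt_series C (M' * 2) κ hκ hCn
  set T : ℝ → B →L[ℝ] B := fun a => ∑' i, a ^ i • C i with hT
  have hT0 : T 0 = C 0 := by
    simp only [hT]
    rw [tsum_eq_single 0]
    · simp
    · intro i hi; simp [hi]
  -- norm of T 0 - R^k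
  have hT0n : ‖T 0 - D.R ^ k‖ ≤ 1 / 4 := by
    have h1 := (hCsum 0).hasSum
    have h2 : HasSum (fun j => c' 0 (j + (k + 1)) • D.R ^ (j + (k + 1))) (C 0 - D.R ^ k) := by
      have h3 := (hasSum_nat_add_iff' (k + 1)).2 h1
      have hs : ∑ i ∈ Finset.range (k + 1), c' 0 i • D.R ^ i = D.R ^ k := by
        rw [Finset.sum_range_succ, Finset.sum_eq_zero, zero_add]
        · have : c' 0 k = 1 := by
            simp only [hc']
            rw [← hγ]; field_simp
          rw [this, one_smul]
        · intro j hj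
          have : c' 0 j = 0 := by
            simp only [hc']
            rw [hk' j (Finset.mem_range.1 hj)]; simp
          rw [this, zero_smul]
      rw [hs] at h3
      exact h3
    have h4 : HasSum (fun j => M' * (κ * r) ^ (k + 1) * (κ * r) ^ j)
        (M' * (κ * r) ^ (k + 1) * (1 - κ * r)⁻¹) :=
      (hasSum_geometric_of_lt_one (by positivity) hκr).mul_left _
    have h5 := tsum_of_norm_bounded h4 (f := fun j => c' 0 (j + (k + 1)) • D.R ^ (j + (k + 1))) (by
      intro j
      rw [norm_smul, Real.norm_eq_abs]
      calc _ ≤ |c' 0 (j + (k + 1))| * 1 := by gcongr; exact hRn _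
        _ ≤ M' * κ ^ 0 * (κ * r) ^ (j + (k + 1)) := by rw [mul_one]; exact hcb _ _
        _ = _ := by rw [pow_add]; ring)
    rw [h2.tsum_eq] at h5
    rw [hT0]
    refine h5.trans ?_
    have : (1 - κ * r)⁻¹ ≤ 2 := by
      rw [inv_le_comm₀ (by linarith) (by norm_num)]; linarith
    calc _ ≤ M' * (κ * r) ^ (k + 1) * 2 := by gcongr
      _ = (M * κ ^ (k + 1) * r * 2) / |γ| := by
          simp only [hM']; field_simp; ring
      _ ≤ (|γ| / 4) / |γ| := by gcongr
      _ = _ := by field_simp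
  set L : ℝ → B →L[ℝ] B := fun a => 1 - (D.R ^ k - T a) * D.S ^ k with hL
  have hSn : ‖D.S ^ k‖ ≤ 1 := opow_norm D.S D.hS k
  have hLan : AnalyticAt ℝ L 0 := by
    simp only [hL]
    exact analyticAt_const.sub ((analyticAt_const.sub hTan).mul analyticAt_const)
  have hLn : ∀ᶠ a in 𝓝 (0:ℝ), ‖(D.R ^ k - T a) * D.S ^ k‖ < 1 / 3 := by
    have hcont : ContinuousAt (fun a => ‖(D.R ^ k - T a) * D.S ^ k‖) 0 :=
      ((continuousAt_const.sub hTan.continuousAt).mul continuousAt_const).norm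
    refine hcont.eventually_lt continuousAt_const ?_
    calc _ ≤ ‖D.R ^ k - T 0‖ * ‖D.S ^ k‖ := norm_mul_le _ _
      _ ≤ (1 / 4) * 1 := by
        gcongr
        rw [norm_sub_rev]; exact hT0n
      _ < _ := by norm_num
  have hLu : ∀ a, ‖(D.R ^ k - T a) * D.S ^ k‖ < 1 / 3 → IsUnit (L a) := by
    intro a ha
    exact isUnit_one_sub_of_norm_lt_one (by linarith)
  set x : ℝ → B := fun a => (Ring.inverse (L a)) ((D.R ^ k) D.e0) with hx
  have hxan : AnalyticAt ℝ x 0 := by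
    simp only [hx]
    apply analyticAt_clm_apply _ _ _ _ analyticAt_const
    obtain ⟨u, hu⟩ := hLu 0 hLn.self_of_nhds
    have := analyticAt_inverse (𝕜 := ℝ) u
    rw [hu] at this
    exact AnalyticAt.fun_comp (f := L) this hLan
  have hLx : ∀ a, ‖(D.R ^ k - T a) * D.S ^ k‖ < 1 / 3 → L a (x a) = (D.R ^ k) D.e0 := by
    intro a ha
    simp only [hx]
    rw [← mul_apply_eq_comp, Ring.mul_inverse_cancel _ (hLu a ha)]
    simp
  -- the function q
  set q0 : ℝ × ℝ → ℝ := fun p => D.evB p.2 ((D.S ^ k) (x p.1)) with hq0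
  have hxan2 : AnalyticAt ℝ (fun p : ℝ × ℝ => x p.1) 0 :=
    AnalyticAt.fun_comp (f := fun p : ℝ × ℝ => p.1) (g := x) (by simpa using hxan) analyticAt_fst
  have hq0an : AnalyticAt ℝ q0 0 := by
    simp only [hq0, evB, ContinuousLinearMap.comp_apply]
    refine AnalyticAt.fun_comp (g := fun y => D.pi0 y) (D.pi0.analyticAt _) ?_
    apply analyticAt_clm_apply
    · have h1 : AnalyticAt ℝ (Ring.inverse : (B →L[ℝ] B) → (B →L[ℝ] B)) (1 - (0:ℝ) • D.S) := by
        have := analyticAt_inverse (𝕜 := ℝ) (1 : (B →L[ℝ] B)ˣ)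
        simpa using this
      refine AnalyticAt.fun_comp (g := Ring.inverse) (f := fun p : ℝ × ℝ => 1 - p.2 • D.S) h1 ?_
      exact analyticAt_const.sub (analyticAt_snd.smul analyticAt_const)
    · exact AnalyticAt.fun_comp (g := fun y => (D.S ^ k) y) ((D.S ^ k).analyticAt _) hxan2
  have hq00 : q0 0 ≠ 0 := by
    have hu := hLn.self_of_nhds
    have h1 := hLx 0 hu
    set A := (D.R ^ k - T 0) * D.S ^ k with hA
    have h2 : x 0 - (D.R ^ k) D.e0 = A (x 0) := by
      have hLA : L 0 = 1 - A := rfl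
      rw [← h1, hLA, sub_apply, one_apply_eq_self]
      abel
    have h3 : ‖A (x 0)‖ ≤ 1 / 3 * ‖x 0‖ := (A.le_opNorm _).trans (by gcongr)
    have h4 : ‖(D.R ^ k) D.e0‖ ≤ 1 := by
      calc _ ≤ ‖D.R ^ k‖ * ‖D.e0‖ := ContinuousLinearMap.le_opNorm _ _
        _ ≤ 1 := mul_le_one₀ (hRn k) (norm_nonneg _) D.he
    have h5 : ‖x 0‖ ≤ 1 + 1 / 3 * ‖x 0‖ := by
      have : x 0 = (D.R ^ k) D.e0 + A (x 0) := by rw [← h2]; abel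
      calc ‖x 0‖ = ‖(D.R ^ k) D.e0 + A (x 0)‖ := congrArg norm this
        _ ≤ _ := (norm_add_le _ _).trans (add_le_add h4 h3)
    have h6 : q0 0 = D.pi0 ((D.S ^ k) (x 0)) := by
      simp only [hq0, evB, ContinuousLinearMap.comp_apply]
      simp
    have h7 : D.pi0 ((D.S ^ k) ((D.R ^ k) D.e0)) = 1 := by
      have : ∀ j, (D.S ^ j) ((D.R ^ j) D.e0) = D.e0 := by
        intro j
        induction j with
        | zero => simp
        | succ j ih =>
          rw [pow_succ, pow_succ', mul_apply_eq_comp, mul_apply_eq_comp, D.hSR, ih]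
      rw [this, D.hpe]
    have h8 : |q0 0 - 1| ≤ 1 / 2 := by
      have h10 : q0 0 - 1 = D.pi0 ((D.S ^ k) (A (x 0))) := by
        rw [← h2, map_sub, map_sub, h7, h6]
      rw [h10]
      calc _ ≤ ‖D.pi0‖ * ‖(D.S ^ k) (A (x 0))‖ := ContinuousLinearMap.le_opNorm _ _
        _ ≤ 1 * (1 * ‖A (x 0)‖) := by
          gcongr
          · exact D.hpi
          · exact (ContinuousLinearMap.le_opNorm _ _).trans (by gcongr)
        _ ≤ 1 / 2 := by linarith
    intro h9
    rw [h9] at h8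
    norm_num at h8
  -- identity
  have hid : ∀ a b, |a| * κ < 1 → |b| < 1 → ‖(D.R ^ k - T a) * D.S ^ k‖ < 1 / 3 →
      HasSum (fun q : ℕ × ℕ => c q.1 q.2 * (a ^ q.1 * (r * b) ^ q.2)) (f (a, r * b)) →
      b ^ k = f (a, r * b) / (γ * r ^ k) * q0 (a, b)
        + ∑ j ∈ Finset.range k, D.pi0 ((D.S ^ j) (x a)) * b ^ j := by
    intro a b ha hb hn hfs
    have h1 := hLx a hn
    have h2 : (D.R ^ k) D.e0 = T a ((D.S ^ k) (x a))
        + ∑ j ∈ Finset.range k, D.pi0 ((D.S ^ j) (x a)) • (D.R ^ j) D.e0 := by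
      have h3 := D.decomp k (x a)
      rw [← h1]
      simp only [hL]
      rw [sub_apply, mul_apply_eq_comp, sub_apply,
        one_apply_eq_self]
      nth_rewrite 1 [h3]
      abel
    have h4 : ∀ y, D.evB b (T a y) = f (a, r * b) / (γ * r ^ k) * D.evB b y := by
      intro y
      set Λ : (B →L[ℝ] B) →L[ℝ] ℝ := (D.evB b).comp (ContinuousLinearMap.apply ℝ B y) with hΛ
      have hΛa : ∀ A, Λ A = D.evB b (A y) := fun A => rfl
      have h5 : HasSum (fun i => Λ (a ^ i • C i)) (Λ (T a)) := Λ.hasSum (hTsum a ha)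
      have h6 : ∀ i, HasSum (fun j => Λ (a ^ i • (c' i j • D.R ^ j))) (Λ (a ^ i • C i)) := by
        intro i
        exact Λ.hasSum ((hCsum i).hasSum.const_smul (a ^ i))
      have h7 : HasSum (fun q : ℕ × ℕ => Λ (a ^ q.1 • (c' q.1 q.2 • D.R ^ q.2)))
          (f (a, r * b) / (γ * r ^ k) * D.evB b y) := by
        have := (hfs.div_const (γ * r ^ k)).mul_right (D.evB b y)
        have hfe : ∀ q : ℕ × ℕ, Λ (a ^ q.1 • (c' q.1 q.2 • D.R ^ q.2)) =
          c q.1 q.2 * (a ^ q.1 * (r * b) ^ q.2) / (γ * r ^ k) * D.evB b y := by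
          intro q
          rw [map_smul, map_smul, hΛa, D.evB_Rpow b hb]
          simp only [hc', smul_eq_mul]
          rw [mul_pow]
          ring
        rw [funext hfe]
        exact this
      have h8 := h7.prod_fiberwise h6
      exact h5.unique h8
    have h9 := congrArg (D.evB b) h2
    rw [D.evB_Rpow b hb, D.evB_E0 b hb, map_add, h4, map_sum, mul_one] at h9
    rw [h9]
    simp only [hq0]
    congr 1
    apply Finset.sum_congr rfl
    intro j _
    rw [map_smul, D.evB_Rpow b hb, D.evB_E0 b hb]
    simp
  refine ⟨k, fun j a => - (r ^ k / r ^ j * D.pi0 ((D.S ^ j) (x a))),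
    fun p => q0 (p.1, p.2 / r) / γ, ?_, ?_, ?_, ?_⟩
  · intro j
    refine (analyticAt_const.mul ?_).neg
    exact AnalyticAt.fun_comp (g := fun y => D.pi0 ((D.S ^ j) y))
      ((D.pi0.comp (D.S ^ j)).analyticAt _) hxan
  · simp only [div_eq_mul_inv]
    refine AnalyticAt.mul ?_ analyticAt_const
    refine AnalyticAt.fun_comp (g := q0) (f := fun p : ℝ × ℝ => (p.1, p.2 * r⁻¹)) ?_ ?_
    · have he : ((0 : ℝ × ℝ).1, (0 : ℝ × ℝ).2 * r⁻¹) = (0 : ℝ × ℝ) := by simp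
      rw [he]; exact hq0an
    exact analyticAt_fst.prod (analyticAt_snd.mul analyticAt_const)
  · have : ((0 : ℝ × ℝ).1, (0 : ℝ × ℝ).2 / r) = (0 : ℝ × ℝ) := by simp
    simp only [this]
    exact div_ne_zero hq00 hk
  · have hev1 : ∀ᶠ p : ℝ × ℝ in 𝓝 0, |p.1| * κ < 1 := by
      have : ContinuousAt (fun p : ℝ × ℝ => |p.1| * κ) 0 := by fun_prop
      exact this.eventually_lt continuousAt_const (by simp)
    have hev2 : ∀ᶠ p : ℝ × ℝ in 𝓝 0, |p.2 / r| < 1 := by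
      have : ContinuousAt (fun p : ℝ × ℝ => |p.2 / r|) 0 := by fun_prop
      exact this.eventually_lt continuousAt_const (by simp)
    have hev3 : ∀ᶠ p : ℝ × ℝ in 𝓝 0, ‖(D.R ^ k - T p.1) * D.S ^ k‖ < 1 / 3 := by
      have : ContinuousAt (fun p : ℝ × ℝ => p.1) 0 := by fun_prop
      exact this.eventually (p := fun a => ‖(D.R ^ k - T a) * D.S ^ k‖ < 1 / 3) (by simpa using hLn)
    filter_upwards [hev1, hev2, hev3, hsum] with p h1 h2 h3 h4
    have hrb : r * (p.2 / r) = p.2 := by field_simp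
    have := hid p.1 (p.2 / r) h1 h2 h3 (by rw [hrb]; exact h4)
    rw [hrb] at this
    simp only [Prod.mk.eta] at this
    have h5 : p.2 ^ k = r ^ k * (p.2 / r) ^ k := by rw [div_pow]; field_simp
    rw [h5, this, mul_add, Finset.mul_sum, add_assoc, ← Finset.sum_add_distrib, Finset.sum_eq_zero]
    · field_simp
      ring
    · intro j _
      rw [div_pow]
      field_simp
      ring

end ShiftData

theorem weierstrass_prep (f : ℝ × ℝ → ℝ) (hf : AnalyticAt ℝ f 0)
    (h0 : ¬ ∀ᶠ b in 𝓝 (0:ℝ), f (0, b) = 0) :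
    ∃ (k : ℕ) (X : ℕ → ℝ → ℝ) (q : ℝ × ℝ → ℝ), (∀ j, AnalyticAt ℝ (X j) 0) ∧ AnalyticAt ℝ q 0 ∧
      q 0 ≠ 0 ∧ ∀ᶠ p in 𝓝 (0 : ℝ × ℝ), f p * q p = p.2 ^ k + ∑ j ∈ Finset.range k, X j p.1 * p.2 ^ j :=
  ShiftData.weier seqShift f hf h0

theorem LL.mono {C C' x₁ x₂ : ℝ} {h : ℝ → ℝ} (H : LL C x₁ h) (hC : C ≤ C') (hx : x₂ ≤ x₁) :
    LL C' x₂ h := by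
  intro x hxx
  obtain ⟨h0, h', hd, hb⟩ := H x (lt_of_lt_of_le hxx hx)
  exact ⟨h0, h', hd, hb.trans (by gcongr)⟩

theorem LL.add {C C' x₁ : ℝ} {h k : ℝ → ℝ} (H : LL C x₁ h) (K : LL C' x₁ k) :
    LL (max C C') x₁ (fun x => h x + k x) := by
  intro x hx
  obtain ⟨h0, h', hd, hb⟩ := H x hx
  obtain ⟨k0, k', kd, kb⟩ := K x hx
  refine ⟨by positivity, h' + k', hd.add kd, ?_⟩
  calc |h' + k'| ≤ |h'| + |k'| := abs_add_le _ _
    _ ≤ C * h x + C' * k x := by gcongr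
    _ ≤ max C C' * h x + max C C' * k x := by
      gcongr
      · exact le_max_left _ _
      · exact le_max_right _ _
    _ = _ := by ring

theorem LL.mul {C C' x₁ : ℝ} {h k : ℝ → ℝ} (H : LL C x₁ h) (K : LL C' x₁ k) :
    LL (C + C') x₁ (fun x => h x * k x) := by
  intro x hx
  obtain ⟨h0, h', hd, hb⟩ := H x hx
  obtain ⟨k0, k', kd, kb⟩ := K x hx
  refine ⟨by positivity, h' * k x + h x * k', hd.mul kd, ?_⟩
  calc |h' * k x + h x * k'| ≤ |h' * k x| + |h x * k'| := abs_add_le _ _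
    _ = |h'| * k x + h x * |k'| := by rw [abs_mul, abs_mul, abs_of_nonneg h0, abs_of_nonneg k0]
    _ ≤ (C * h x) * k x + h x * (C' * k x) := by gcongr
    _ = _ := by ring

theorem LL.const {x₁ c : ℝ} (hc : 0 ≤ c) : LL 0 x₁ (fun _ => c) := by
  intro x hx
  exact ⟨hc, 0, hasDerivAt_const _ _, by simp⟩

theorem LL.const_mul {C x₁ c : ℝ} {h : ℝ → ℝ} (hc : 0 ≤ c) (H : LL C x₁ h) :
    LL C x₁ (fun x => c * h x) := by
  simpa using (LL.const (x₁ := x₁) hc).mul H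

theorem LL.exp {x₁ : ℝ} (N : ℕ) : LL N x₁ (fun x => rexp (N * x)) := by
  intro x hx
  refine ⟨(Real.exp_pos _).le, N * rexp (N * x), ?_, ?_⟩
  · have h1 : HasDerivAt (fun x : ℝ => (N:ℝ) * x) N x := by
      simpa using (hasDerivAt_id x).const_mul (N:ℝ)
    exact h1.exp.congr_deriv (by ring)
  · rw [abs_of_nonneg (by positivity)]

theorem LL.rpow {C x₁ : ℝ} {h : ℝ → ℝ} (H : LL C x₁ h) (hp : ∀ x < x₁, 0 < h x) (γ : ℝ) :
    LL (|γ| * C) x₁ (fun x => h x ^ γ) := by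
  intro x hx
  obtain ⟨h0, h', hd, hb⟩ := H x hx
  have hpx := hp x hx
  refine ⟨by positivity, h' * γ * h x ^ (γ - 1), hd.rpow_const (Or.inl hpx.ne'), ?_⟩
  rw [abs_mul, abs_mul, abs_of_nonneg (Real.rpow_nonneg h0 _)]
  have : h x ^ γ = h x ^ (γ - 1) * h x := by
    rw [← Real.rpow_add_one hpx.ne']; congr 1; ring
  simp only [this]
  calc |h'| * |γ| * h x ^ (γ - 1) ≤ (C * h x) * |γ| * h x ^ (γ - 1) := by gcongr
    _ = _ := by ring

theorem LL.congr {C x₁ : ℝ} {h k : ℝ → ℝ} (H : LL C x₁ h) (e : ∀ x < x₁, k x = h x) :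
    LL C x₁ k := by
  intro x hx
  obtain ⟨h0, h', hd, hb⟩ := H x hx
  have hev : k =ᶠ[𝓝 x] h := by
    filter_upwards [Iio_mem_nhds hx] with y hy using e y hy
  rw [e x hx]
  exact ⟨h0, h', hd.congr_of_eventuallyEq hev, hb⟩

theorem LL.list_prod {x₁ : ℝ} {α : Type} (C : ℝ) (hC : 0 ≤ C) (l : List α) (h : α → ℝ → ℝ)
    (H : ∀ i ∈ l, LL C x₁ (h i)) :
    LL (l.length * C) x₁ (fun x => (l.map (fun i => h i x)).prod) := by
  induction l with
  | nil => simpa using LL.const (x₁ := x₁) zero_le_one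
  | cons a l ih =>
    have h1 := (H a (by simp)).mul (ih (fun i hi => H i (by simp [hi])))
    have : ((a :: l).length : ℝ) * C = C + l.length * C := by push_cast [List.length_cons]; ring
    rw [this]
    simpa using h1

theorem LL.finset_prod {x₁ : ℝ} {α : Type} (C : ℝ) (hC : 0 ≤ C) (l : Finset α) (h : α → ℝ → ℝ)
    (H : ∀ i ∈ l, LL C x₁ (h i)) :
    LL (l.card * C) x₁ (fun x => ∏ i ∈ l, h i x) := by
  have := LL.list_prod C hC l.toList h (fun i hi => H i (by simpa using hi))
  simpa using this

theorem LL.list_sum_C {α : Type} (l : List α) (P : α → ℝ → Prop)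
    (hmono : ∀ a, ∀ C C', C ≤ C' → P a C → P a C') (h : ∀ a ∈ l, ∃ C, P a C) :
    ∃ C, 0 ≤ C ∧ ∀ a ∈ l, P a C := by
  induction l with
  | nil => exact ⟨0, le_rfl, by simp⟩
  | cons a l ih =>
    obtain ⟨C, hC, hl⟩ := ih (fun b hb => h b (by simp [hb]))
    obtain ⟨C', ha⟩ := h a (by simp)
    refine ⟨max C C', le_max_of_le_left hC, ?_⟩
    intro b hb
    rcases List.mem_cons.1 hb with rfl | hb
    · exact hmono _ _ _ (le_max_right _ _) ha
    · exact hmono _ _ _ (le_max_left _ _) (hl b hb)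

/-- logarithmic derivative bound for analytic germs -/
theorem an1 (h : ℝ → ℝ) (hh : AnalyticAt ℝ h 0) : ∃ C : ℝ, 0 ≤ C ∧ ∀ᶠ t in 𝓝[>] (0:ℝ),
    ∃ h', HasDerivAt h h' t ∧ |t * h'| ≤ C * |h t| := by
  by_cases hz : ∀ᶠ t in 𝓝 (0:ℝ), h t = 0
  · refine ⟨0, le_rfl, ?_⟩
    have h2 : ∀ᶠ t in 𝓝 (0:ℝ), HasDerivAt h 0 t := by
      filter_upwards [hz.eventually_nhds] with t ht
      have : h =ᶠ[𝓝 t] fun _ => 0 := ht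
      exact (hasDerivAt_const t (0:ℝ)).congr_of_eventuallyEq this
    filter_upwards [nhdsWithin_le_nhds h2] with t ht
    exact ⟨0, ht, by simp⟩
  · obtain ⟨n, g, hg, hg0, hgh⟩ := hh.exists_eventuallyEq_pow_smul_nonzero_iff.2 hz
    have hcont : ContinuousAt (fun t => |t * deriv g t| - |g t|) 0 :=
      ((continuousAt_id.mul hg.deriv.continuousAt).abs.sub hg.continuousAt.abs)
    have hlt : ∀ᶠ t in 𝓝 (0:ℝ), |t * deriv g t| - |g t| < 0 :=
      hcont.eventually_lt continuousAt_const (by simpa using hg0)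
    refine ⟨n + 1, by positivity, ?_⟩
    filter_upwards [nhdsWithin_le_nhds hlt, nhdsWithin_le_nhds hgh.eventually_nhds,
      nhdsWithin_le_nhds hg.eventually_analyticAt, self_mem_nhdsWithin] with t h1 h2 h3 h4
    have h4' : (0:ℝ) < t := h4
    have h5 : HasDerivAt (fun z : ℝ => z ^ n * g z) (n * t ^ (n - 1) * g t + t ^ n * deriv g t) t :=
      (hasDerivAt_pow n t).mul h3.differentiableAt.hasDerivAt
    have h6 : h =ᶠ[𝓝 t] fun z : ℝ => z ^ n * g z := by
      filter_upwards [h2] with z hz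
      simpa using hz
    refine ⟨_, h5.congr_of_eventuallyEq h6, ?_⟩
    rw [h6.eq_of_nhds]
    have h7 : t * (n * t ^ (n - 1) * g t + t ^ n * deriv g t)
        = t ^ n * (n * g t + t * deriv g t) := by
      rcases n with _ | n
      · simp
      · rw [Nat.add_sub_cancel, pow_succ]; ring
    rw [h7, abs_mul, abs_mul]
    have : |n * g t + t * deriv g t| ≤ (n + 1) * |g t| := by
      calc _ ≤ |n * g t| + |t * deriv g t| := abs_add_le _ _
        _ ≤ n * |g t| + |g t| := by rw [abs_mul (n:ℝ), Nat.abs_cast]; linarith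
        _ = _ := by ring
    calc _ ≤ |t ^ n| * ((n + 1) * |g t|) := by gcongr
      _ = _ := by ring

theorem an_sgn (h : ℝ → ℝ) (hh : AnalyticAt ℝ h 0) : (∀ᶠ t in 𝓝[>] (0:ℝ), h t < 0) ∨
    (∀ᶠ t in 𝓝[>] (0:ℝ), h t = 0) ∨ (∀ᶠ t in 𝓝[>] (0:ℝ), 0 < h t) := by
  by_cases hz : ∀ᶠ t in 𝓝 (0:ℝ), h t = 0
  · exact Or.inr (Or.inl (nhdsWithin_le_nhds hz))
  · obtain ⟨n, g, hg, hg0, hgh⟩ := hh.exists_eventuallyEq_pow_smul_nonzero_iff.2 hz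
    rcases lt_or_gt_of_ne hg0 with h0 | h0
    · left
      filter_upwards [nhdsWithin_le_nhds hgh,
        nhdsWithin_le_nhds (hg.continuousAt.eventually_lt continuousAt_const h0),
        self_mem_nhdsWithin] with t h1 h2 h3
      have h3' : (0:ℝ) < t := h3
      rw [h1]; simp only [sub_zero, smul_eq_mul]
      exact mul_neg_of_pos_of_neg (by positivity) h2
    · right; right
      filter_upwards [nhdsWithin_le_nhds hgh,
        nhdsWithin_le_nhds (continuousAt_const.eventually_lt hg.continuousAt h0),
        self_mem_nhdsWithin] with t h1 h2 h3
      have h3' : (0:ℝ) < t := h3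
      rw [h1]; simp only [sub_zero, smul_eq_mul]
      positivity

theorem ev_Ioo {P : ℝ → Prop} (h : ∀ᶠ t in 𝓝[>] (0:ℝ), P t) :
    ∃ t₁ > 0, ∀ t, 0 < t → t < t₁ → P t := by
  obtain ⟨u, hu, hs⟩ := mem_nhdsGT_iff_exists_Ioo_subset.1 h
  exact ⟨u, hu, fun t h1 h2 => hs ⟨h1, h2⟩⟩

/-- `h` has log derivative bound on `(0,t₁)`. -/
def LDer (C t₁ : ℝ) (h : ℝ → ℝ) : Prop :=
  ∀ t, 0 < t → t < t₁ → ∃ h', HasDerivAt h h' t ∧ |t * h'| ≤ C * |h t|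

theorem an_LDer (h : ℝ → ℝ) (hh : AnalyticAt ℝ h 0) : ∃ C : ℝ, 0 ≤ C ∧ ∃ t₁ > 0, LDer C t₁ h := by
  obtain ⟨C, hC, hev⟩ := an1 h hh
  obtain ⟨t₁, ht, H⟩ := ev_Ioo hev
  exact ⟨C, hC, t₁, ht, H⟩

theorem LDer.mono {C C' t₁ t₂ : ℝ} {h : ℝ → ℝ} (H : LDer C t₁ h) (hC : C ≤ C') (ht : t₂ ≤ t₁) :
    LDer C' t₂ h := by
  intro t h1 h2
  obtain ⟨h', a, b⟩ := H t h1 (h2.trans_le ht)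
  exact ⟨h', a, b.trans (by gcongr)⟩

theorem LDer.ll {C t₁ x₁ : ℝ} {h : ℝ → ℝ} (H : LDer C t₁ h) (hx : rexp x₁ ≤ t₁)
    (h0 : ∀ t, 0 < t → t < t₁ → 0 ≤ h t) : LL C x₁ (fun x => h (rexp x)) := by
  intro x hxx
  have hp := Real.exp_pos x
  have hl : rexp x < t₁ := lt_of_lt_of_le (Real.exp_lt_exp.2 hxx) hx
  obtain ⟨h', a, b⟩ := H _ hp hl
  refine ⟨h0 _ hp hl, h' * rexp x, a.comp x (Real.hasDerivAt_exp x), ?_⟩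
  rw [abs_of_nonneg (h0 _ hp hl)] at b
  rwa [mul_comm]

/-- finite trichotomy -/
theorem an_list (l : List (ℝ → ℝ)) (hl : ∀ h ∈ l, AnalyticAt ℝ h 0) :
    ∃ C : ℝ, 0 ≤ C ∧ ∃ t₁ > 0, ∀ h ∈ l, LDer C t₁ h ∧
      ((∀ t, 0 < t → t < t₁ → h t < 0) ∨ (∀ t, 0 < t → t < t₁ → h t = 0) ∨
      (∀ t, 0 < t → t < t₁ → 0 < h t)) := by
  induction l with
  | nil => exact ⟨0, le_rfl, 1, one_pos, by simp⟩
  | cons a l ih =>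
    obtain ⟨C, hC, t₁, ht, H⟩ := ih (fun b hb => hl b (by simp [hb]))
    obtain ⟨C', hC', t₂, ht2, H2⟩ := an_LDer a (hl a (by simp))
    have h3 : ∃ t₃ > 0, ((∀ t, 0 < t → t < t₃ → a t < 0) ∨ (∀ t, 0 < t → t < t₃ → a t = 0) ∨
      (∀ t, 0 < t → t < t₃ → 0 < a t)) := by
      rcases an_sgn a (hl a (by simp)) with h | h | h <;>
      · obtain ⟨t, ht, h⟩ := ev_Ioo h
        exact ⟨t, ht, by tauto⟩
    obtain ⟨t₃, ht3, H3⟩ := h3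
    refine ⟨max C C', le_max_of_le_left hC, min t₁ (min t₂ t₃), by positivity, ?_⟩
    intro h hh
    have l1 : min t₁ (min t₂ t₃) ≤ t₁ := min_le_left _ _
    have l2 : min t₁ (min t₂ t₃) ≤ t₂ := (min_le_right _ _).trans (min_le_left _ _)
    have l3 : min t₁ (min t₂ t₃) ≤ t₃ := (min_le_right _ _).trans (min_le_right _ _)
    rcases List.mem_cons.1 hh with rfl | hh
    · refine ⟨H2.mono (le_max_right _ _) l2, ?_⟩
      rcases H3 with H3 | H3 | H3
      · exact Or.inl fun t h1 h2 => H3 t h1 (h2.trans_le l3)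
      · exact Or.inr (Or.inl fun t h1 h2 => H3 t h1 (h2.trans_le l3))
      · exact Or.inr (Or.inr fun t h1 h2 => H3 t h1 (h2.trans_le l3))
    · obtain ⟨HA, HB⟩ := H h hh
      refine ⟨HA.mono (le_max_left _ _) l1, ?_⟩
      rcases HB with H3 | H3 | H3
      · exact Or.inl fun t h1 h2 => H3 t h1 (h2.trans_le l1)
      · exact Or.inr (Or.inl fun t h1 h2 => H3 t h1 (h2.trans_le l1))
      · exact Or.inr (Or.inr fun t h1 h2 => H3 t h1 (h2.trans_le l1))

theorem mpol_eval (m : ℕ) (X : ℕ → ℝ) (b : ℝ) :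
    (mpol m (fun i => (X i : ℂ))).eval (b : ℂ) =
      ((b ^ m + ∑ j ∈ Finset.range m, X j * b ^ j : ℝ) : ℂ) := by
  unfold mpol lpol
  simp [Polynomial.eval_finset_sum, Finset.sum_range]

/-- root data for `F` with ramification `N` -/
def RootData (F : ℝ × ℝ → ℝ) (N : ℕ) (l : List (ℝ → ℂ)) (q : ℝ × ℝ → ℝ) : Prop :=
  (∀ ρ ∈ l, AnalyticAt ℝ ρ 0) ∧ AnalyticAt ℝ q 0 ∧ q 0 ≠ 0 ∧
  ∃ η > 0, ∀ t b : ℝ, |t| < η → |b| < η →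
    (F (t ^ N, b) * q (t ^ N, b)) ^ 2 = (l.map (fun ρ => (b - (ρ t).re) ^ 2 + (ρ t).im ^ 2)).prod

theorem prod_normSq (l : List (ℝ → ℂ)) (t b : ℝ) :
    Complex.normSq ((l.map (fun ρ => ((b:ℂ) - ρ t))).prod) =
      (l.map (fun ρ => (b - (ρ t).re) ^ 2 + (ρ t).im ^ 2)).prod := by
  induction l with
  | nil => simp
  | cons a l ih =>
    simp only [List.map_cons, List.prod_cons, map_mul, ih]
    congr 1
    rw [Complex.normSq_apply]
    simp
    ring

theorem exists_rootData (F : ℝ × ℝ → ℝ) (hF : AnalyticAt ℝ F 0)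
    (h0 : ¬ ∀ᶠ b in 𝓝 (0:ℝ), F (0, b) = 0) :
    ∃ N : ℕ, 0 < N ∧ ∃ l q, RootData F N l q := by
  obtain ⟨k, X, q, hX, hq, hq0, hev⟩ := weierstrass_prep F hF h0
  obtain ⟨N, hN, l, hl, hP⟩ := puiseux k (fun t => mpol k (fun i => (X i t : ℂ)))
    (monFam_mpol k (fun t i => (X i t : ℂ)) (by
      apply AnalyticAt.pi
      intro i
      exact AnalyticAt.fun_comp (g := fun y : ℝ => (y:ℂ)) (Complex.ofRealCLM.analyticAt _) (hX i)))
  refine ⟨N, hN, l, q, hl, hq, hq0, ?_⟩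
  obtain ⟨η₁, hη₁, h1⟩ := Metric.eventually_nhds_iff.1 hP
  have hev2 : ∀ᶠ p : ℝ × ℝ in 𝓝 0, F (p.1 ^ N, p.2) * q (p.1 ^ N, p.2) =
      p.2 ^ k + ∑ j ∈ Finset.range k, X j (p.1 ^ N) * p.2 ^ j := by
    have hc : Tendsto (fun p : ℝ × ℝ => (p.1 ^ N, p.2)) (𝓝 0) (𝓝 0) := by
      have : ContinuousAt (fun p : ℝ × ℝ => (p.1 ^ N, p.2)) 0 := by fun_prop
      have h := this.tendsto
      have e : ((0 : ℝ × ℝ).1 ^ N, (0 : ℝ × ℝ).2) = 0 := by simp [hN.ne']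
      rwa [e] at h
    exact hc.eventually hev
  obtain ⟨η₂, hη₂, h2⟩ := Metric.eventually_nhds_iff.1 hev2
  refine ⟨min η₁ η₂, by positivity, ?_⟩
  intro t b ht hb
  have h3 := h1 (y := t) (by rw [dist_zero_right]; exact ht.trans_le (min_le_left _ _))
  have h4 := h2 (y := (t, b)) (by
    rw [dist_zero_right, Prod.norm_def]
    exact max_lt (ht.trans_le (min_le_right _ _)) (hb.trans_le (min_le_right _ _)))
  have h5 := congrArg (Polynomial.eval (b:ℂ)) h3
  simp only at h5 h4
  rw [mpol_eval k (fun i => X i (t ^ N)), ← h4, Polynomial.eval_list_prod, List.map_map] at h5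
  have h6 := congrArg Complex.normSq h5
  rw [Complex.normSq_ofReal, ← sq] at h6
  rw [h6, ← prod_normSq]
  congr 2
  apply List.map_congr_left
  intro ρ _
  simp

theorem RootData.ramify {F : ℝ × ℝ → ℝ} {N : ℕ} {l : List (ℝ → ℂ)} {q : ℝ × ℝ → ℝ}
    (h : RootData F N l q) (K : ℕ) (hK : 0 < K) :
    RootData F (K * N) (l.map (fun ρ t => ρ (t ^ K))) q := by
  obtain ⟨h1, h2, h3, η, hη, h4⟩ := h
  refine ⟨?_, h2, h3, min η 1, by positivity, ?_⟩
  · intro ρ hρ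
    obtain ⟨ρ', hρ', rfl⟩ := List.mem_map.1 hρ
    exact analyticAt_comp_pow K hK ρ' (h1 _ hρ')
  · intro t b ht hb
    have : |t ^ K| < η := by
      rw [abs_pow]
      have h5 : |t| < 1 := ht.trans_le (min_le_right _ _)
      calc |t| ^ K ≤ |t| ^ 1 := pow_le_pow_of_le_one (abs_nonneg _) h5.le hK
        _ < η := by rw [pow_one]; exact ht.trans_le (min_le_left _ _)
    have h6 := h4 (t ^ K) b this (hb.trans_le (min_le_left _ _))
    rw [← pow_mul] at h6
    rw [h6, List.map_map]
    rfl

def Tame (M r : ℝ) (Ψ : ℝ × ℝ → ℂ) : Prop :=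
  0 ≤ M ∧ (∀ p, ‖Ψ p‖ ≤ M) ∧
  (∀ p, p ≠ 0 → ∃ Ψ' : ℝ × ℝ →L[ℝ] ℂ, HasFDerivAt Ψ Ψ' p ∧ ‖Ψ'‖ * ‖p‖ ≤ M) ∧
  ∀ p, r ≤ ‖p‖ → Ψ p = 0

def oscI (g : ℝ × ℝ → ℝ) (Ψ : ℝ × ℝ → ℂ) (s : ℝ) (p : ℝ × ℝ) : ℂ :=
  (g p : ℂ) * (Ψ p * Complex.exp (Complex.I * ((s * p.1 : ℝ) : ℂ)))

def wtI (g : ℝ × ℝ → ℝ) (s : ℝ) (p : ℝ × ℝ) : ℝ := g p * (Real.sqrt (1 + (s * p.1) ^ 2))⁻¹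

def Good (g : ℝ × ℝ → ℝ) (r : ℝ) (D : Set (ℝ × ℝ)) : Prop :=
  ∃ C : ℝ, 0 ≤ C ∧ ∀ M Ψ, Tame M r Ψ → ∀ s : ℝ,
    ‖∫ p in D, oscI g Ψ s p‖ ≤ C * M * ∫ p in D, wtI g s p

theorem Tame.measurable {M r : ℝ} {Ψ : ℝ × ℝ → ℂ} (h : Tame M r Ψ) : Measurable Ψ := by
  apply measurable_of_continuousOn_compl_singleton (0 : ℝ × ℝ)
  intro p hp
  obtain ⟨Ψ', h1, -⟩ := h.2.2.1 p hp
  exact h1.continuousAt.continuousWithinAt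

theorem Tame.mono {M r r' : ℝ} {Ψ : ℝ × ℝ → ℂ} (h : Tame M r Ψ) (hr : r ≤ r') : Tame M r' Ψ :=
  ⟨h.1, h.2.1, h.2.2.1, fun p hp => h.2.2.2 p (hr.trans hp)⟩

theorem norm_osc_exp (y : ℝ) : ‖Complex.exp (Complex.I * (y : ℂ))‖ = 1 := by
  rw [mul_comm]; exact Complex.norm_exp_ofReal_mul_I y

theorem oscI_integrable {g : ℝ × ℝ → ℝ} {D : Set (ℝ × ℝ)} (hg : IntegrableOn g D) {M r : ℝ}
    {Ψ : ℝ × ℝ → ℂ} (h : Tame M r Ψ) (s : ℝ) : IntegrableOn (oscI g Ψ s) D := by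
  unfold oscI
  refine Integrable.mul_bdd (c := M) hg.ofReal ?_ ?_
  · apply Measurable.aestronglyMeasurable
    have := h.measurable
    fun_prop
  · filter_upwards with p
    rw [norm_mul, norm_osc_exp, mul_one]
    exact h.2.1 p

theorem inv_sqrt_le_one (y : ℝ) : (Real.sqrt (1 + y ^ 2))⁻¹ ≤ 1 := by
  apply inv_le_one_of_one_le₀
  rw [Real.one_le_sqrt]
  nlinarith [sq_nonneg y]

theorem wtI_integrable {g : ℝ × ℝ → ℝ} {D : Set (ℝ × ℝ)} (hg : IntegrableOn g D)
    (s : ℝ) : IntegrableOn (wtI g s) D := by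
  unfold wtI
  refine Integrable.mul_bdd (c := 1) hg ?_ ?_
  · apply Measurable.aestronglyMeasurable
    fun_prop
  · filter_upwards with p
    rw [Real.norm_of_nonneg (by positivity)]
    exact inv_sqrt_le_one _

theorem wtI_nonneg {g : ℝ × ℝ → ℝ} (hg : ∀ p, 0 ≤ g p) (s : ℝ) (p : ℝ × ℝ) : 0 ≤ wtI g s p := by
  unfold wtI
  have := hg p
  positivity

theorem Good.mono {g : ℝ × ℝ → ℝ} {r r' : ℝ} {D : Set (ℝ × ℝ)} (h : Good g r D) (hr : r' ≤ r) :
    Good g r' D := by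
  obtain ⟨C, hC, H⟩ := h
  exact ⟨C, hC, fun M Ψ hΨ s => H M Ψ (hΨ.mono hr) s⟩

theorem Good.congr {g : ℝ × ℝ → ℝ} {r : ℝ} {D D' : Set (ℝ × ℝ)} (h : Good g r D)
    (hD : D =ᵐ[volume] D') : Good g r D' := by
  obtain ⟨C, hC, H⟩ := h
  refine ⟨C, hC, fun M Ψ hΨ s => ?_⟩
  have := H M Ψ hΨ s
  rwa [setIntegral_congr_set hD, setIntegral_congr_set hD] at this

theorem Good.empty {g : ℝ × ℝ → ℝ} {r : ℝ} : Good g r ∅ :=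
  ⟨0, le_rfl, fun M Ψ hΨ s => by simp⟩

theorem Good.of_zero {g : ℝ × ℝ → ℝ} {r : ℝ} {D : Set (ℝ × ℝ)} (hD : MeasurableSet D)
    (h : ∀ p ∈ D, g p = 0) : Good g r D := by
  refine ⟨0, le_rfl, fun M Ψ hΨ s => ?_⟩
  rw [setIntegral_congr_fun (g := fun _ => (0:ℂ)) hD (fun p hp => by simp [oscI, h p hp])]
  simp

theorem Good.union {g : ℝ × ℝ → ℝ} {r : ℝ} {D D' : Set (ℝ × ℝ)} (hg : ∀ p, 0 ≤ g p)
    (h : Good g r D) (h' : Good g r D') (hd : Disjoint D D') (hm' : MeasurableSet D')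
    (hi : IntegrableOn g D) (hi' : IntegrableOn g D') : Good g r (D ∪ D') := by
  obtain ⟨C, hC, H⟩ := h
  obtain ⟨C', hC', H'⟩ := h'
  refine ⟨max C C', le_max_of_le_left hC, fun M Ψ hΨ s => ?_⟩
  rw [setIntegral_union hd hm' (oscI_integrable hi hΨ s) (oscI_integrable hi' hΨ s),
    setIntegral_union hd hm' (wtI_integrable hi s) (wtI_integrable hi' s)]
  have n1 : 0 ≤ ∫ p in D, wtI g s p := integral_nonneg (wtI_nonneg hg s)
  have n2 : 0 ≤ ∫ p in D', wtI g s p := integral_nonneg (wtI_nonneg hg s)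
  have hM := hΨ.1
  calc _ ≤ C * M * (∫ p in D, wtI g s p) + C' * M * ∫ p in D', wtI g s p :=
        (norm_add_le _ _).trans (add_le_add (H M Ψ hΨ s) (H' M Ψ hΨ s))
    _ ≤ max C C' * M * (∫ p in D, wtI g s p) + max C C' * M * ∫ p in D', wtI g s p := by
      gcongr
      · exact le_max_left _ _
      · exact le_max_right _ _
    _ = _ := by ring

theorem Good.biUnion {g : ℝ × ℝ → ℝ} {r : ℝ} {ι : Type} [DecidableEq ι] (S : Finset ι)
    (D : ι → Set (ℝ × ℝ)) (hg : ∀ p, 0 ≤ g p)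
    (h : ∀ i ∈ S, Good g r (D i)) (hd : ∀ i j, i ≠ j → Disjoint (D i) (D j))
    (hm : ∀ i, MeasurableSet (D i))
    (hi : ∀ i, IntegrableOn g (D i)) : Good g r (⋃ i ∈ S, D i) := by
  induction S using Finset.induction_on with
  | empty => simpa using Good.empty
  | insert a S ha ih =>
    rw [Finset.set_biUnion_insert, Set.union_comm]
    refine Good.union hg (ih (fun i hi => h i (by simp [hi]))) (h a (by simp)) ?_ (hm a) ?_ (hi a)
    · rw [Set.disjoint_iUnion₂_left]
      intro i hi'
      exact hd i a (fun e => ha (e ▸ hi'))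
    · exact integrableOn_finset_iUnion.2 fun i _ => hi i

theorem lemmaZ {g : ℝ × ℝ → ℝ} {r C₀ C₁ x₁ x₂ : ℝ} {J : Set ℝ} (hJ : MeasurableSet J) (N : ℕ)
    (hN : 1 ≤ N) (T : ℝ × ℝ → ℝ × ℝ) (T' : ℝ × ℝ → (ℝ × ℝ →L[ℝ] ℝ × ℝ)) (c : ℝ → ℝ)
    (hC₀ : 0 ≤ C₀) (hC₁ : 0 ≤ C₁) (hx : x₂ < x₁)
    (hT : ∀ q ∈ J ×ˢ Iio x₁, HasFDerivAt T (T' q) q) (hinj : InjOn T (J ×ˢ Iio x₁))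
    (hv : ∀ q ∈ J ×ˢ Iio x₁, (T q).1 = c q.1 * rexp (N * q.2))
    (hG : ∀ θ ∈ J, LL C₀ x₁ (fun x => |(T' (θ, x)).det| * g (T (θ, x))))
    (h1 : ∀ q ∈ J ×ˢ Iio x₁, ‖T' q (0, 1)‖ ≤ C₁ * ‖T q‖)
    (h0 : ∀ q ∈ J ×ˢ Iio x₁, T q ≠ 0)
    (hfar : ∀ q ∈ J ×ˢ Iio x₁, x₂ ≤ q.2 → r ≤ ‖T q‖)
    (hgi : IntegrableOn g (T '' (J ×ˢ Iio x₁))) : Good g r (T '' (J ×ˢ Iio x₁)) := by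
  set S := J ×ˢ Iio x₁ with hS
  have hSm : MeasurableSet S := hJ.prod measurableSet_Iio
  have hTw : ∀ q ∈ S, HasFDerivWithinAt T (T' q) S q := fun q hq => (hT q hq).hasFDerivWithinAt
  refine ⟨C₀ + C₁ + 1 + N, by positivity, fun M Ψ hΨ s => ?_⟩
  have hM := hΨ.1
  set G : ℝ × ℝ → ℝ := fun q => |(T' q).det| * g (T q) with hGdef
  have hGi : IntegrableOn G S := by
    have := (integrableOn_image_iff_integrableOn_abs_det_fderiv_smul volume hSm hTw hinj g).1 hgi
    simpa only [smul_eq_mul] using this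
  rw [integral_image_eq_integral_abs_det_fderiv_smul volume hSm hTw hinj,
    integral_image_eq_integral_abs_det_fderiv_smul volume hSm hTw hinj]
  have hoi := (integrableOn_image_iff_integrableOn_abs_det_fderiv_smul volume hSm hTw hinj _).1
    (oscI_integrable hgi hΨ s)
  have hwi := (integrableOn_image_iff_integrableOn_abs_det_fderiv_smul volume hSm hTw hinj _).1
    (wtI_integrable hgi s)
  rw [Measure.volume_eq_prod] at hoi hwi hGi ⊢
  rw [setIntegral_prod _ hoi, setIntegral_prod _ hwi, ← integral_const_mul]
  apply norm_integral_le_of_norm_le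
  · rw [hS, IntegrableOn, ← Measure.prod_restrict] at hwi
    exact hwi.integral_prod_left.const_mul _
  · rw [hS, IntegrableOn, ← Measure.prod_restrict] at hGi
    filter_upwards [hGi.prod_right_ae, ae_restrict_mem hJ] with θ hθ hθJ
    have hq : ∀ x < x₁, (θ, x) ∈ S := fun x hx => ⟨hθJ, hx⟩
    have key := osc1d (hG θ hθJ) hθ N hN hC₀ hC₁ hM hx (ψ := fun x => Ψ (T (θ, x))) (by
        intro x hxx
        refine ⟨hΨ.2.1 _, ?_⟩
        obtain ⟨Ψ', hd, hb⟩ := hΨ.2.2.1 _ (h0 _ (hq x hxx))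
        have hc : HasDerivAt (fun x : ℝ => ((θ, x) : ℝ × ℝ)) ((0, 1) : ℝ × ℝ) x :=
          (hasDerivAt_const x θ).prodMk (hasDerivAt_id x)
        have hc2 := (hd.comp _ (hT _ (hq x hxx))).comp_hasDerivAt x hc
        refine ⟨_, hc2, ?_⟩
        rw [ContinuousLinearMap.comp_apply]
        calc _ ≤ ‖Ψ'‖ * ‖T' (θ, x) (0, 1)‖ := Ψ'.le_opNorm _
          _ ≤ ‖Ψ'‖ * (C₁ * ‖T (θ, x)‖) := by gcongr; exact h1 _ (hq x hxx)
          _ = C₁ * (‖Ψ'‖ * ‖T (θ, x)‖) := by ring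
          _ ≤ C₁ * M := by gcongr) (by
        intro x hx2 hx1
        exact hΨ.2.2.2 _ (hfar _ (hq x hx1) hx2)) (s * c θ)
    rw [setIntegral_congr_fun (g := fun x => |(T' (θ, x)).det| • oscI g Ψ s (T (θ, x)))
      measurableSet_Iio ?_, setIntegral_congr_fun
      (g := fun x => |(T' (θ, x)).det| • wtI g s (T (θ, x))) measurableSet_Iio ?_] at key
    · exact key
    · intro x hxx
      simp only [wtI, smul_eq_mul]
      rw [hv _ (hq x hxx)]
      simp only [div_eq_mul_inv, ← mul_assoc]
    · intro x hxx
      simp only [oscI, Complex.real_smul]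
      rw [hv _ (hq x hxx)]
      push_cast
      simp only [← mul_assoc]

theorem det_prod2 (a b c d : ℝ) :
    ContinuousLinearMap.det ((a • ContinuousLinearMap.fst ℝ ℝ ℝ + b • ContinuousLinearMap.snd ℝ ℝ ℝ).prod
      (c • ContinuousLinearMap.fst ℝ ℝ ℝ + d • ContinuousLinearMap.snd ℝ ℝ ℝ)) = a * d - b * c := by
  rw [ContinuousLinearMap.det]
  have : ((a • ContinuousLinearMap.fst ℝ ℝ ℝ + b • ContinuousLinearMap.snd ℝ ℝ ℝ).prod
      (c • ContinuousLinearMap.fst ℝ ℝ ℝ + d • ContinuousLinearMap.snd ℝ ℝ ℝ) : ℝ × ℝ →L[ℝ] ℝ × ℝ)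
      = (Matrix.toLin (Module.Basis.finTwoProd ℝ) (Module.Basis.finTwoProd ℝ) !![a, b; c, d]) := by
    rw [Matrix.toLin_finTwoProd]
    ext <;> simp
  rw [this, LinearMap.det_toLin, Matrix.det_fin_two_of]

def Tm (N : ℕ) (β₀ β₁ : ℝ → ℝ) (q : ℝ × ℝ) : ℝ × ℝ :=
  (rexp (N * q.2), β₀ (rexp q.2) + q.1 * (β₁ (rexp q.2) - β₀ (rexp q.2)))

def Tm' (N : ℕ) (β₀ β₁ : ℝ → ℝ) (q : ℝ × ℝ) : ℝ × ℝ →L[ℝ] ℝ × ℝ :=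
  ((0:ℝ) • ContinuousLinearMap.fst ℝ ℝ ℝ + (N * rexp (N * q.2)) • ContinuousLinearMap.snd ℝ ℝ ℝ).prod
    ((β₁ (rexp q.2) - β₀ (rexp q.2)) • ContinuousLinearMap.fst ℝ ℝ ℝ +
      (rexp q.2 * deriv β₀ (rexp q.2) +
        q.1 * (rexp q.2 * deriv β₁ (rexp q.2) - rexp q.2 * deriv β₀ (rexp q.2)))
        • ContinuousLinearMap.snd ℝ ℝ ℝ)

theorem hasFDerivAt_Tm (N : ℕ) (β₀ β₁ : ℝ → ℝ) (q : ℝ × ℝ)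
    (h0 : DifferentiableAt ℝ β₀ (rexp q.2)) (h1 : DifferentiableAt ℝ β₁ (rexp q.2)) :
    HasFDerivAt (Tm N β₀ β₁) (Tm' N β₀ β₁ q) q := by
  have hs : HasFDerivAt (fun q : ℝ × ℝ => q.2) (ContinuousLinearMap.snd ℝ ℝ ℝ) q := hasFDerivAt_snd
  have hf : HasFDerivAt (fun q : ℝ × ℝ => q.1) (ContinuousLinearMap.fst ℝ ℝ ℝ) q := hasFDerivAt_fst
  have e1 : HasFDerivAt (fun q : ℝ × ℝ => rexp (N * q.2)) ((N * rexp (N * q.2)) • ContinuousLinearMap.snd ℝ ℝ ℝ) q := by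
    have := (hs.const_mul (N:ℝ)).exp
    refine this.congr_fderiv ?_
    ext <;> simp [mul_comm]
  have b0 : HasFDerivAt (fun q : ℝ × ℝ => β₀ (rexp q.2)) ((rexp q.2 * deriv β₀ (rexp q.2)) • ContinuousLinearMap.snd ℝ ℝ ℝ) q := by
    have := h0.hasDerivAt.comp_hasFDerivAt q hs.exp
    refine this.congr_fderiv ?_
    ext <;> simp [mul_comm]
  have b1 : HasFDerivAt (fun q : ℝ × ℝ => β₁ (rexp q.2)) ((rexp q.2 * deriv β₁ (rexp q.2)) • ContinuousLinearMap.snd ℝ ℝ ℝ) q := by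
    have := h1.hasDerivAt.comp_hasFDerivAt q hs.exp
    refine this.congr_fderiv ?_
    ext <;> simp [mul_comm]
  have := e1.prodMk (b0.add (hf.mul (b1.sub b0)))
  refine this.congr_fderiv ?_
  unfold Tm'
  ext <;> simp <;> ring

theorem det_Tm' (N : ℕ) (β₀ β₁ : ℝ → ℝ) (q : ℝ × ℝ) (h : 0 ≤ β₁ (rexp q.2) - β₀ (rexp q.2)) :
    |(Tm' N β₀ β₁ q).det| = N * (rexp (N * q.2) * (β₁ (rexp q.2) - β₀ (rexp q.2))) := by
  unfold Tm'
  rw [det_prod2, zero_mul, zero_sub, abs_neg, abs_of_nonneg (by positivity)]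
  ring

theorem exp_N (N : ℕ) (x : ℝ) : rexp (N * x) = (rexp x) ^ N := by
  rw [← Real.exp_nat_mul]

theorem Tm_injOn (N : ℕ) (hN : 1 ≤ N) (β₀ β₁ : ℝ → ℝ) (t₁ x₁ : ℝ) (ht : rexp x₁ ≤ t₁)
    (hlt : ∀ t, 0 < t → t < t₁ → β₀ t < β₁ t) : InjOn (Tm N β₀ β₁) (Ioo 0 1 ×ˢ Iio x₁) := by
  intro q hq q' hq' h
  have hNr : (1:ℝ) ≤ N := by exact_mod_cast hN
  unfold Tm at h
  have h1 := congrArg Prod.fst h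
  have h2 := congrArg Prod.snd h
  simp only at h1 h2
  have h3 : q.2 = q'.2 := by
    have := Real.exp_injective h1
    exact mul_left_cancel₀ (by positivity) this
  rw [← h3] at h2
  have h4 := hlt _ (Real.exp_pos q.2) ((Real.exp_lt_exp.2 hq.2).trans_le ht)
  have h5 : q.1 = q'.1 := by
    have : q.1 * (β₁ (rexp q.2) - β₀ (rexp q.2)) = q'.1 * (β₁ (rexp q.2) - β₀ (rexp q.2)) := by
      linarith
    exact mul_right_cancel₀ (by linarith) this
  exact Prod.ext h5 h3

theorem Tm'_bd (N : ℕ) (β₀ β₁ : ℝ → ℝ) (q : ℝ × ℝ) (C κ : ℝ) (hC : 0 ≤ C) (hκ : 0 < κ)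
    (hq1 : 0 < q.1 ∧ q.1 < 1)
    (k0 : |rexp q.2 * deriv β₀ (rexp q.2)| ≤ C * (κ * rexp q.2 ^ N))
    (k1 : |rexp q.2 * deriv β₁ (rexp q.2)| ≤ C * (κ * rexp q.2 ^ N)) :
    ‖Tm' N β₀ β₁ q (0, 1)‖ ≤ (N + C * κ) * rexp (N * q.2) := by
  have e : Tm' N β₀ β₁ q (0, 1) = (N * rexp (N * q.2), (rexp q.2 * deriv β₀ (rexp q.2) +
      q.1 * (rexp q.2 * deriv β₁ (rexp q.2) - rexp q.2 * deriv β₀ (rexp q.2)))) := by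
    unfold Tm'
    simp
  have hb : |(rexp q.2 * deriv β₀ (rexp q.2) +
      q.1 * (rexp q.2 * deriv β₁ (rexp q.2) - rexp q.2 * deriv β₀ (rexp q.2)))| ≤ C * κ * rexp (N * q.2) := by
    rw [exp_N]
    calc _ = |(1 - q.1) * (rexp q.2 * deriv β₀ (rexp q.2)) + q.1 * (rexp q.2 * deriv β₁ (rexp q.2))| := by
          congr 1; ring
      _ ≤ |(1 - q.1) * (rexp q.2 * deriv β₀ (rexp q.2))| + |q.1 * (rexp q.2 * deriv β₁ (rexp q.2))| :=
          abs_add_le _ _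
      _ = (1 - q.1) * |rexp q.2 * deriv β₀ (rexp q.2)| + q.1 * |rexp q.2 * deriv β₁ (rexp q.2)| := by
          rw [abs_mul (1 - q.1), abs_mul q.1, abs_of_pos hq1.1, abs_of_pos (by linarith : 0 < 1 - q.1)]
      _ ≤ (1 - q.1) * (C * (κ * rexp q.2 ^ N)) + q.1 * (C * (κ * rexp q.2 ^ N)) := by
          have : 0 ≤ 1 - q.1 := by linarith
          have := hq1.1
          gcongr
      _ = _ := by ring
  have hexp : 0 < rexp (N * q.2) := Real.exp_pos _
  rw [e, Prod.norm_def]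
  apply max_le
  · simp only [Real.norm_eq_abs]
    rw [abs_of_nonneg (by positivity)]
    have : 0 ≤ C * κ * rexp (N * q.2) := by positivity
    linarith
  · simp only [Real.norm_eq_abs]
    refine hb.trans ?_
    have : 0 ≤ N * rexp (N * q.2) := by positivity
    linarith

theorem pieceGood {g : ℝ × ℝ → ℝ} (N : ℕ) (hN : 1 ≤ N) (β₀ β₁ : ℝ → ℝ) (t₁ x₁ C κ C₂ : ℝ)
    (hC : 0 ≤ C) (hκ : 0 < κ) (hC₂ : 0 ≤ C₂)
    (ht : rexp x₁ = t₁)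
    (hlt : ∀ t, 0 < t → t < t₁ → β₀ t < β₁ t)
    (h0 : ∀ t, 0 < t → t < t₁ → DifferentiableAt ℝ β₀ t ∧ |t * deriv β₀ t| ≤ C * (κ * t ^ N))
    (h1 : ∀ t, 0 < t → t < t₁ → DifferentiableAt ℝ β₁ t ∧ |t * deriv β₁ t| ≤ C * (κ * t ^ N))
    (hΔ : LDer C t₁ (fun t => β₁ t - β₀ t))
    (hG : ∀ θ ∈ Ioo (0:ℝ) 1, LL C₂ x₁ (fun x => g (Tm N β₀ β₁ (θ, x))))
    (hgi : IntegrableOn g (Tm N β₀ β₁ '' (Ioo 0 1 ×ˢ Iio x₁))) :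
    Good g (t₁ ^ N / 2) (Tm N β₀ β₁ '' (Ioo 0 1 ×ˢ Iio x₁)) := by
  have hNr : (1:ℝ) ≤ N := by exact_mod_cast hN
  have hlog2 : 0 < Real.log 2 := Real.log_pos (by norm_num)
  have hr : ∀ q ∈ Ioo (0:ℝ) 1 ×ˢ Iio x₁, 0 < rexp q.2 ∧ rexp q.2 < t₁ := fun q hq =>
    ⟨Real.exp_pos _, ht ▸ Real.exp_lt_exp.2 hq.2⟩
  have hnorm : ∀ q, rexp (N * q.2) ≤ ‖Tm N β₀ β₁ q‖ := by
    intro q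
    calc rexp (N * q.2) = ‖(Tm N β₀ β₁ q).1‖ := by
          simp [Tm]
      _ ≤ _ := norm_fst_le _
  refine lemmaZ (C₀ := N + C + C₂) (C₁ := N + C * κ) (x₂ := x₁ - Real.log 2 / N) measurableSet_Ioo N hN (Tm N β₀ β₁) (Tm' N β₀ β₁)
    (fun _ => 1) (by positivity) (by positivity) ?_ ?_ ?_ ?_ ?_ ?_ ?_ ?_ hgi
  · have : 0 < Real.log 2 / N := by positivity
    linarith
  · intro q hq
    obtain ⟨a, b⟩ := hr q hq
    exact hasFDerivAt_Tm N β₀ β₁ q (h0 _ a b).1 (h1 _ a b).1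
  · exact Tm_injOn N hN β₀ β₁ t₁ x₁ ht.le hlt
  · intro q hq
    simp [Tm]
  · intro θ hθ
    have hll := hΔ.ll ht.le (fun t a b => by linarith [hlt t a b])
    have h3 := (((LL.exp (x₁ := x₁) N).mul hll).const_mul (c := N) (by positivity)).mul (hG θ hθ)
    refine h3.congr ?_
    intro x hx
    obtain ⟨a, b⟩ := hr (θ, x) ⟨hθ, hx⟩
    rw [det_Tm' N β₀ β₁ (θ, x) (by linarith [hlt _ a b])]
  · intro q hq
    obtain ⟨a, b⟩ := hr q hq
    have k0 := (h0 _ a b).2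
    have k1 := (h1 _ a b).2
    calc ‖Tm' N β₀ β₁ q (0, 1)‖ ≤ (N + C * κ) * rexp (N * q.2) := Tm'_bd N β₀ β₁ q C κ hC hκ hq.1 k0 k1
      _ ≤ _ := by gcongr; exact hnorm q
  · intro q hq h
    have := congrArg Prod.fst h
    simp [Tm] at this
  · intro q hq hx2
    refine le_trans ?_ (hnorm q)
    have : t₁ ^ N / 2 = rexp (N * (x₁ - Real.log 2 / N)) := by
      rw [← ht, ← exp_N, mul_sub, mul_div_cancel₀ _ (by positivity), Real.exp_sub, Real.exp_log (by norm_num)]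
    rw [this]
    apply Real.exp_le_exp.2
    gcongr

theorem abs_rpow_eq (F Pr q γ : ℝ) (hq : q ≠ 0) (hP : 0 ≤ Pr) (h : (F * q) ^ 2 = Pr) :
    |F| ^ γ = Pr ^ (γ / 2) * (q ^ 2) ^ (-(γ / 2)) := by
  have hq2 : 0 < q ^ 2 := by positivity
  have h1 : F ^ 2 = Pr * (q ^ 2)⁻¹ := by
    rw [← h]; field_simp
  have h2 : |F| ^ γ = (F ^ 2) ^ (γ / 2) := by
    rw [← sq_abs, ← Real.rpow_natCast, ← Real.rpow_mul (abs_nonneg F)]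
    congr 1; push_cast; ring
  rw [h2, h1, Real.mul_rpow hP (by positivity), Real.inv_rpow hq2.le, Real.rpow_neg hq2.le]

theorem LL.sq_path {q : ℝ × ℝ → ℝ} {P P' : ℝ → ℝ × ℝ} {B C₁ c₀ x₁ : ℝ} (hc : 0 < c₀) (hB : 0 ≤ B)
    (hC₁ : 0 ≤ C₁)
    (hP : ∀ x < x₁, HasDerivAt P (P' x) x ∧ ‖P' x‖ ≤ C₁)
    (hq : ∀ x < x₁, DifferentiableAt ℝ q (P x) ∧ ‖fderiv ℝ q (P x)‖ ≤ B ∧ c₀ ≤ |q (P x)|) :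
    LL (2 * (B * C₁ / c₀)) x₁ (fun x => q (P x) ^ 2) := by
  intro x hx
  obtain ⟨a, b⟩ := hP x hx
  obtain ⟨c, d, e⟩ := hq x hx
  refine ⟨sq_nonneg _, _, (c.hasFDerivAt.comp_hasDerivAt x a).pow 2, ?_⟩
  have h1 : |fderiv ℝ q (P x) (P' x)| ≤ B * C₁ := by
    calc _ ≤ ‖fderiv ℝ q (P x)‖ * ‖P' x‖ := ContinuousLinearMap.le_opNorm _ _
      _ ≤ _ := by gcongr
  have h2 : B * C₁ ≤ B * C₁ / c₀ * |q (P x)| := by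
    rw [div_mul_eq_mul_div, le_div_iff₀ hc]
    gcongr
  simp only [Function.comp]
  rw [abs_mul, abs_mul, ← sq_abs (q (P x))]
  simp only [Nat.cast_ofNat, Nat.abs_ofNat, Nat.add_one_sub_one, pow_one]
  calc 2 * |q (P x)| * |fderiv ℝ q (P x) (P' x)| ≤ 2 * |q (P x)| * (B * C₁ / c₀ * |q (P x)|) := by
        gcongr; exact h1.trans h2
    _ = _ := by ring

/-- position of the root relative to the strip between `β₀` and `β₁` -/
def RootPos (C t₁ : ℝ) (β₀ β₁ : ℝ → ℝ) (ρ : ℝ → ℂ) : Prop :=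
  LDer C t₁ (fun t => (ρ t).im ^ 2) ∧
  (((∀ t, 0 < t → t < t₁ → (ρ t).re ≤ β₀ t) ∧ LDer C t₁ (fun t => β₀ t - (ρ t).re)) ∨
   ((∀ t, 0 < t → t < t₁ → β₁ t ≤ (ρ t).re) ∧ LDer C t₁ (fun t => (ρ t).re - β₁ t)))

theorem RootPos.ll {C t₁ x₁ : ℝ} {β₀ β₁ : ℝ → ℝ} {ρ : ℝ → ℂ} (h : RootPos C t₁ β₀ β₁ ρ)
    (hC : 0 ≤ C)
    (N : ℕ) (ht : rexp x₁ ≤ t₁) (hlt : ∀ t, 0 < t → t < t₁ → β₀ t < β₁ t)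
    (hΔ : LDer C t₁ (fun t => β₁ t - β₀ t)) (θ : ℝ) (hθ : θ ∈ Ioo (0:ℝ) 1) :
    LL (2 * C) x₁ (fun x => ((Tm N β₀ β₁ (θ, x)).2 - (ρ (rexp x)).re) ^ 2 + (ρ (rexp x)).im ^ 2) ∧
    ∀ x < x₁, 0 < ((Tm N β₀ β₁ (θ, x)).2 - (ρ (rexp x)).re) ^ 2 + (ρ (rexp x)).im ^ 2 := by
  have hD := hΔ.ll ht (fun t a b => by linarith [hlt t a b])
  have him := h.1.ll ht (fun t a b => sq_nonneg _)
  have hmax : max (max C C + max C C) C ≤ 2 * C := by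
    simp only [max_self]; apply max_le <;> linarith
  have hr : ∀ x < x₁, 0 < rexp x ∧ rexp x < t₁ := fun x hx =>
    ⟨Real.exp_pos _, lt_of_lt_of_le (Real.exp_lt_exp.2 hx) ht⟩
  rcases h.2 with ⟨hle, hL⟩ | ⟨hle, hL⟩
  · have h1 := hL.ll ht (fun t a b => by linarith [hle t a b])
    have h2 := h1.add (hD.const_mul hθ.1.le)
    have h3 := ((h2.mul h2).add him).mono hmax le_rfl
    refine ⟨h3.congr (fun x hx => by simp only [Tm]; ring), ?_⟩
    intro x hx
    obtain ⟨a, b⟩ := hr x hx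
    have k1 := hle _ a b
    have k2 := hlt _ a b
    have k3 : 0 < θ * (β₁ (rexp x) - β₀ (rexp x)) := mul_pos hθ.1 (by linarith)
    have : 0 < (Tm N β₀ β₁ (θ, x)).2 - (ρ (rexp x)).re := by
      simp only [Tm]; linarith
    positivity
  · have h1 := hL.ll ht (fun t a b => by linarith [hle t a b])
    have h2 := h1.add (hD.const_mul (c := 1 - θ) (by linarith [hθ.2]))
    have h3 := ((h2.mul h2).add him).mono hmax le_rfl
    refine ⟨h3.congr (fun x hx => by simp only [Tm]; ring), ?_⟩
    intro x hx
    obtain ⟨a, b⟩ := hr x hx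
    have k1 := hle _ a b
    have k2 := hlt _ a b
    have k3 : 0 < (1 - θ) * (β₁ (rexp x) - β₀ (rexp x)) := mul_pos (by linarith [hθ.2]) (by linarith)
    have : 0 < (ρ (rexp x)).re - (Tm N β₀ β₁ (θ, x)).2 := by
      simp only [Tm]; nlinarith
    have h4 : ((Tm N β₀ β₁ (θ, x)).2 - (ρ (rexp x)).re) ^ 2 = ((ρ (rexp x)).re - (Tm N β₀ β₁ (θ, x)).2) ^ 2 := by
      ring
    rw [h4]
    positivity

theorem LLF (F : ℝ × ℝ → ℝ) (N : ℕ) (l : List (ℝ → ℂ)) (q : ℝ × ℝ → ℝ) (γ η C t₁ x₁ B C₁ c₀ : ℝ)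
    (β₀ β₁ : ℝ → ℝ) (hC : 0 ≤ C) (hc : 0 < c₀) (hB : 0 ≤ B) (hC₁ : 0 ≤ C₁)
    (hroot : ∀ t b : ℝ, |t| < η → |b| < η →
      (F (t ^ N, b) * q (t ^ N, b)) ^ 2 = (l.map (fun ρ => (b - (ρ t).re) ^ 2 + (ρ t).im ^ 2)).prod)
    (hq : ∀ p : ℝ × ℝ, ‖p‖ < η → DifferentiableAt ℝ q p ∧ ‖fderiv ℝ q p‖ ≤ B ∧ c₀ ≤ |q p|)
    (hpos : ∀ ρ ∈ l, RootPos C t₁ β₀ β₁ ρ)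
    (ht : rexp x₁ ≤ t₁) (hlt : ∀ t, 0 < t → t < t₁ → β₀ t < β₁ t)
    (hΔ : LDer C t₁ (fun t => β₁ t - β₀ t)) (θ : ℝ) (hθ : θ ∈ Ioo (0:ℝ) 1)
    (hP : ∀ x < x₁, HasDerivAt (fun x => Tm N β₀ β₁ (θ, x)) (Tm' N β₀ β₁ (θ, x) (0, 1)) x ∧
      ‖Tm' N β₀ β₁ (θ, x) (0, 1)‖ ≤ C₁)
    (hsm : ∀ x < x₁, rexp x < η ∧ ‖Tm N β₀ β₁ (θ, x)‖ < η) :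
    LL (|γ / 2| * (l.length * (2 * C)) + |γ / 2| * (2 * (B * C₁ / c₀))) x₁
      (fun x => |F (Tm N β₀ β₁ (θ, x))| ^ γ) := by
  have h1 := LL.list_prod (x₁ := x₁) (2 * C) (by positivity) l
    (fun ρ x => ((Tm N β₀ β₁ (θ, x)).2 - (ρ (rexp x)).re) ^ 2 + (ρ (rexp x)).im ^ 2)
    (fun ρ hρ => ((hpos ρ hρ).ll hC N ht hlt hΔ θ hθ).1)
  have h1p : ∀ x < x₁, 0 < (l.map (fun ρ => ((Tm N β₀ β₁ (θ, x)).2 - (ρ (rexp x)).re) ^ 2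
      + (ρ (rexp x)).im ^ 2)).prod := by
    intro x hx
    apply List.prod_pos
    intro a ha
    obtain ⟨ρ, hρ, rfl⟩ := List.mem_map.1 ha
    exact ((hpos ρ hρ).ll hC N ht hlt hΔ θ hθ).2 x hx
  have hqx : ∀ x < x₁, DifferentiableAt ℝ q (Tm N β₀ β₁ (θ, x)) ∧
      ‖fderiv ℝ q (Tm N β₀ β₁ (θ, x))‖ ≤ B ∧ c₀ ≤ |q (Tm N β₀ β₁ (θ, x))| := fun x hx =>
    hq _ (hsm x hx).2
  have hq0 : ∀ x < x₁, q (Tm N β₀ β₁ (θ, x)) ≠ 0 := by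
    intro x hx h
    have := (hqx x hx).2.2
    rw [h, abs_zero] at this
    linarith
  have h2 := LL.sq_path hc hB hC₁ hP hqx
  have h3 := (h1.rpow h1p (γ / 2)).mul (h2.rpow (fun x hx => by
    have := hq0 x hx
    positivity) (-(γ / 2)))
  rw [abs_neg] at h3
  refine h3.congr ?_
  intro x hx
  apply abs_rpow_eq _ _ _ _ (hq0 x hx) (h1p x hx).le
  have hsx := hsm x hx
  have e : Tm N β₀ β₁ (θ, x) = ((rexp x) ^ N, (Tm N β₀ β₁ (θ, x)).2) := by
    apply Prod.ext
    · simp only [Tm]; exact exp_N N x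
    · rfl
  have := hroot (rexp x) (Tm N β₀ β₁ (θ, x)).2 (by rw [abs_of_pos (Real.exp_pos _)]; exact hsx.1)
    (lt_of_le_of_lt (norm_snd_le (Tm N β₀ β₁ (θ, x))) hsx.2)
  rw [← e] at this
  exact this

theorem stdFun_nonneg (n : ℕ) (F : Fin n → ℝ × ℝ → ℝ) (γ : Fin n → ℝ) (E : Set (ℝ × ℝ)) (p : ℝ × ℝ) :
    0 ≤ stdFun n F γ E p := by
  unfold stdFun
  apply Set.indicator_nonneg
  intro p _
  apply Finset.prod_nonneg
  intro i _
  positivity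

theorem preconn_frontier {X : Type*} [TopologicalSpace X] {s E : Set X} (hs : IsPreconnected s)
    {p z : X} (hp : p ∈ s) (hpE : p ∈ E) (hz : z ∈ s) (hzE : z ∉ E)
    (hf : ∀ y ∈ s, y ∉ frontier E) : False := by
  have h1 : ∀ y ∈ s, y ∈ interior E ∨ y ∈ (closure E)ᶜ := by
    intro y hy
    by_contra! h
    exact hf y hy ⟨not_not.1 h.2, h.1⟩
  have hpi : p ∈ interior E := (h1 p hp).resolve_right (fun h => h (subset_closure hpE))
  have hzi : z ∈ (closure E)ᶜ := (h1 z hz).resolve_left (fun h => hzE (interior_subset h))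
  obtain ⟨y, _, hy1, hy2⟩ := hs (interior E) (closure E)ᶜ isOpen_interior isClosed_closure.isOpen_compl
    h1 ⟨p, hp, hpi⟩ ⟨z, hz, hzi⟩
  exact hy2 (subset_closure (interior_subset hy1))

theorem qbd (q : ℝ × ℝ → ℝ) (hq : AnalyticAt ℝ q 0) (h0 : q 0 ≠ 0) :
    ∃ η B c₀ : ℝ, 0 < η ∧ 0 ≤ B ∧ 0 < c₀ ∧ ∀ p : ℝ × ℝ, ‖p‖ < η →
      DifferentiableAt ℝ q p ∧ ‖fderiv ℝ q p‖ ≤ B ∧ c₀ ≤ |q p| := by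
  have hpos : 0 < |q 0| := abs_pos.2 h0
  have e1 : ∀ᶠ p in 𝓝 (0 : ℝ × ℝ), DifferentiableAt ℝ q p :=
    hq.eventually_analyticAt.mono fun p hp => hp.differentiableAt
  have e2 : ∀ᶠ p in 𝓝 (0 : ℝ × ℝ), ‖fderiv ℝ q p‖ < ‖fderiv ℝ q 0‖ + 1 :=
    hq.fderiv.continuousAt.norm.eventually_lt continuousAt_const (by linarith)
  have e3 : ∀ᶠ p in 𝓝 (0 : ℝ × ℝ), |q 0| / 2 < |q p| :=
    continuousAt_const.eventually_lt hq.continuousAt.abs (by linarith)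
  obtain ⟨η, hη, H⟩ := Metric.eventually_nhds_iff.1 (e1.and (e2.and e3))
  refine ⟨η, ‖fderiv ℝ q 0‖ + 1, |q 0| / 2, hη, by positivity, by positivity, fun p hp => ?_⟩
  obtain ⟨a, b, c⟩ := H (y := p) (by rwa [dist_zero_right])
  exact ⟨a, b.le, c.le⟩

theorem piece_core {n : ℕ} (F : Fin n → ℝ × ℝ → ℝ) (γ : Fin n → ℝ) (E : Set (ℝ × ℝ)) (N : ℕ)
    (hN : 1 ≤ N) (κ : ℝ) (hκ : 0 < κ) (ls : Fin n → List (ℝ → ℂ)) (qs : Fin n → ℝ × ℝ → ℝ)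
    (η B c₀ : Fin n → ℝ) (hB : ∀ i, 0 ≤ B i) (hc : ∀ i, 0 < c₀ i)
    (hroot : ∀ i, ∀ t b : ℝ, |t| < η i → |b| < η i →
      (F i (t ^ N, b) * qs i (t ^ N, b)) ^ 2 =
        ((ls i).map (fun ρ => (b - (ρ t).re) ^ 2 + (ρ t).im ^ 2)).prod)
    (hq : ∀ i, ∀ p : ℝ × ℝ, ‖p‖ < η i →
      DifferentiableAt ℝ (qs i) p ∧ ‖fderiv ℝ (qs i) p‖ ≤ B i ∧ c₀ i ≤ |qs i p|)
    (C t₁ : ℝ) (hC : 0 ≤ C) (ht₁ : 0 < t₁) (ht1 : t₁ ≤ 1) (htη : ∀ i, (1 + κ) * t₁ < η i)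
    (β₀ β₁ : ℝ → ℝ) (hlt : ∀ t, 0 < t → t < t₁ → β₀ t < β₁ t)
    (hl0 : ∀ t, 0 < t → t < t₁ → -(κ * t ^ N) ≤ β₀ t)
    (hl1 : ∀ t, 0 < t → t < t₁ → β₁ t ≤ κ * t ^ N)
    (hd0 : LDer C t₁ β₀) (hd1 : LDer C t₁ β₁) (hΔ : LDer C t₁ (fun t => β₁ t - β₀ t))
    (hpos : ∀ i, ∀ ρ ∈ ls i, RootPos C t₁ β₀ β₁ ρ)
    (hfr : ∀ p ∈ Tm N β₀ β₁ '' (Ioo 0 1 ×ˢ Iio (Real.log t₁)), p ∉ frontier E)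
    (hgi : IntegrableOn (stdFun n F γ E) (Tm N β₀ β₁ '' (Ioo 0 1 ×ˢ Iio (Real.log t₁)))) :
    MeasurableSet (Tm N β₀ β₁ '' (Ioo 0 1 ×ˢ Iio (Real.log t₁))) ∧
    Good (stdFun n F γ E) (t₁ ^ N / 2) (Tm N β₀ β₁ '' (Ioo 0 1 ×ˢ Iio (Real.log t₁))) := by
  set x₁ := Real.log t₁ with hx₁
  have hex : rexp x₁ = t₁ := Real.exp_log ht₁
  have hr : ∀ x < x₁, 0 < rexp x ∧ rexp x < t₁ := fun x hx =>
    ⟨Real.exp_pos _, hex ▸ Real.exp_lt_exp.2 hx⟩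
  have hbd : ∀ β : ℝ → ℝ, LDer C t₁ β → (∀ t, 0 < t → t < t₁ → |β t| ≤ κ * t ^ N) →
      ∀ t, 0 < t → t < t₁ → DifferentiableAt ℝ β t ∧ |t * deriv β t| ≤ C * (κ * t ^ N) := by
    intro β hβ hb t h1 h2
    obtain ⟨h', hd, hbb⟩ := hβ t h1 h2
    refine ⟨hd.differentiableAt, ?_⟩
    rw [hd.deriv]
    exact hbb.trans (by gcongr; exact hb t h1 h2)
  have h0 := hbd β₀ hd0 (fun t a b => abs_le.2 ⟨hl0 t a b, (hlt t a b).le.trans (hl1 t a b)⟩)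
  have h1 := hbd β₁ hd1 (fun t a b => abs_le.2 ⟨(hl0 t a b).trans (hlt t a b).le, hl1 t a b⟩)
  have hTd : ∀ q ∈ Ioo (0:ℝ) 1 ×ˢ Iio x₁, HasFDerivAt (Tm N β₀ β₁) (Tm' N β₀ β₁ q) q := by
    intro q hq
    obtain ⟨a, b⟩ := hr _ hq.2
    exact hasFDerivAt_Tm N β₀ β₁ q (h0 _ a b).1 (h1 _ a b).1
  have hSm : MeasurableSet (Ioo (0:ℝ) 1 ×ˢ Iio x₁) := measurableSet_Ioo.prod measurableSet_Iio
  have hmeas : MeasurableSet (Tm N β₀ β₁ '' (Ioo (0:ℝ) 1 ×ˢ Iio x₁)) :=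
    measurable_image_of_fderivWithin hSm (fun q hq => (hTd q hq).hasFDerivWithinAt)
      (Tm_injOn N hN β₀ β₁ t₁ x₁ hex.le hlt)
  refine ⟨hmeas, ?_⟩
  have hconn : IsPreconnected (Tm N β₀ β₁ '' (Ioo (0:ℝ) 1 ×ˢ Iio x₁)) := by
    refine (isPreconnected_Ioo.prod isPreconnected_Iio).image _ ?_
    intro q hq
    exact (hTd q hq).continuousAt.continuousWithinAt
  by_cases hE : (Tm N β₀ β₁ '' (Ioo (0:ℝ) 1 ×ˢ Iio x₁)) ⊆ E
  · have hnb : ∀ θ ∈ Ioo (0:ℝ) 1, ∀ x < x₁, ‖Tm N β₀ β₁ (θ, x)‖ ≤ (1 + κ) * rexp x ^ N := by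
      intro θ hθ x hx
      obtain ⟨a, b⟩ := hr x hx
      have k0 := hl0 _ a b
      have k1 := hl1 _ a b
      have k2 := hlt _ a b
      have hp : 0 < rexp x ^ N := by positivity
      have : 0 < θ * (β₁ (rexp x) - β₀ (rexp x)) := mul_pos hθ.1 (by linarith)
      have : 0 < (1 - θ) * (β₁ (rexp x) - β₀ (rexp x)) := mul_pos (by linarith [hθ.2]) (by linarith)
      rw [Prod.norm_def]
      apply max_le
      · simp only [Tm, Real.norm_eq_abs, Real.abs_exp]
        rw [exp_N]
        nlinarith
      · simp only [Tm, Real.norm_eq_abs]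
        rw [abs_le]
        constructor <;> nlinarith
    have hsmall : ∀ x < x₁, rexp x ^ N ≤ rexp x := by
      intro x hx
      obtain ⟨a, b⟩ := hr x hx
      calc rexp x ^ N ≤ rexp x ^ 1 := pow_le_pow_of_le_one a.le (by linarith) hN
        _ = _ := pow_one _
    set cst : Fin n → ℝ := fun i => |γ i / 2| * ((ls i).length * (2 * C)) +
      |γ i / 2| * (2 * (B i * (N + C * κ) / c₀ i)) with hcst
    have hcst0 : ∀ i, 0 ≤ cst i := by
      intro i
      have := hB i
      have := hc i
      simp only [hcst]
      positivity
    refine pieceGood N hN β₀ β₁ t₁ x₁ C κ ((Finset.univ : Finset (Fin n)).card * ∑ i, cst i) hC hκ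
      (mul_nonneg (by positivity) (Finset.sum_nonneg fun i _ => hcst0 i)) hex hlt h0 h1 hΔ ?_ hgi
    intro θ hθ
    have hP : ∀ x < x₁, HasDerivAt (fun x => Tm N β₀ β₁ (θ, x)) (Tm' N β₀ β₁ (θ, x) (0, 1)) x ∧
        ‖Tm' N β₀ β₁ (θ, x) (0, 1)‖ ≤ N + C * κ := by
      intro x hx
      obtain ⟨a, b⟩ := hr x hx
      have hcv : HasDerivAt (fun x : ℝ => ((θ, x) : ℝ × ℝ)) ((0, 1) : ℝ × ℝ) x :=
        (hasDerivAt_const x θ).prodMk (hasDerivAt_id x)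
      refine ⟨(hTd (θ, x) ⟨hθ, hx⟩).comp_hasDerivAt x hcv, ?_⟩
      refine (Tm'_bd N β₀ β₁ (θ, x) C κ hC hκ hθ (h0 _ a b).2 (h1 _ a b).2).trans ?_
      have h3 : rexp (N * x) ≤ 1 := by
        rw [exp_N]; exact (hsmall x hx).trans (by linarith)
      have : 0 ≤ N + C * κ := by positivity
      simp only
      nlinarith
    have hLL : ∀ i ∈ (Finset.univ : Finset (Fin n)), LL (∑ i, cst i) x₁
        (fun x => |F i (Tm N β₀ β₁ (θ, x))| ^ γ i) := by
      intro i _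
      refine (LLF (F i) N (ls i) (qs i) (γ i) (η i) C t₁ x₁ (B i) (N + C * κ) (c₀ i) β₀ β₁ hC (hc i) (hB i)
        (by positivity) (hroot i) (hq i) (hpos i) hex.le hlt hΔ θ hθ hP ?_).mono ?_ le_rfl
      · intro x hx
        obtain ⟨a, b⟩ := hr x hx
        have := htη i
        constructor
        · nlinarith
        · refine lt_of_le_of_lt (hnb θ hθ x hx) (lt_of_le_of_lt ?_ this)
          gcongr
          exact (hsmall x hx).trans b.le
      · exact Finset.single_le_sum (f := cst) (fun i _ => hcst0 i) (Finset.mem_univ i)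
    refine (LL.finset_prod _ (Finset.sum_nonneg fun i _ => hcst0 i) _ _ hLL).congr ?_
    intro x hx
    unfold stdFun
    rw [Set.indicator_of_mem]
    exact hE ⟨(θ, x), ⟨hθ, hx⟩, rfl⟩
  · apply Good.of_zero hmeas
    intro p hp
    unfold stdFun
    apply Set.indicator_of_notMem
    intro hpE
    obtain ⟨z, hz, hzE⟩ := Set.not_subset.1 hE
    exact preconn_frontier hconn hp hpE hz hzE hfr

def coneI (κ a₁ : ℝ) : Set (ℝ × ℝ) := {p | 0 < p.1 ∧ p.1 < a₁ ∧ |p.2| < κ * p.1}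

theorem coneI_meas (κ a₁ : ℝ) : MeasurableSet (coneI κ a₁) := by
  unfold coneI
  apply IsOpen.measurableSet
  refine IsOpen.inter ?_ (IsOpen.inter ?_ ?_)
  · exact isOpen_lt continuous_const continuous_fst
  · exact isOpen_lt continuous_fst continuous_const
  · exact isOpen_lt (continuous_snd.abs) (continuous_const.mul continuous_fst)

def cellD (N : ℕ) {K : ℕ} (β : Fin K → ℝ → ℝ) (im ip : Fin K) (t₁ : ℝ) (L : Finset (Fin K)) :
    Set (ℝ × ℝ) :=
  {p | im ∈ L ∧ ip ∉ L ∧ ∃ t, 0 < t ∧ t < t₁ ∧ p.1 = t ^ N ∧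
    ∀ i, (i ∈ L → β i t < p.2) ∧ (i ∉ L → p.2 < β i t)}

theorem curve_null (N : ℕ) (β : ℝ → ℝ) (t₁ : ℝ)
    (h : ∀ t, 0 < t → t < t₁ → DifferentiableAt ℝ β t) :
    volume {p : ℝ × ℝ | ∃ t, 0 < t ∧ t < t₁ ∧ p = (t ^ N, β t)} = 0 := by
  have h1 : volume ((fun q : ℝ × ℝ => (q.1 ^ N, β q.1)) '' (Ioo 0 t₁ ×ˢ {(0:ℝ)})) = 0 := by
    apply addHaar_image_eq_zero_of_differentiableOn_of_addHaar_eq_zero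
    · intro q hq
      have := (h q.1 hq.1.1 hq.1.2).comp q (differentiableAt_fst)
      exact (DifferentiableAt.prodMk (by fun_prop) this).differentiableWithinAt
    · rw [Measure.volume_eq_prod, Measure.prod_prod]
      simp
  refine measure_mono_null ?_ h1
  rintro p ⟨t, h1, h2, rfl⟩
  exact ⟨(t, 0), ⟨⟨h1, h2⟩, rfl⟩, rfl⟩

theorem typeI_core {n : ℕ} (F : Fin n → ℝ × ℝ → ℝ) (γ : Fin n → ℝ) (E : Set (ℝ × ℝ)) (N : ℕ)
    (hN : 1 ≤ N) (κ : ℝ) (hκ : 0 < κ) (ls : Fin n → List (ℝ → ℂ)) (qs : Fin n → ℝ × ℝ → ℝ)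
    (hR : ∀ i, RootData (F i) N (ls i) (qs i))
    {K : ℕ} (β : Fin K → ℝ → ℝ) (hβ : ∀ i, AnalyticAt ℝ (β i) 0) (im ip : Fin K)
    (him : β im = fun t => -(κ * t ^ N)) (hip : β ip = fun t => κ * t ^ N)
    (hre : ∀ i, ∀ ρ ∈ ls i, ∃ j, ∀ t, (ρ t).re = β j t)
    (t₀ : ℝ) (ht₀ : 0 < t₀)
    (hfr : ∀ t b, 0 < t → t < t₀ → |b| < κ * t ^ N → (t ^ N, b) ∈ frontier E → ∃ j, b = β j t)
    (U : Set (ℝ × ℝ)) (hU : U ∈ 𝓝 0) (hgi : IntegrableOn (stdFun n F γ E) U) :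
    ∃ a₁ > 0, coneI κ a₁ ⊆ U ∧ Good (stdFun n F γ E) (a₁ / 2) (coneI κ a₁) := by
  choose η' hη' hroot using fun i => (hR i).2.2.2
  choose η'' B c₀ hη'' hB hc hq using fun i => qbd (qs i) (hR i).2.1 (hR i).2.2.1
  -- the list of comparison functions
  let l : List (ℝ → ℝ) :=
    (List.finRange K).map β ++
    ((List.finRange K).flatMap fun i => (List.finRange K).map fun j => fun t => β i t - β j t) ++
    ((List.finRange n).flatMap fun i => (ls i).map fun ρ => fun t => (ρ t).im ^ 2)
  have hl : ∀ h ∈ l, AnalyticAt ℝ h 0 := by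
    intro h hh
    simp only [l, List.mem_append, List.mem_map, List.mem_flatMap, List.mem_finRange, true_and] at hh
    rcases hh with (⟨i, rfl⟩ | ⟨i, j, rfl⟩) | ⟨i, ρ, hρ, rfl⟩
    · exact hβ i
    · exact (hβ i).sub (hβ j)
    · have h1 : AnalyticAt ℝ ρ 0 := (hR i).1 ρ hρ
      have h2 : AnalyticAt ℝ (fun t => (ρ t).im) 0 :=
        AnalyticAt.fun_comp (g := Complex.imCLM) (f := ρ) (Complex.imCLM.analyticAt _) h1
      exact h2.pow 2
  obtain ⟨C, hC, t₂, ht₂, HL⟩ := an_list l hl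
  obtain ⟨u, hu, HU⟩ := Metric.mem_nhds_iff.1 hU
  have hex : ∃ t₁ > 0, t₁ ≤ 1 ∧ t₁ < t₀ ∧ t₁ < t₂ ∧ (1 + κ) * t₁ < u ∧
      ∀ i, (1 + κ) * t₁ < min (η' i) (η'' i) := by
    have hlim : Tendsto (fun t : ℝ => (1 + κ) * t) (𝓝[>] 0) (𝓝 0) := by
      have : Tendsto (fun t : ℝ => (1 + κ) * t) (𝓝 0) (𝓝 ((1 + κ) * 0)) :=
        (continuous_const.mul continuous_id).tendsto 0
      rw [mul_zero] at this
      exact this.mono_left nhdsWithin_le_nhds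
    have hid : Tendsto (fun t : ℝ => t) (𝓝[>] 0) (𝓝 0) := tendsto_id.mono_left nhdsWithin_le_nhds
    have e1 : ∀ᶠ t : ℝ in 𝓝[>] 0, ∀ i, (1 + κ) * t < min (η' i) (η'' i) :=
      eventually_all.2 fun i => hlim.eventually_lt_const (lt_min (hη' i) (hη'' i))
    obtain ⟨t, h⟩ := (((hid.eventually_lt_const one_pos).and ((hid.eventually_lt_const ht₀).and
      ((hid.eventually_lt_const ht₂).and ((hlim.eventually_lt_const hu).and
      (e1.and self_mem_nhdsWithin)))))).exists
    exact ⟨t, h.2.2.2.2.2, h.1.le, h.2.1, h.2.2.1, h.2.2.2.1, h.2.2.2.2.1⟩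
  obtain ⟨t₁, ht₁, ht1, htt0, htt2, htu, htη⟩ := hex
  have H1 : ∀ i, LDer C t₁ (β i) := fun i =>
    (HL (β i) (by simp [l])).1.mono le_rfl htt2.le
  have H2 : ∀ i j, LDer C t₁ (fun t => β i t - β j t) := fun i j =>
    (HL (fun t => β i t - β j t) (by simp only [l, List.mem_append, List.mem_map, List.mem_flatMap, List.mem_finRange, true_and]; exact Or.inl (Or.inr ⟨i, j, rfl⟩))).1.mono le_rfl htt2.le
  have H3 : ∀ i, ∀ ρ ∈ ls i, LDer C t₁ (fun t => (ρ t).im ^ 2) := fun i ρ hρ =>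
    (HL (fun t => (ρ t).im ^ 2) (by simp only [l, List.mem_append, List.mem_map, List.mem_flatMap, List.mem_finRange, true_and]; exact Or.inr ⟨i, ρ, hρ, rfl⟩)).1.mono le_rfl htt2.le
  have H4 : ∀ i j, (∀ t, 0 < t → t < t₁ → β i t < β j t) ∨ (∀ t, 0 < t → t < t₁ → β j t ≤ β i t) := by
    intro i j
    rcases (HL (fun t => β i t - β j t) (by simp only [l, List.mem_append, List.mem_map, List.mem_flatMap, List.mem_finRange, true_and]; exact Or.inl (Or.inr ⟨i, j, rfl⟩))).2 with h | h | h
    · exact Or.inl fun t a b => by linarith [h t a (b.trans htt2)]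
    · exact Or.inr fun t a b => by linarith [h t a (b.trans htt2)]
    · exact Or.inr fun t a b => by linarith [h t a (b.trans htt2)]
  clear_value l
  clear HL hl
  have H5 : ∀ i j, β i (t₁ / 2) ≤ β j (t₁ / 2) → ∀ t, 0 < t → t < t₁ → β i t ≤ β j t := by
    intro i j h
    rcases H4 j i with h' | h'
    · exact absurd (h' (t₁ / 2) (by linarith) (by linarith)) (not_lt.2 h)
    · exact h'
  have hpow : ∀ t, 0 < t → t < t₁ → t ^ N ≤ t ∧ t ^ N < t₁ ^ N := by
    intro t h1 h2
    exact ⟨by simpa using pow_le_pow_of_le_one h1.le (by linarith) hN,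
      pow_lt_pow_left₀ h2 h1.le (by omega)⟩
  have ha1 : t₁ ^ N ≤ t₁ := by simpa using pow_le_pow_of_le_one ht₁.le ht1 hN
  have hsub : coneI κ (t₁ ^ N) ⊆ U := by
    rintro p ⟨h1, h2, h3⟩
    apply HU
    rw [mem_ball_zero_iff, Prod.norm_def, max_lt_iff, Real.norm_eq_abs, Real.norm_eq_abs, abs_of_pos h1]
    constructor <;> nlinarith
  have hDsub : ∀ L, cellD N β im ip t₁ L ⊆ coneI κ (t₁ ^ N) := by
    rintro L p ⟨h1, h2, t, h3, h4, h5, h6⟩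
    have a := (h6 im).1 h1
    have b := (h6 ip).2 h2
    simp only [him, hip] at a b
    refine ⟨by rw [h5]; positivity, by rw [h5]; exact (hpow t h3 h4).2, ?_⟩
    rw [h5, abs_lt]; exact ⟨a, b⟩
  have hgW : IntegrableOn (stdFun n F γ E) (coneI κ (t₁ ^ N)) := hgi.mono_set hsub
  have hcell : ∀ L, MeasurableSet (cellD N β im ip t₁ L) ∧
      Good (stdFun n F γ E) (t₁ ^ N / 2) (cellD N β im ip t₁ L) := by
    intro L
    by_cases hL : im ∈ L ∧ ip ∉ L
    swap
    · have : cellD N β im ip t₁ L = ∅ := by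
        ext p
        simp only [cellD, mem_setOf_eq, mem_empty_iff_false, iff_false]
        exact fun h => hL ⟨h.1, h.2.1⟩
      rw [this]; exact ⟨MeasurableSet.empty, Good.empty⟩
    obtain ⟨i₀, hi₀, hmax⟩ := Finset.exists_max_image L (fun i => β i (t₁ / 2)) ⟨im, hL.1⟩
    obtain ⟨j₀, hj₀, hmin⟩ := Finset.exists_min_image Lᶜ (fun i => β i (t₁ / 2))
      ⟨ip, Finset.mem_compl.2 hL.2⟩
    rw [Finset.mem_compl] at hj₀
    have hmax' : ∀ i ∈ L, ∀ t, 0 < t → t < t₁ → β i t ≤ β i₀ t := fun i hi => H5 i i₀ (hmax i hi)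
    have hmin' : ∀ i ∉ L, ∀ t, 0 < t → t < t₁ → β j₀ t ≤ β i t := fun i hi =>
      H5 j₀ i (hmin i (Finset.mem_compl.2 hi))
    rcases H4 i₀ j₀ with hlt | hge
    swap
    · have : cellD N β im ip t₁ L = ∅ := by
        ext p
        simp only [cellD, mem_setOf_eq, mem_empty_iff_false, iff_false]
        rintro ⟨-, -, t, h3, h4, h5, h6⟩
        have a := (h6 i₀).1 hi₀
        have b := (h6 j₀).2 hj₀
        linarith [hge t h3 h4]
      rw [this]; exact ⟨MeasurableSet.empty, Good.empty⟩
    have hD : cellD N β im ip t₁ L = Tm N (β i₀) (β j₀) '' (Ioo 0 1 ×ˢ Iio (Real.log t₁)) := by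
      ext p
      constructor
      · rintro ⟨-, -, t, h3, h4, h5, h6⟩
        have a := (h6 i₀).1 hi₀
        have b := (h6 j₀).2 hj₀
        have hd : 0 < β j₀ t - β i₀ t := by linarith
        refine ⟨((p.2 - β i₀ t) / (β j₀ t - β i₀ t), Real.log t), ⟨⟨?_, ?_⟩, Real.log_lt_log h3 h4⟩, ?_⟩
        · exact div_pos (by linarith) hd
        · exact (div_lt_one hd).2 (by linarith)
        · unfold Tm
          simp only [exp_N, Real.exp_log h3]
          rw [div_mul_cancel₀ _ hd.ne']
          ext
          · exact h5.symm
          · simp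
      · rintro ⟨⟨θ, x⟩, ⟨hθ, hx⟩, rfl⟩
        have hx2 : rexp x < t₁ := by
          rw [← Real.exp_log ht₁]; exact Real.exp_lt_exp.2 hx
        have hx1 := Real.exp_pos x
        have k := hlt _ hx1 hx2
        have k1 : 0 < θ * (β j₀ (rexp x) - β i₀ (rexp x)) := mul_pos hθ.1 (by linarith)
        have k2 : 0 < (1 - θ) * (β j₀ (rexp x) - β i₀ (rexp x)) := mul_pos (by linarith [hθ.2]) (by linarith)
        refine ⟨hL.1, hL.2, rexp x, hx1, hx2, exp_N N x, fun i => ⟨fun hi => ?_, fun hi => ?_⟩⟩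
        · have := hmax' i hi _ hx1 hx2
          simp only [Tm]; linarith
        · have := hmin' i hi _ hx1 hx2
          simp only [Tm]; linarith
    have hfin := piece_core F γ E N hN κ hκ ls qs (fun i => min (η' i) (η'' i)) B c₀ hB hc
      (fun i t b h1 h2 => hroot i t b (h1.trans_le (min_le_left _ _)) (h2.trans_le (min_le_left _ _)))
      (fun i p hp => hq i p (hp.trans_le (min_le_right _ _))) C t₁ hC ht₁ ht1 htη (β i₀) (β j₀) hlt
      ?_ ?_ (H1 _) (H1 _) (H2 _ _) ?_ ?_ ?_
    · rw [hD]; exact hfin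
    · intro t a b
      have := hmax' im hL.1 t a b
      simpa only [him] using this
    · intro t a b
      have := hmin' ip hL.2 t a b
      simpa only [hip] using this
    · intro i ρ hρ
      refine ⟨H3 i ρ hρ, ?_⟩
      obtain ⟨j, hj⟩ := hre i ρ hρ
      simp only [hj]
      by_cases hjL : j ∈ L
      · exact Or.inl ⟨hmax' j hjL, H2 _ _⟩
      · exact Or.inr ⟨hmin' j hjL, H2 _ _⟩
    · intro p hp hpf
      rw [← hD] at hp
      have hp2 := hDsub L hp
      obtain ⟨-, -, t, h3, h4, h5, h6⟩ := hp
      obtain ⟨j, hj⟩ := hfr t p.2 h3 (h4.trans htt0) (by rw [← h5]; exact hp2.2.2)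
        (by rw [← h5]; exact hpf)
      by_cases hjL : j ∈ L
      · linarith [(h6 j).1 hjL]
      · linarith [(h6 j).2 hjL]
    · rw [← hD]; exact hgW.mono_set (hDsub L)
  refine ⟨t₁ ^ N, by positivity, hsub, ?_⟩
  have hU := Good.biUnion (Finset.univ : Finset (Finset (Fin K))) (cellD N β im ip t₁)
    (stdFun_nonneg n F γ E) (fun L _ => (hcell L).2) ?_ (fun L => (hcell L).1)
    (fun L => hgW.mono_set (hDsub L))
  · refine hU.congr ?_
    apply Filter.EventuallyLE.antisymm
    · exact (HasSubset.Subset.eventuallyLE (by simpa using hDsub))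
    · rw [ae_le_set]
      refine measure_mono_null ?_ (measure_iUnion_null (fun j => curve_null N (β j) t₁ ?_) (ι := Fin K))
      · rintro p ⟨⟨h1, h2, h3⟩, hp⟩
        obtain ⟨t, ht, htp⟩ : ∃ t : ℝ, 0 < t ∧ p.1 = t ^ N := by
          refine ⟨p.1 ^ ((N:ℝ)⁻¹), by positivity, ?_⟩
          rw [← Real.rpow_natCast, ← Real.rpow_mul h1.le, inv_mul_cancel₀ (by positivity), Real.rpow_one]
        have htt : t < t₁ := by
          rw [htp] at h2
          exact lt_of_pow_lt_pow_left₀ N ht₁.le h2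
        by_contra hno
        apply hp
        simp only [mem_iUnion, mem_setOf_eq, not_exists, not_and] at hno
        have hne : ∀ j, p.2 ≠ β j t := fun j hj => hno j t ht htt (by ext; exacts [htp, hj])
        simp only [mem_iUnion, Finset.mem_univ, exists_prop, true_and]
        rw [htp, abs_lt] at h3
        refine ⟨Finset.univ.filter (fun i => β i t < p.2), ?_, ?_, t, ht, htt, htp, fun i => ⟨?_, ?_⟩⟩
        · simp [him, h3.1]
        · simp [hip, h3.2.le]
        · simp
        · simp only [Finset.mem_filter, Finset.mem_univ, true_and, not_lt]
          intro h
          exact lt_of_le_of_ne h (hne i)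
      · intro t a b
        obtain ⟨_, hd, _⟩ := H1 j t a b
        exact hd.differentiableAt
  · intro L L' hLL
    rw [Set.disjoint_left]
    rintro p ⟨-, -, t, h3, h4, h5, h6⟩ ⟨-, -, t', h3', h4', h5', h6'⟩
    have htt : t = t' := (pow_left_inj₀ h3.le h3'.le (by omega)).1 (h5.symm.trans h5')
    subst htt
    apply hLL
    ext i
    constructor
    · intro hi
      by_contra hi'
      linarith [(h6 i).1 hi, (h6' i).2 hi']
    · intro hi
      by_contra hi'
      linarith [(h6 i).2 hi', (h6' i).1 hi]

def EdgeData (κ : ℝ) (E : Set (ℝ × ℝ)) (M : ℕ) (bs : List (ℝ → ℝ)) : Prop :=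
  (∀ β ∈ bs, AnalyticAt ℝ β 0) ∧ ∃ t₀ > 0, ∀ t b, 0 < t → t < t₀ → |b| < κ * t ^ M →
    (t ^ M, b) ∈ E → ∃ β ∈ bs, b = β t

theorem EdgeData.ramify {κ : ℝ} {E : Set (ℝ × ℝ)} {M : ℕ} {bs : List (ℝ → ℝ)}
    (h : EdgeData κ E M bs) (P : ℕ) (hP : 0 < P) :
    EdgeData κ E (M * P) (bs.map fun β t => β (t ^ P)) := by
  obtain ⟨h1, t₀, ht₀, h2⟩ := h
  refine ⟨?_, min 1 t₀, by positivity, ?_⟩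
  · intro β hβ
    obtain ⟨β', hβ', rfl⟩ := List.mem_map.1 hβ
    have : AnalyticAt ℝ (fun t : ℝ => t ^ P) 0 := by fun_prop
    refine AnalyticAt.fun_comp (g := β') (f := fun t : ℝ => t ^ P) ?_ this
    simp only [zero_pow hP.ne']
    exact h1 β' hβ'
  · intro t b ht ht' hb hf
    have e : t ^ (M * P) = (t ^ P) ^ M := by rw [mul_comm, pow_mul]
    rw [e] at hb hf
    have hlt : t ^ P < t₀ := by
      have : t ^ P ≤ t ^ 1 := pow_le_pow_of_le_one ht.le (ht'.le.trans (min_le_left _ _)) hP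
      rw [pow_one] at this
      exact this.trans_lt (ht'.trans_le (min_le_right _ _))
    obtain ⟨β, hβ, hbe⟩ := h2 (t ^ P) b (by positivity) hlt hb hf
    exact ⟨_, List.mem_map.2 ⟨β, hβ, rfl⟩, hbe⟩

theorem typeI {n : ℕ} (F : Fin n → ℝ × ℝ → ℝ) (γ : Fin n → ℝ) (E : Set (ℝ × ℝ))
    (hF : ∀ i, AnalyticAt ℝ (F i) 0) (h0 : ∀ i, ¬ ∀ᶠ b in 𝓝 (0:ℝ), F i (0, b) = 0)
    (κ : ℝ) (hκ : 0 < κ) (M : ℕ) (hM : 0 < M) (bs : List (ℝ → ℝ)) (hE : EdgeData κ (frontier E) M bs)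
    (U : Set (ℝ × ℝ)) (hU : U ∈ 𝓝 0) (hgi : IntegrableOn (stdFun n F γ E) U) :
    ∃ a₁ > 0, coneI κ a₁ ⊆ U ∧ Good (stdFun n F γ E) (a₁ / 2) (coneI κ a₁) := by
  choose Ns hNs ls qs hR using fun i => exists_rootData (F i) (hF i) (h0 i)
  set P := ∏ i, Ns i with hP
  have hP0 : 0 < P := Finset.prod_pos fun i _ => hNs i
  have hdiv : ∀ i, Ns i ∣ M * P := fun i =>
    (Finset.dvd_prod_of_mem Ns (Finset.mem_univ i)).mul_left M
  choose Ks hKs using hdiv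
  have hN0 : 0 < M * P := Nat.mul_pos hM hP0
  have hKs0 : ∀ i, 0 < Ks i := by
    intro i
    apply Nat.pos_of_ne_zero
    intro h
    have := hKs i
    rw [h, mul_zero] at this
    omega
  have hR' : ∀ i, RootData (F i) (M * P) ((ls i).map fun ρ t => ρ (t ^ Ks i)) (qs i) := by
    intro i
    have := (hR i).ramify (Ks i) (hKs0 i)
    rwa [mul_comm (Ks i), ← hKs i] at this
  have hE' := hE.ramify P hP0
  set N := M * P
  set ls' : Fin n → List (ℝ → ℂ) := fun i => (ls i).map fun ρ t => ρ (t ^ Ks i)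
  set bs' := bs.map fun β t => β (t ^ P)
  set nodes : List (ℝ → ℝ) := [fun t => -(κ * t ^ N), fun t => κ * t ^ N] ++ bs' ++
    ((List.finRange n).flatMap fun i => (ls' i).map fun ρ t => (ρ t).re) with hnodes
  have hmem : ∀ b ∈ nodes, ∃ j : Fin nodes.length, nodes.get j = b := fun b hb => List.get_of_mem hb
  have hA : ∀ b ∈ nodes, AnalyticAt ℝ b 0 := by
    intro b hb
    simp only [hnodes, List.mem_append, List.mem_cons, List.mem_flatMap, List.mem_map,
      List.mem_finRange, true_and, List.not_mem_nil, or_false] at hb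
    rcases hb with ((rfl | rfl) | hb) | ⟨i, ρ, hρ, rfl⟩
    · fun_prop
    · fun_prop
    · exact hE'.1 b hb
    · exact AnalyticAt.fun_comp (g := Complex.reCLM) (f := ρ) (Complex.reCLM.analyticAt _) ((hR' i).1 ρ hρ)
  obtain ⟨im, him⟩ := hmem (fun t => -(κ * t ^ N)) (by simp [hnodes])
  obtain ⟨ip, hip⟩ := hmem (fun t => κ * t ^ N) (by simp [hnodes])
  obtain ⟨t₀, ht₀, hfr⟩ := hE'.2
  refine typeI_core F γ E N hN0 κ hκ ls' qs hR' (fun j => nodes.get j)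
    (fun j => hA _ (List.get_mem _ _)) im ip him hip ?_ t₀ ht₀ ?_ U hU hgi
  · intro i ρ hρ
    obtain ⟨j, hj⟩ := hmem (fun t => (ρ t).re) (by
      simp only [hnodes, List.mem_append, List.mem_flatMap, List.mem_map, List.mem_finRange, true_and]
      exact Or.inr ⟨i, ρ, hρ, rfl⟩)
    exact ⟨j, fun t => by rw [hj]⟩
  · intro t b h1 h2 h3 h4
    obtain ⟨β, hβ, hb⟩ := hfr t b h1 h2 h3 h4
    obtain ⟨j, hj⟩ := hmem β (by simp only [hnodes, List.mem_append]; exact Or.inl (Or.inr hβ))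
    exact ⟨j, by rw [hj]; exact hb⟩

theorem psum_zero {V : Type*} [NormedAddCommGroup V] [NormedSpace ℝ V] [CompleteSpace V]
    (f : ℝ × ℝ → V) (p : FormalMultilinearSeries ℝ (ℝ × ℝ) V) (hp : HasFPowerSeriesAt f p 0)
    (m : ℕ) (hm : iteratedFDeriv ℝ m f 0 = 0) (y : ℝ × ℝ) : p m (fun _ => y) = 0 := by
  obtain ⟨r, hr⟩ := hp
  have := hr.factorial_smul y m
  rw [hm] at this
  simp only [ContinuousMultilinearMap.zero_apply] at this
  rw [← Nat.cast_smul_eq_nsmul ℝ] at this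
  exact (smul_eq_zero.1 this).resolve_left (Nat.cast_ne_zero.2 (Nat.factorial_ne_zero m))

theorem lowBd (f : ℝ × ℝ → ℝ) (hf : AnalyticAt ℝ f 0) (W : ℝ × ℝ) (hW : lowestPart f W ≠ 0) :
    ∃ (k : ℕ) (c C κ r : ℝ), 0 < c ∧ 0 < κ ∧ 0 < r ∧ ∀ (b : ℝ) (w : ℝ × ℝ), 0 < b → b < r →
      ‖w - W‖ < κ → c * b ^ k ≤ |f (b • w)| ∧ |f (b • w)| ≤ C * b ^ k ∧
      DifferentiableAt ℝ f (b • w) ∧ b * ‖fderiv ℝ f (b • w)‖ ≤ C * b ^ k := by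
  set k := vanishingOrder f with hk
  have hlow : ∀ m < k, iteratedFDeriv ℝ m f 0 = 0 := by
    intro m hm
    have := Nat.notMem_of_lt_sInf hm
    simpa using this
  obtain ⟨p, hp⟩ := hf
  have hf : AnalyticAt ℝ f 0 := ⟨p, hp⟩
  obtain ⟨q, hq⟩ := hf.fderiv
  have hA := hp.isBigO_sub_partialSum_pow (k + 1)
  have hB := hq.isBigO_sub_partialSum_pow (k - 1)
  have hA' : ∀ y, p.partialSum (k + 1) y = p k (fun _ => y) := by
    intro y
    rw [FormalMultilinearSeries.partialSum, Finset.sum_range_succ, Finset.sum_eq_zero, zero_add]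
    intro m hm
    exact psum_zero f p hp m (hlow m (Finset.mem_range.1 hm)) y
  have hB' : ∀ y, q.partialSum (k - 1) y = 0 := by
    intro y
    rw [FormalMultilinearSeries.partialSum, Finset.sum_eq_zero]
    intro m hm
    refine psum_zero (fderiv ℝ f) q hq m ?_ y
    rw [← norm_eq_zero, norm_iteratedFDeriv_fderiv, hlow (m + 1) (by have := Finset.mem_range.1 hm; omega),
      norm_zero]
  simp only [hA', zero_add, hB', sub_zero] at hA hB
  obtain ⟨K1, hK1, hA⟩ := hA.exists_pos
  obtain ⟨K2, hK2, hB⟩ := hB.exists_pos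
  have hd : ∀ᶠ y in 𝓝 (0 : ℝ × ℝ), DifferentiableAt ℝ f y :=
    hf.eventually_analyticAt.mono fun y hy => hy.differentiableAt
  obtain ⟨δ, hδ, Hδ⟩ := Metric.eventually_nhds_iff.1 (hA.bound.and (hB.bound.and hd))
  set P : ℝ × ℝ → ℝ := fun y => p k (fun _ => y) with hPdef
  have hPc : Continuous P := by
    rw [hPdef]
    exact (p k).cont.comp (continuous_pi fun _ => continuous_id)
  have hPW : P W ≠ 0 := by
    intro h
    apply hW
    obtain ⟨r, hr⟩ := hp
    have h2 := hr.factorial_smul W k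
    simp only [lowestPart]
    rw [← hk, ← h2]
    simp only [hPdef] at h
    rw [h, smul_zero]
  have hPh : ∀ (b : ℝ) w, P (b • w) = b ^ k * P w := by
    intro b w
    simp only [hPdef]
    have := (p k).map_smul_univ (fun _ => b) (fun _ => w)
    simpa using this
  have e1 : ∀ᶠ w in 𝓝 W, |P W| / 2 < |P w| :=
    continuousAt_const.eventually_lt hPc.abs.continuousAt (by linarith [abs_pos.2 hPW])
  have e2 : ∀ᶠ w in 𝓝 W, |P w| < |P W| + 1 :=
    hPc.abs.continuousAt.eventually_lt continuousAt_const (by linarith)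
  obtain ⟨κ, hκ, Hκ⟩ := Metric.eventually_nhds_iff.1 (e1.and e2)
  set c := |P W| / 2
  have hc : 0 < c := half_pos (abs_pos.2 hPW)
  set B := ‖W‖ + 1 with hBdef
  have hB1 : 1 ≤ B := by simp only [hBdef]; linarith [norm_nonneg W]
  set Q := K1 * B ^ (k + 1)
  have hQ : 0 < Q := by positivity
  refine ⟨k, c / 2, max (|P W| + 1 + Q) (K2 * B ^ (k - 1)), min κ 1, min 1 (min (δ / B) (c / (2 * Q))),
    by positivity, by positivity, by positivity, ?_⟩
  intro b w hb hbr hw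
  have hb1 : b < 1 := hbr.trans_le (min_le_left _ _)
  have hb2 : b < δ / B := hbr.trans_le ((min_le_right _ _).trans (min_le_left _ _))
  have hb3 : b < c / (2 * Q) := hbr.trans_le ((min_le_right _ _).trans (min_le_right _ _))
  have hwB : ‖w‖ ≤ B := by
    have : ‖w‖ ≤ ‖w - W‖ + ‖W‖ := by simpa using norm_add_le (w - W) W
    have := hw.trans_le (min_le_right _ _)
    simp only [hBdef]; linarith
  have hbw : ‖b • w‖ ≤ b * B := by
    rw [norm_smul, Real.norm_of_nonneg hb.le]; gcongr
  rw [lt_div_iff₀ (by positivity)] at hb2 hb3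
  obtain ⟨k1, k2, k3⟩ := Hδ (y := b • w) (by rw [dist_zero_right]; linarith)
  obtain ⟨m1, m2⟩ := Hκ (y := w) (by rw [dist_eq_norm]; exact hw.trans_le (min_le_left _ _))
  have hPb : |P (b • w)| = b ^ k * |P w| := by rw [hPh, abs_mul, abs_of_pos (by positivity)]
  have hrem : |f (b • w) - P (b • w)| ≤ b * Q * b ^ k := by
    have : ‖f (b • w) - P (b • w)‖ ≤ K1 * ‖‖b • w‖ ^ (k + 1)‖ := k1
    rw [Real.norm_eq_abs, Real.norm_of_nonneg (by positivity)] at this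
    refine this.trans ?_
    calc K1 * ‖b • w‖ ^ (k + 1) ≤ K1 * (b * B) ^ (k + 1) := by gcongr
      _ = _ := by simp only [Q]; ring
  have hbk : 0 < b ^ k := by positivity
  refine ⟨?_, ?_, k3, ?_⟩
  · have : |P (b • w)| ≤ |f (b • w)| + |f (b • w) - P (b • w)| := by
      rw [abs_sub_comm]
      have := abs_sub_abs_le_abs_sub (P (b • w)) (f (b • w))
      linarith
    nlinarith
  · have : |f (b • w)| ≤ |P (b • w)| + |f (b • w) - P (b • w)| := by
      have := abs_sub_abs_le_abs_sub (f (b • w)) (P (b • w))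
      linarith
    calc |f (b • w)| ≤ (|P W| + 1 + Q) * b ^ k := by nlinarith [mul_pos hQ hbk]
      _ ≤ _ := by gcongr; exact le_max_left _ _
  · rw [Real.norm_of_nonneg (by positivity)] at k2
    have h3 : b * b ^ (k - 1) ≤ b ^ k := by
      rcases Nat.eq_zero_or_pos k with h | h
      · rw [h]; simp; exact hb1.le
      · rw [← pow_succ', Nat.sub_add_cancel h]
    calc b * ‖fderiv ℝ f (b • w)‖ ≤ b * (K2 * ‖b • w‖ ^ (k - 1)) := by gcongr
      _ ≤ b * (K2 * (b * B) ^ (k - 1)) := by gcongr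
      _ = (K2 * B ^ (k - 1)) * (b * b ^ (k - 1)) := by rw [mul_pow]; ring
      _ ≤ (K2 * B ^ (k - 1)) * b ^ k := by gcongr
      _ ≤ _ := by gcongr; exact le_max_right _ _

def coneII (κ r : ℝ) : Set (ℝ × ℝ) := {p | 0 < p.2 ∧ p.2 < r ∧ |p.1| < κ * p.2}

theorem coneII_meas (κ a₁ : ℝ) : MeasurableSet (coneII κ a₁) := by
  unfold coneII
  apply IsOpen.measurableSet
  refine IsOpen.inter ?_ (IsOpen.inter ?_ ?_)
  · exact isOpen_lt continuous_const continuous_snd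
  · exact isOpen_lt continuous_snd continuous_const
  · exact isOpen_lt (continuous_fst.abs) (continuous_const.mul continuous_snd)

theorem coneII_conn (κ r : ℝ) : IsPreconnected (coneII κ r) := by
  apply Convex.isPreconnected
  intro p hp q hq a b ha hb hab
  obtain ⟨p1, p2, p3⟩ := hp
  obtain ⟨q1, q2, q3⟩ := hq
  rw [abs_lt] at p3 q3
  simp only [coneII, mem_setOf_eq, Prod.fst_add, Prod.smul_fst, smul_eq_mul, Prod.snd_add, Prod.smul_snd]
  rcases ha.eq_or_lt with h | h
  · have hb1 : b = 1 := by linarith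
    subst h hb1
    simp only [zero_mul, zero_add, one_mul]
    exact ⟨q1, q2, abs_lt.2 q3⟩
  · refine ⟨by nlinarith [mul_pos h p1], by nlinarith [mul_pos h (sub_pos.2 p2), mul_nonneg hb (sub_pos.2 q2).le], ?_⟩
    rw [abs_lt]
    constructor
    · nlinarith [mul_pos h (sub_pos.2 p3.1), mul_nonneg hb (sub_pos.2 q3.1).le]
    · nlinarith [mul_pos h (sub_pos.2 p3.2), mul_nonneg hb (sub_pos.2 q3.2).le]

def ConeBd (F : ℝ × ℝ → ℝ) (k : ℕ) (c C κ r : ℝ) : Prop :=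
  ∀ p ∈ coneII κ r, c * p.2 ^ k ≤ |F p| ∧ |F p| ≤ C * p.2 ^ k ∧
    ∃ F' : ℝ × ℝ →L[ℝ] ℝ, HasFDerivAt F F' p ∧ p.2 * ‖F'‖ ≤ C * p.2 ^ k

def T2 (q : ℝ × ℝ) : ℝ × ℝ := (q.1 * rexp q.2, rexp q.2)

def T2' (q : ℝ × ℝ) : ℝ × ℝ →L[ℝ] ℝ × ℝ :=
  (rexp q.2 • ContinuousLinearMap.fst ℝ ℝ ℝ + (q.1 * rexp q.2) • ContinuousLinearMap.snd ℝ ℝ ℝ).prod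
    ((0:ℝ) • ContinuousLinearMap.fst ℝ ℝ ℝ + rexp q.2 • ContinuousLinearMap.snd ℝ ℝ ℝ)

theorem hasFDerivAt_T2 (q : ℝ × ℝ) : HasFDerivAt T2 (T2' q) q := by
  have h1 : HasFDerivAt (fun q : ℝ × ℝ => rexp q.2) (rexp q.2 • ContinuousLinearMap.snd ℝ ℝ ℝ) q :=
    hasFDerivAt_snd.exp
  have h2 : HasFDerivAt (fun q : ℝ × ℝ => q.1 * rexp q.2) _ q := hasFDerivAt_fst.mul h1
  refine (h2.prodMk h1).congr_fderiv ?_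
  ext <;> simp [T2']

theorem T2_image (κ r : ℝ) (hr : 0 < r) : T2 '' (Ioo (-κ) κ ×ˢ Iio (Real.log r)) = coneII κ r := by
  ext p
  constructor
  · rintro ⟨⟨θ, x⟩, ⟨hθ, hx⟩, rfl⟩
    refine ⟨Real.exp_pos _, ?_, ?_⟩
    · simp only [T2]; rw [← Real.exp_log hr]; exact Real.exp_lt_exp.2 hx
    · simp only [T2]; rw [abs_mul, Real.abs_exp]
      have : |θ| < κ := abs_lt.2 hθ
      gcongr
  · rintro ⟨h1, h2, h3⟩
    refine ⟨(p.1 / p.2, Real.log p.2), ⟨?_, Real.log_lt_log h1 h2⟩, ?_⟩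
    · have : |p.1 / p.2| < κ := by rw [abs_div, abs_of_pos h1, div_lt_iff₀ h1]; exact h3
      exact abs_lt.1 this
    · simp only [T2, Real.exp_log h1]
      ext
      · simp; field_simp
      · rfl

theorem cone_subset_or {E : Set (ℝ × ℝ)} {κ r : ℝ} (hfr : ∀ p ∈ coneII κ r, p ∉ frontier E) :
    coneII κ r ⊆ E ∨ ∀ p ∈ coneII κ r, p ∉ E := by
  by_cases hE : coneII κ r ⊆ E
  · exact Or.inl hE
  · right
    intro p hp hpE
    obtain ⟨z, hz, hzE⟩ := Set.not_subset.1 hE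
    exact preconn_frontier (coneII_conn κ r) hp hpE hz hzE hfr

theorem typeII {n : ℕ} (F : Fin n → ℝ × ℝ → ℝ) (γ : Fin n → ℝ) (E : Set (ℝ × ℝ)) (κ r : ℝ)
    (hκ : 0 < κ) (hκ1 : κ ≤ 1) (hr : 0 < r) (k : Fin n → ℕ) (c C : Fin n → ℝ) (hc : ∀ i, 0 < c i)
    (hF : ∀ i, ConeBd (F i) (k i) (c i) (C i) κ r) (hfr : ∀ p ∈ coneII κ r, p ∉ frontier E)
    (hgi : IntegrableOn (stdFun n F γ E) (coneII κ r)) :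
    Good (stdFun n F γ E) (r / 2) (coneII κ r) := by
  rcases cone_subset_or hfr with hE | hE
  swap
  · apply Good.of_zero (coneII_meas κ r)
    intro p hp
    exact Set.indicator_of_notMem (hE p hp) _
  have him := T2_image κ r hr
  have hmem : ∀ θ ∈ Ioo (-κ) κ, ∀ x < Real.log r, T2 (θ, x) ∈ coneII κ r := by
    intro θ hθ x hx
    rw [← him]
    exact ⟨(θ, x), ⟨hθ, hx⟩, rfl⟩
  have hCn : ∀ i, 0 ≤ C i := by
    intro i
    have hm := hmem 0 ⟨by linarith, hκ⟩ (Real.log r - 1) (by linarith)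
    obtain ⟨h1, h2, -⟩ := hF i _ hm
    have hp : 0 < (T2 (0, Real.log r - 1)).2 ^ k i := pow_pos hm.1 _
    have := (mul_pos (hc i) hp).le.trans (h1.trans h2)
    exact nonneg_of_mul_nonneg_left this hp
  rw [← him] at hgi ⊢
  set cst : Fin n → ℝ := fun i => |γ i| * (C i / c i) with hcst
  have hcst0 : ∀ i, 0 ≤ cst i := fun i => by
    have := hCn i
    have := hc i
    simp only [hcst]; positivity
  refine lemmaZ (C₀ := 2 + (Finset.univ : Finset (Fin n)).card * ∑ i, cst i) (C₁ := 1)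
    (x₂ := Real.log (r / 2)) measurableSet_Ioo 1 le_rfl T2 T2'
    (fun θ => θ) ?_ zero_le_one ?_ ?_ ?_ ?_ ?_ ?_ ?_ ?_ hgi
  · have : 0 ≤ ∑ i, cst i := Finset.sum_nonneg fun i _ => hcst0 i
    positivity
  · exact Real.log_lt_log (by positivity) (by linarith)
  · exact fun q _ => hasFDerivAt_T2 q
  · intro q _ q' _ h
    have h2 : rexp q.2 = rexp q'.2 := congrArg Prod.snd h
    have h1 : q.1 * rexp q.2 = q'.1 * rexp q'.2 := congrArg Prod.fst h
    have h3 := Real.exp_injective h2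
    rw [h3] at h1
    exact Prod.ext (mul_right_cancel₀ (Real.exp_ne_zero _) h1) h3
  · intro q _
    simp [T2]
  · intro θ hθ
    have hLL : ∀ i ∈ (Finset.univ : Finset (Fin n)), LL (∑ i, cst i) (Real.log r)
        (fun x => |F i (T2 (θ, x))| ^ γ i) := by
      intro i _
      have hpos : ∀ x < Real.log r, 0 < |F i (T2 (θ, x))| := by
        intro x hx
        have hm := hmem θ hθ x hx
        exact (mul_pos (hc i) (pow_pos hm.1 _)).trans_le (hF i _ hm).1
      have h1 : LL (C i / c i) (Real.log r) (fun x => |F i (T2 (θ, x))|) := by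
        intro x hx
        have hm := hmem θ hθ x hx
        obtain ⟨b1, b2, F', b3, b4⟩ := hF i _ hm
        have hcv : HasDerivAt (fun x : ℝ => ((θ, x) : ℝ × ℝ)) ((0, 1) : ℝ × ℝ) x :=
          (hasDerivAt_const x θ).prodMk (hasDerivAt_id x)
        have hd := b3.comp_hasDerivAt x ((hasFDerivAt_T2 (θ, x)).comp_hasDerivAt x hcv)
        have hd2 := HasDerivAt.comp x (hasDerivAt_abs (abs_pos.1 (hpos x hx))) hd
        refine ⟨abs_nonneg _, _, hd2, ?_⟩
        have hn : ‖T2' (θ, x) (0, 1)‖ ≤ rexp x := by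
          rw [Prod.norm_def]
          have : |θ| ≤ 1 := (abs_lt.2 hθ).le.trans hκ1
          apply max_le
          · simp [T2', abs_mul]
            nlinarith [Real.exp_pos x]
          · simp [T2']
        have hsg : |((SignType.sign (F i (T2 (θ, x))) : SignType) : ℝ)| ≤ 1 := by
          rcases lt_trichotomy (F i (T2 (θ, x))) 0 with h | h | h <;> simp [h]
        rw [abs_mul]
        calc _ ≤ 1 * (‖F'‖ * ‖T2' (θ, x) (0, 1)‖) := by
              gcongr
              · exact hsg
              · exact F'.le_opNorm _
          _ ≤ 1 * (‖F'‖ * rexp x) := by gcongr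
          _ = (T2 (θ, x)).2 * ‖F'‖ := by simp [T2, mul_comm]
          _ ≤ C i * (T2 (θ, x)).2 ^ k i := b4
          _ = C i / c i * (c i * (T2 (θ, x)).2 ^ k i) := by have := (hc i).ne'; field_simp
          _ ≤ _ := by
            have := hCn i
            have := hc i
            gcongr
      exact (h1.rpow hpos (γ i)).mono
        (Finset.single_le_sum (f := cst) (fun i _ => hcst0 i) (Finset.mem_univ i)) le_rfl
    have h4 := ((LL.exp (x₁ := Real.log r) 2).mul
      (LL.finset_prod _ (Finset.sum_nonneg fun i _ => hcst0 i) _ _ hLL))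
    refine (h4.mono (by norm_num) le_rfl).congr ?_
    intro x hx
    unfold stdFun
    rw [Set.indicator_of_mem (hE (hmem θ hθ x hx))]
    congr 1
    rw [T2', det_prod2]
    simp only [mul_zero, sub_zero]
    rw [← Real.exp_add, Real.abs_exp]
    push_cast
    ring_nf
  · rintro ⟨θ, x⟩ ⟨hθ, hx⟩
    have : |θ| ≤ 1 := (abs_lt.2 hθ).le.trans hκ1
    have h5 : rexp x ≤ ‖T2 (θ, x)‖ := by
      rw [Prod.norm_def]
      refine le_trans ?_ (le_max_right _ _)
      simp [T2]
    rw [one_mul]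
    refine le_trans ?_ h5
    rw [Prod.norm_def]
    apply max_le
    · simp [T2', abs_mul]
      nlinarith [Real.exp_pos x]
    · simp [T2']
  · intro q _ h
    have := congrArg Prod.snd h
    simp [T2] at this
  · rintro ⟨θ, x⟩ ⟨hθ, hx⟩ h
    rw [Prod.norm_def]
    refine le_trans ?_ (le_max_right _ _)
    simp only [T2, Real.norm_eq_abs, Real.abs_exp]
    rw [← Real.exp_log (show 0 < r / 2 by positivity)]
    exact Real.exp_le_exp.2 h

def flip2 (σ τ : ℝ) (p : ℝ × ℝ) : ℝ × ℝ := (σ * p.1, τ * p.2)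

theorem flip2_flip2 {σ τ : ℝ} (hσ : σ = 1 ∨ σ = -1) (hτ : τ = 1 ∨ τ = -1) (p : ℝ × ℝ) :
    flip2 σ τ (flip2 σ τ p) = p := by
  rcases hσ with rfl | rfl <;> rcases hτ with rfl | rfl <;> simp [flip2]

theorem norm_flip2 {σ τ : ℝ} (hσ : σ = 1 ∨ σ = -1) (hτ : τ = 1 ∨ τ = -1) (p : ℝ × ℝ) :
    ‖flip2 σ τ p‖ = ‖p‖ := by
  rcases hσ with rfl | rfl <;> rcases hτ with rfl | rfl <;> simp [flip2, Prod.norm_def]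

theorem mp_sign {σ : ℝ} (hσ : σ = 1 ∨ σ = -1) : MeasurePreserving (fun x : ℝ => σ * x) volume volume := by
  rcases hσ with rfl | rfl
  · simp only [one_mul]; exact MeasurePreserving.id (volume : Measure ℝ)
  · simpa using Measure.measurePreserving_neg (volume : Measure ℝ)

theorem mp_flip2 {σ τ : ℝ} (hσ : σ = 1 ∨ σ = -1) (hτ : τ = 1 ∨ τ = -1) :
    MeasurePreserving (flip2 σ τ) volume volume := (mp_sign hσ).prod (mp_sign hτ)

theorem flip2_cont (σ τ : ℝ) : Continuous (flip2 σ τ) := by unfold flip2; fun_prop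

theorem emb_flip2 {σ τ : ℝ} (hσ : σ = 1 ∨ σ = -1) (hτ : τ = 1 ∨ τ = -1) :
    MeasurableEmbedding (flip2 σ τ) :=
  MeasurableEquiv.measurableEmbedding
    { toFun := flip2 σ τ, invFun := flip2 σ τ, left_inv := flip2_flip2 hσ hτ,
      right_inv := flip2_flip2 hσ hτ, measurable_toFun := (flip2_cont σ τ).measurable,
      measurable_invFun := (flip2_cont σ τ).measurable }

theorem setInt_flip {V : Type*} [NormedAddCommGroup V] [NormedSpace ℝ V] {σ τ : ℝ}
    (hσ : σ = 1 ∨ σ = -1) (hτ : τ = 1 ∨ τ = -1) (D : Set (ℝ × ℝ)) (h : ℝ × ℝ → V) :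
    ∫ p in flip2 σ τ ⁻¹' D, h p = ∫ p in D, h (flip2 σ τ p) := by
  have := (mp_flip2 hσ hτ).setIntegral_preimage_emb (emb_flip2 hσ hτ) (fun p => h (flip2 σ τ p)) D
  simp only [flip2_flip2 hσ hτ] at this
  exact this

theorem Tame.flip {σ τ : ℝ} (hσ : σ = 1 ∨ σ = -1) (hτ : τ = 1 ∨ τ = -1) {M r : ℝ}
    {Ψ : ℝ × ℝ → ℂ} (h : Tame M r Ψ) : Tame M r (fun p => Ψ (flip2 σ τ p)) := by
  obtain ⟨h1, h2, h3, h4⟩ := h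
  let L : ℝ × ℝ →L[ℝ] ℝ × ℝ := (σ • ContinuousLinearMap.fst ℝ ℝ ℝ).prod (τ • ContinuousLinearMap.snd ℝ ℝ ℝ)
  have hL : ∀ p, L p = flip2 σ τ p := fun p => by simp [L, flip2]
  have hLn : ‖L‖ ≤ 1 := by
    apply ContinuousLinearMap.opNorm_le_bound _ zero_le_one
    intro p
    rw [hL, norm_flip2 hσ hτ, one_mul]
  refine ⟨h1, fun p => h2 _, fun p hp => ?_, fun p hp => ?_⟩
  · have hp' : flip2 σ τ p ≠ 0 := by
      rw [← norm_pos_iff, norm_flip2 hσ hτ, norm_pos_iff]; exact hp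
    obtain ⟨Ψ', hd, hb⟩ := h3 _ hp'
    rw [norm_flip2 hσ hτ] at hb
    have hLd : HasFDerivAt (flip2 σ τ) L p := by
      have := L.hasFDerivAt (x := p)
      rwa [show (L : ℝ × ℝ → ℝ × ℝ) = flip2 σ τ from funext hL] at this
    refine ⟨Ψ'.comp L, hd.comp p hLd, le_trans ?_ hb⟩
    gcongr
    calc ‖Ψ'.comp L‖ ≤ ‖Ψ'‖ * ‖L‖ := Ψ'.opNorm_comp_le L
      _ ≤ ‖Ψ'‖ * 1 := by gcongr
      _ = _ := mul_one _
  · exact h4 _ (by rwa [norm_flip2 hσ hτ])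

theorem Good.flip {g : ℝ × ℝ → ℝ} {r σ τ : ℝ} (hσ : σ = 1 ∨ σ = -1) (hτ : τ = 1 ∨ τ = -1)
    {D : Set (ℝ × ℝ)} (h : Good (fun p => g (flip2 σ τ p)) r D) : Good g r (flip2 σ τ ⁻¹' D) := by
  obtain ⟨C, hC, H⟩ := h
  refine ⟨C, hC, fun M Ψ hΨ s => ?_⟩
  rw [setInt_flip hσ hτ, setInt_flip hσ hτ]
  have h1 := H M _ (hΨ.flip hσ hτ) (σ * s)
  convert h1 using 2
  · congr 1
    ext p
    simp only [oscI, flip2]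
    congr 5
    ring
  · congr 1
    ext p
    simp only [wtI, flip2]
    congr 4
    ring

def HasEdge (κ : ℝ) (S : Set (ℝ × ℝ)) : Prop := ∃ M, 0 < M ∧ ∃ bs, EdgeData κ S M bs

theorem HasEdge.mono {κ : ℝ} {S S' : Set (ℝ × ℝ)} (h : HasEdge κ S') (hS : S ⊆ S') : HasEdge κ S := by
  obtain ⟨M, hM, bs, h1, t₀, ht, h2⟩ := h
  exact ⟨M, hM, bs, h1, t₀, ht, fun t b a1 a2 a3 a4 => h2 t b a1 a2 a3 (hS a4)⟩

theorem HasEdge.far {κ : ℝ} (hκ : 0 < κ) {S : Set (ℝ × ℝ)} {r : ℝ} (hr : 0 < r)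
    (h : ∀ p ∈ S, r ≤ ‖p‖) : HasEdge κ S := by
  refine ⟨1, one_pos, [], by simp, r / (1 + κ), by positivity, ?_⟩
  intro t b h1 h2 h3 h4
  exfalso
  rw [pow_one] at h3 h4
  have := h _ h4
  rw [lt_div_iff₀ (by positivity)] at h2
  rw [Prod.norm_def, le_max_iff, Real.norm_eq_abs, Real.norm_eq_abs, abs_of_pos h1] at this
  simp only at this
  rcases this with h | h <;> nlinarith

theorem HasEdge.union {κ : ℝ} {S S' : Set (ℝ × ℝ)} (h : HasEdge κ S) (h' : HasEdge κ S') :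
    HasEdge κ (S ∪ S') := by
  obtain ⟨M, hM, bs, hb⟩ := h
  obtain ⟨M', hM', bs', hb'⟩ := h'
  obtain ⟨a1, t₁, ht₁, a2⟩ := hb.ramify M' hM'
  obtain ⟨b1, t₂, ht₂, b2⟩ := hb'.ramify M hM
  refine ⟨M * M', Nat.mul_pos hM hM', (bs.map fun β t => β (t ^ M')) ++ (bs'.map fun β t => β (t ^ M)), ?_,
    min t₁ t₂, lt_min ht₁ ht₂, ?_⟩
  · intro β hβ
    rcases List.mem_append.1 hβ with h | h
    · exact a1 β h
    · exact b1 β h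
  · intro t b h1 h2 h3 h4
    rcases h4 with h4 | h4
    · obtain ⟨β, hβ, e⟩ := a2 t b h1 (h2.trans_le (min_le_left _ _)) h3 h4
      exact ⟨β, List.mem_append.2 (Or.inl hβ), e⟩
    · obtain ⟨β, hβ, e⟩ := b2 t b h1 (h2.trans_le (min_le_right _ _)) (by rwa [mul_comm M' M])
        (by rwa [mul_comm M' M])
      exact ⟨β, List.mem_append.2 (Or.inr hβ), e⟩

theorem HasEdge.biUnion {κ : ℝ} (hκ : 0 < κ) {ι : Type*} [DecidableEq ι] (s : Finset ι) (S : ι → Set (ℝ × ℝ))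
    (h : ∀ i, HasEdge κ (S i)) : HasEdge κ (⋃ i ∈ s, S i) := by
  induction s using Finset.induction_on with
  | empty => exact HasEdge.far hκ one_pos (by simp)
  | insert a s ha ih =>
    rw [Finset.set_biUnion_insert]
    exact (h a).union ih

theorem HasEdge.curve {κ : ℝ} (hκ : 0 < κ) (a b : ℝ → ℝ) (ha : AnalyticAt ℝ a 0) (hb : AnalyticAt ℝ b 0)
    (ha0 : a 0 = 0) (S : Set (ℝ × ℝ))
    (hS : ∀ η > 0, ∃ r > 0, ∀ p ∈ S, ‖p‖ < r → ∃ t, 0 ≤ t ∧ t < η ∧ p = (a t, b t)) : HasEdge κ S := by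
  -- reduce: no points with positive first coordinate
  have hneg : (∀ᶠ t in 𝓝[>] (0:ℝ), a t ≤ 0) → HasEdge κ S := by
    intro h
    obtain ⟨η, hη, H⟩ := ev_Ioo h
    obtain ⟨r, hr, hr2⟩ := hS η hη
    refine ⟨1, one_pos, [], by simp, r / (1 + κ), by positivity, ?_⟩
    intro t b' h1 h2 h3 h4
    exfalso
    rw [pow_one] at h3 h4
    rw [lt_div_iff₀ (by positivity)] at h2
    obtain ⟨s, hs0, hs1, hs2⟩ := hr2 _ h4 (by
      rw [Prod.norm_def, max_lt_iff, Real.norm_eq_abs, Real.norm_eq_abs, abs_of_pos h1]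
      constructor <;> nlinarith)
    have e1 : t = a s := congrArg Prod.fst hs2
    rcases hs0.eq_or_lt with h | h
    · rw [← h, ha0] at e1; linarith
    · linarith [H s h hs1]
  rcases an_sgn a ha with h | h | h
  · exact hneg (h.mono fun _ h => h.le)
  · exact hneg (h.mono fun _ h => h.le)
  have hnz : ¬ ∀ᶠ t in 𝓝 (0:ℝ), a t = 0 := by
    intro h'
    obtain ⟨t, h1, h2⟩ := (h.and (nhdsWithin_le_nhds h')).exists
    linarith
  obtain ⟨M, w, hw, hw0, hwa⟩ := ha.exists_eventuallyEq_pow_smul_nonzero_iff.2 hnz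
  simp only [sub_zero, smul_eq_mul] at hwa
  have hM : 0 < M := by
    apply Nat.pos_of_ne_zero
    rintro rfl
    have := hwa.self_of_nhds
    rw [ha0] at this
    simp at this
    exact hw0 this.symm
  have hwpos : 0 < w 0 := by
    by_contra hneg'
    have hlt : w 0 < 0 := lt_of_le_of_ne (not_lt.1 hneg') hw0
    have e : ∀ᶠ t in 𝓝 (0:ℝ), w t < 0 := hw.continuousAt.eventually_lt continuousAt_const hlt
    obtain ⟨t, ⟨h1, h2, h3⟩, h4⟩ := ((h.and ((hwa.and e).filter_mono nhdsWithin_le_nhds)).and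
      self_mem_nhdsWithin).exists
    have h4 : 0 < t := h4
    rw [h2] at h1
    have : 0 < t ^ M := by positivity
    nlinarith
  set z : ℝ → ℝ := fun t => t * rexp ((M:ℝ)⁻¹ * Real.log (w t)) with hz
  have hlogw : AnalyticAt ℝ (fun t => Real.log (w t)) 0 :=
    AnalyticAt.fun_comp (g := Real.log) (f := w) (analyticAt_log hwpos) hw
  have hexpw : AnalyticAt ℝ (fun t => rexp ((M:ℝ)⁻¹ * Real.log (w t))) 0 :=
    AnalyticAt.fun_comp (g := rexp) (f := fun t => (M:ℝ)⁻¹ * Real.log (w t)) analyticAt_rexp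
      (analyticAt_const.mul hlogw)
  have hza : AnalyticAt ℝ z 0 := analyticAt_id.mul hexpw
  have hz0 : z 0 = 0 := by simp [hz]
  have hdz : deriv z 0 ≠ 0 := by
    have h1 := (hasDerivAt_id (0:ℝ)).mul hexpw.differentiableAt.hasDerivAt
    have h2 : deriv z 0 = _ := h1.deriv
    rw [h2]
    simp [Real.exp_ne_zero]
  have hzM : ∀ᶠ t in 𝓝 (0:ℝ), a t = z t ^ M := by
    have e : ∀ᶠ t in 𝓝 (0:ℝ), 0 < w t := continuousAt_const.eventually_lt hw.continuousAt hwpos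
    filter_upwards [hwa, e] with t h1 h2
    rw [h1, hz]
    simp only
    rw [mul_pow, ← Real.exp_nat_mul, ← mul_assoc, mul_inv_cancel₀ (by positivity), one_mul, Real.exp_log h2]
  set τ := hza.hasStrictDerivAt.localInverse _ _ _ hdz with hτ
  have hτa : AnalyticAt ℝ τ 0 := by
    have := hza.analyticAt_localInverse hdz
    rwa [hz0] at this
  have hτ0 : τ 0 = 0 := by
    have : τ (z 0) = 0 := HasStrictFDerivAt.localInverse_apply_image ..
    rwa [hz0] at this
  have hτz : ∀ᶠ t in 𝓝 (0:ℝ), τ (z t) = t := HasStrictFDerivAt.eventually_left_inverse ..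
  obtain ⟨η, hη, H⟩ := Metric.eventually_nhds_iff.1 (hzM.and hτz)
  obtain ⟨r, hr, hr2⟩ := hS η hη
  refine ⟨M, hM, [fun s => b (τ s)], ?_, min 1 (r / (1 + κ)), by positivity, ?_⟩
  · intro β hβ
    rw [List.mem_singleton] at hβ
    rw [hβ]
    exact AnalyticAt.fun_comp (g := b) (f := τ) (by rwa [hτ0]) hτa
  · intro s b' h1 h2 h3 h4
    have hs1 : s < 1 := h2.trans_le (min_le_left _ _)
    have h2' := h2.trans_le (min_le_right _ _)
    rw [lt_div_iff₀ (by positivity)] at h2'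
    have hsM : s ^ M ≤ s := by simpa using pow_le_pow_of_le_one h1.le hs1.le hM
    have hsp : 0 < s ^ M := by positivity
    obtain ⟨t, ht0, ht1, ht2⟩ := hr2 _ h4 (by
      rw [Prod.norm_def, max_lt_iff, Real.norm_eq_abs, Real.norm_eq_abs, abs_of_pos hsp]
      constructor <;> nlinarith)
    have e1 : s ^ M = a t := congrArg Prod.fst ht2
    have e2 : b' = b t := congrArg Prod.snd ht2
    obtain ⟨k1, k2⟩ := H (y := t) (by rw [dist_zero_right, Real.norm_eq_abs, abs_of_nonneg ht0]; exact ht1)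
    have hzt : 0 ≤ z t := mul_nonneg ht0 (Real.exp_pos _).le
    have : s = z t := (pow_left_inj₀ h1.le hzt hM.ne').1 (e1.trans k1)
    exact ⟨_, List.mem_singleton_self _, by rw [this, k2, e2]⟩

def Rv (v q : ℝ × ℝ) : ℝ × ℝ := (q.1 * v.1 + q.2 * v.2, q.1 * v.2 - q.2 * v.1)

theorem unit_sq {v : ℝ × ℝ} (hv : nrm2 v = 1) : v.1 ^ 2 + v.2 ^ 2 = 1 := by
  unfold nrm2 at hv
  rwa [Real.sqrt_eq_one] at hv

theorem Rv_Rv {v : ℝ × ℝ} (hv : nrm2 v = 1) (q : ℝ × ℝ) : Rv v (Rv v q) = q := by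
  have h := unit_sq hv
  unfold Rv
  ext
  · simp only; linear_combination q.1 * h
  · simp only; linear_combination q.2 * h

theorem Rv_cont (v : ℝ × ℝ) : Continuous (Rv v) := by unfold Rv; fun_prop

theorem Rv_sq {v : ℝ × ℝ} (hv : nrm2 v = 1) (q : ℝ × ℝ) :
    (Rv v q).1 ^ 2 + (Rv v q).2 ^ 2 = q.1 ^ 2 + q.2 ^ 2 := by
  have h := unit_sq hv
  unfold Rv
  simp only; linear_combination (q.1 ^ 2 + q.2 ^ 2) * h

theorem unit_abs {v : ℝ × ℝ} (hv : nrm2 v = 1) : |v.1| ≤ 1 ∧ |v.2| ≤ 1 := by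
  have h := unit_sq hv
  constructor <;> rw [abs_le] <;> constructor <;> nlinarith [sq_nonneg v.1, sq_nonneg v.2]

theorem Rv_norm {v : ℝ × ℝ} (hv : nrm2 v = 1) (q : ℝ × ℝ) : ‖Rv v q‖ ≤ 2 * ‖q‖ := by
  obtain ⟨h1, h2⟩ := unit_abs hv
  have a1 : |q.1| ≤ ‖q‖ := norm_fst_le q
  have a2 : |q.2| ≤ ‖q‖ := norm_snd_le q
  have m : ∀ x y : ℝ, |x| ≤ ‖q‖ → |y| ≤ 1 → |x * y| ≤ ‖q‖ := by
    intro x y hx hy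
    rw [abs_mul]
    calc |x| * |y| ≤ ‖q‖ * 1 := by gcongr
      _ = _ := mul_one _
  rw [Prod.norm_def]
  apply max_le
  · exact (abs_add_le _ _).trans (by linarith [m _ _ a1 h1, m _ _ a2 h2])
  · exact (abs_sub _ _).trans (by linarith [m _ _ a1 h2, m _ _ a2 h1])

def Ph (v : ℝ × ℝ) (σ τ : ℝ) (q : ℝ × ℝ) : ℝ × ℝ := Rv v (flip2 σ τ q)

def PhH {v : ℝ × ℝ} (hv : nrm2 v = 1) {σ τ : ℝ} (hσ : σ = 1 ∨ σ = -1) (hτ : τ = 1 ∨ τ = -1) :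
    (ℝ × ℝ) ≃ₜ (ℝ × ℝ) where
  toFun := Ph v σ τ
  invFun := fun p => flip2 σ τ (Rv v p)
  left_inv := fun q => by simp only [Ph]; rw [Rv_Rv hv, flip2_flip2 hσ hτ]
  right_inv := fun p => by simp only [Ph]; rw [flip2_flip2 hσ hτ, Rv_Rv hv]
  continuous_toFun := (Rv_cont v).comp (flip2_cont σ τ)
  continuous_invFun := (flip2_cont σ τ).comp (Rv_cont v)

theorem Ph_norm {v : ℝ × ℝ} (hv : nrm2 v = 1) {σ τ : ℝ} (hσ : σ = 1 ∨ σ = -1) (hτ : τ = 1 ∨ τ = -1)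
    (q : ℝ × ℝ) : ‖Ph v σ τ q‖ ≤ 2 * ‖q‖ := by
  unfold Ph
  exact (Rv_norm hv _).trans (by rw [norm_flip2 hσ hτ])

theorem frontier_Ph {v : ℝ × ℝ} (hv : nrm2 v = 1) {σ τ : ℝ} (hσ : σ = 1 ∨ σ = -1) (hτ : τ = 1 ∨ τ = -1)
    (E : Set (ℝ × ℝ)) : frontier (Ph v σ τ ⁻¹' E) = Ph v σ τ ⁻¹' frontier E :=
  ((PhH hv hσ hτ).preimage_frontier E).symm

theorem edge_param {κ : ℝ} (hκ : 0 < κ) {v : ℝ × ℝ} (hv : nrm2 v = 1) {σ τ : ℝ} (hσ : σ = 1 ∨ σ = -1)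
    (hτ : τ = 1 ∨ τ = -1) (x y : ℝ → ℝ) (hx : AnalyticAt ℝ x 0) (hy : AnalyticAt ℝ y 0)
    (hx0 : x 0 = 0) (hy0 : y 0 = 0) (S : Set (ℝ × ℝ))
    (hS : ∀ η > 0, ∃ r > 0, ∀ p ∈ S, ‖p‖ < r → ∃ t, 0 ≤ t ∧ t < η ∧ p = (x t, y t)) :
    HasEdge κ (Ph v σ τ ⁻¹' S) := by
  refine HasEdge.curve hκ (fun t => σ * (x t * v.1 + y t * v.2)) (fun t => τ * (x t * v.2 - y t * v.1))
    (by fun_prop) (by fun_prop) (by simp [hx0, hy0]) _ ?_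
  intro η hη
  obtain ⟨r, hr, H⟩ := hS η hη
  refine ⟨r / 2, by positivity, fun q hq hqr => ?_⟩
  obtain ⟨t, h1, h2, h3⟩ := H _ hq ((Ph_norm hv hσ hτ q).trans_lt (by linarith))
  refine ⟨t, h1, h2, ?_⟩
  have : q = flip2 σ τ (Rv v (Ph v σ τ q)) := ((PhH hv hσ hτ).left_inv q).symm
  rw [this, h3]
  rfl

theorem edge_curve {κ : ℝ} (hκ : 0 < κ) {v : ℝ × ℝ} (hv : nrm2 v = 1) {σ τ : ℝ} (hσ : σ = 1 ∨ σ = -1)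
    (hτ : τ = 1 ∨ τ = -1) (r₀ : ℝ) (hr₀ : 0 < r₀) (S : Set (ℝ × ℝ)) (hS : IsPuiseuxBdryCurve r₀ S) :
    HasEdge κ (Ph v σ τ ⁻¹' S) := by
  obtain ⟨N, h, I, ς, hN, hς, hI, hIcc, hh, hh0, hC, -⟩ := hS
  have hha : AnalyticAt ℝ h 0 := hh 0 (hIcc ⟨le_rfl, by positivity⟩)
  have hp : AnalyticAt ℝ (fun t : ℝ => ς * t ^ N) 0 := by fun_prop
  have hp0 : ς * (0:ℝ) ^ N = 0 := by simp [hN.ne']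
  have key : ∀ x : ℝ, 0 ≤ ς * x → x = ς * (|x| ^ ((N:ℝ)⁻¹)) ^ N := by
    intro x hx
    rw [← Real.rpow_natCast, ← Real.rpow_mul (abs_nonneg x), inv_mul_cancel₀ (by positivity), Real.rpow_one]
    rcases hς with rfl | rfl
    · rw [abs_of_nonneg (by linarith)]; ring
    · rw [abs_of_nonpos (by linarith)]; ring
  have key2 : ∀ η > (0:ℝ), ∀ x : ℝ, |x| < η ^ N → |x| ^ ((N:ℝ)⁻¹) < η := by
    intro η hη x hx
    have := Real.rpow_lt_rpow (abs_nonneg x) hx (show 0 < (N:ℝ)⁻¹ by positivity)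
    rwa [← Real.rpow_natCast, ← Real.rpow_mul hη.le, mul_inv_cancel₀ (by positivity), Real.rpow_one] at this
  rcases hC with rfl | rfl
  · refine edge_param hκ hv hσ hτ (fun t => ς * t ^ N) h hp hha hp0 hh0 _ ?_
    intro η hη
    refine ⟨η ^ N, by positivity, ?_⟩
    rintro p ⟨-, h1, h2⟩ hpr
    refine ⟨|p.1| ^ ((N:ℝ)⁻¹), by positivity, key2 η hη _ ((norm_fst_le p).trans_lt hpr), ?_⟩
    exact Prod.ext (key _ h1) h2
  · refine edge_param hκ hv hσ hτ h (fun t => ς * t ^ N) hha hp hh0 hp0 _ ?_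
    intro η hη
    refine ⟨η ^ N, by positivity, ?_⟩
    rintro p ⟨-, h1, h2⟩ hpr
    refine ⟨|p.2| ^ ((N:ℝ)⁻¹), by positivity, key2 η hη _ ((norm_snd_le p).trans_lt hpr), ?_⟩
    exact Prod.ext h2 (key _ h1)

theorem edge_circle {κ : ℝ} (hκ : 0 < κ) {v : ℝ × ℝ} (hv : nrm2 v = 1) {σ τ : ℝ} (hσ : σ = 1 ∨ σ = -1)
    (hτ : τ = 1 ∨ τ = -1) (r₀ : ℝ) (hr₀ : 0 < r₀) : HasEdge κ (Ph v σ τ ⁻¹' circle2 r₀) := by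
  refine HasEdge.far hκ (r := r₀ / 4) (by positivity) ?_
  intro q hq
  have h1 : (Ph v σ τ q).1 ^ 2 + (Ph v σ τ q).2 ^ 2 = r₀ ^ 2 := hq
  have h2 := Ph_norm hv hσ hτ q
  have a1 : |(Ph v σ τ q).1| ≤ ‖Ph v σ τ q‖ := norm_fst_le (Ph v σ τ q)
  have a2 : |(Ph v σ τ q).2| ≤ ‖Ph v σ τ q‖ := norm_snd_le (Ph v σ τ q)
  by_contra! h
  have b1 : |(Ph v σ τ q).1| ≤ r₀ / 2 := by linarith
  have b2 : |(Ph v σ τ q).2| ≤ r₀ / 2 := by linarith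
  have := sq_le_sq' (by linarith [neg_abs_le (Ph v σ τ q).1, (abs_le.1 b1).1]) (abs_le.1 b1).2
  have := sq_le_sq' (by linarith [neg_abs_le (Ph v σ τ q).2, (abs_le.1 b2).1]) (abs_le.1 b2).2
  nlinarith

theorem edge_dom {κ : ℝ} (hκ : 0 < κ) {v : ℝ × ℝ} (hv : nrm2 v = 1) {σ τ : ℝ} (hσ : σ = 1 ∨ σ = -1)
    (hτ : τ = 1 ∨ τ = -1) (E : Set (ℝ × ℝ)) (hE : IsStdDomain E) :
    HasEdge κ (frontier (Ph v σ τ ⁻¹' E)) := by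
  rw [frontier_Ph hv hσ hτ]
  rcases hE with ⟨r₀, hr₀, rfl⟩ | ⟨r₀, hr₀, m, Es, Cs, rfl, -, h1, h2, -⟩
  · refine (edge_circle hκ hv hσ hτ r₀ hr₀).mono (preimage_mono ?_)
    exact frontier_lt_subset_eq (by fun_prop) (by fun_prop)
  · have hfr : frontier (⋃ i, Es i) ⊆ ⋃ i ∈ (Finset.univ : Finset (Fin m)),
        (Cs i 0 ∪ Cs i 1 ∪ circle2 r₀) := by
      rintro x ⟨hx1, hx2⟩
      rw [closure_iUnion_of_finite] at hx1
      obtain ⟨i, hi⟩ := mem_iUnion.1 hx1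
      have : x ∈ frontier (Es i) := ⟨hi, fun h => hx2 (interior_mono (subset_iUnion Es i) h)⟩
      simp only [mem_iUnion]
      exact ⟨i, Finset.mem_univ _, (h1 i).2.2.2 this⟩
    refine HasEdge.mono ?_ (preimage_mono hfr)
    simp only [preimage_iUnion]
    apply HasEdge.biUnion hκ
    intro i
    rw [preimage_union, preimage_union]
    exact ((edge_curve hκ hv hσ hτ r₀ hr₀ _ (h2 i 0)).union (edge_curve hκ hv hσ hτ r₀ hr₀ _ (h2 i 1))).union
      (edge_circle hκ hv hσ hτ r₀ hr₀)

def RvL (v : ℝ × ℝ) : ℝ × ℝ →ₗ[ℝ] ℝ × ℝ where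
  toFun := Rv v
  map_add' := fun p q => by ext <;> simp [Rv] <;> ring
  map_smul' := fun c q => by ext <;> simp [Rv] <;> ring

theorem mp_Rv {v : ℝ × ℝ} (hv : nrm2 v = 1) : MeasurePreserving (Rv v) volume volume := by
  have h1 : (RvL v).comp (RvL v) = LinearMap.id := by
    ext q <;> simp [RvL, Rv_Rv hv]
  have h2 : LinearMap.det (RvL v) * LinearMap.det (RvL v) = 1 := by
    rw [← LinearMap.det_comp, h1, LinearMap.det_id]
  have h3 : LinearMap.det (RvL v) ≠ 0 := by
    intro h; rw [h] at h2; norm_num at h2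
  refine ⟨(Rv_cont v).measurable, ?_⟩
  have h4 := Measure.map_linearMap_addHaar_eq_smul_addHaar (μ := (volume : Measure (ℝ × ℝ))) h3
  have h5 : |(LinearMap.det (RvL v))⁻¹| = 1 := by
    rw [abs_inv]
    have : |LinearMap.det (RvL v)| * |LinearMap.det (RvL v)| = 1 := by rw [← abs_mul, h2]; simp
    have : |LinearMap.det (RvL v)| = 1 := by nlinarith [abs_nonneg (LinearMap.det (RvL v))]
    rw [this]; simp
  rw [h5, ENNReal.ofReal_one, one_smul] at h4
  exact h4

theorem emb_Rv {v : ℝ × ℝ} (hv : nrm2 v = 1) : MeasurableEmbedding (Rv v) :=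
  (⟨⟨Rv v, Rv v, Rv_Rv hv, Rv_Rv hv⟩, Rv_cont v, Rv_cont v⟩ : (ℝ × ℝ) ≃ₜ (ℝ × ℝ)).measurableEmbedding

theorem setInt_Rv {V : Type*} [NormedAddCommGroup V] [NormedSpace ℝ V] {v : ℝ × ℝ} (hv : nrm2 v = 1)
    (D : Set (ℝ × ℝ)) (h : ℝ × ℝ → V) : ∫ p in Rv v ⁻¹' D, h (Rv v p) = ∫ p in D, h p :=
  (mp_Rv hv).setIntegral_preimage_emb (emb_Rv hv) h D

theorem coneII_mono {κ κ' r r' : ℝ} (hκ : κ ≤ κ') (hr : r ≤ r') : coneII κ r ⊆ coneII κ' r' := by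
  rintro p ⟨h1, h2, h3⟩
  exact ⟨h1, h2.trans_le hr, h3.trans_le (by gcongr)⟩

theorem ConeBd.mono {F : ℝ × ℝ → ℝ} {k : ℕ} {c C κ κ' r r' : ℝ} (h : ConeBd F k c C κ' r')
    (hκ : κ ≤ κ') (hr : r ≤ r') : ConeBd F k c C κ r := fun p hp => h p (coneII_mono hκ hr hp)

def PhL (v : ℝ × ℝ) (σ τ : ℝ) : ℝ × ℝ →ₗ[ℝ] ℝ × ℝ where
  toFun := Ph v σ τ
  map_add' := fun p q => by ext <;> simp [Ph, Rv, flip2] <;> ring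
  map_smul' := fun c q => by ext <;> simp [Ph, Rv, flip2] <;> ring

theorem Ph_fderiv {v : ℝ × ℝ} (hv : nrm2 v = 1) {σ τ : ℝ} (hσ : σ = 1 ∨ σ = -1) (hτ : τ = 1 ∨ τ = -1) :
    ∃ L : ℝ × ℝ →L[ℝ] ℝ × ℝ, ‖L‖ ≤ 2 ∧ (∀ q, L q = Ph v σ τ q) ∧ ∀ p, HasFDerivAt (Ph v σ τ) L p := by
  refine ⟨(PhL v σ τ).mkContinuous 2 (Ph_norm hv hσ hτ), LinearMap.mkContinuous_norm_le _ (by norm_num) _,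
    fun q => rfl, fun p => ?_⟩
  exact ((PhL v σ τ).mkContinuous 2 (Ph_norm hv hσ hτ)).hasFDerivAt

theorem Ph_polar {v : ℝ × ℝ} {σ τ : ℝ} (p : ℝ × ℝ) (hp : 0 < p.2) :
    Ph v σ τ p = p.2 • Ph v σ τ (p.1 / p.2, 1) := by
  ext <;> simp [Ph, Rv, flip2] <;> field_simp

theorem Ph_near {v : ℝ × ℝ} (hv : nrm2 v = 1) {σ τ : ℝ} (hσ : σ = 1 ∨ σ = -1) (x : ℝ) :
    ‖Ph v σ τ (x, 1) - τ • perp2 v‖ ≤ |x| := by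
  obtain ⟨h1, h2⟩ := unit_abs hv
  have e : Ph v σ τ (x, 1) - τ • perp2 v = (σ * x) • v := by
    ext <;> simp [Ph, Rv, flip2, perp2]
  rw [e, norm_smul, Prod.norm_def]
  have : ‖σ * x‖ = |x| := by rcases hσ with rfl | rfl <;> simp
  rw [this]
  calc |x| * max ‖v.1‖ ‖v.2‖ ≤ |x| * 1 := by gcongr; exact max_le h1 h2
    _ = _ := mul_one _

theorem lowestPart_sign (f : ℝ × ℝ → ℝ) (W : ℝ × ℝ) {τ : ℝ} (hτ : τ = 1 ∨ τ = -1)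
    (h : lowestPart f W ≠ 0) : lowestPart f (τ • W) ≠ 0 := by
  unfold lowestPart at *
  have := (iteratedFDeriv ℝ (vanishingOrder f) f 0).map_smul_univ (fun _ => τ) (fun _ => W)
  rw [this]
  refine smul_ne_zero ?_ h
  rw [Finset.prod_ne_zero_iff]
  intro i _
  rcases hτ with rfl | rfl <;> norm_num

theorem coneBd_one {v : ℝ × ℝ} (hv : nrm2 v = 1) {σ τ : ℝ} (hσ : σ = 1 ∨ σ = -1) (hτ : τ = 1 ∨ τ = -1)
    (f : ℝ × ℝ → ℝ) (hf : AnalyticAt ℝ f 0) (hW : lowestPart f (perp2 v) ≠ 0) :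
    ∃ (k : ℕ) (c C ρ : ℝ), 0 < c ∧ 0 < ρ ∧ ConeBd (fun p => f (Ph v σ τ p)) k c C ρ ρ := by
  obtain ⟨k, c, C, κ, r, hc, hκ, hr, H⟩ := lowBd f hf _ (lowestPart_sign f _ hτ hW)
  obtain ⟨L, hL, -, hL'⟩ := Ph_fderiv hv hσ hτ
  refine ⟨k, c, 2 * C, min κ r, hc, lt_min hκ hr, ?_⟩
  rintro p ⟨h1, h2, h3⟩
  have hx : |p.1 / p.2| < κ := by
    rw [abs_div, abs_of_pos h1, div_lt_iff₀ h1]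
    exact h3.trans_le (by gcongr; exact min_le_left _ _)
  have := H p.2 (Ph v σ τ (p.1 / p.2, 1)) h1 (h2.trans_le (min_le_right _ _))
    ((Ph_near hv hσ _).trans_lt hx)
  rw [← Ph_polar p h1] at this
  obtain ⟨b1, b2, b3, b4⟩ := this
  have hC : 0 ≤ C * p.2 ^ k := (abs_nonneg _).trans b2
  refine ⟨b1, by linarith, (fderiv ℝ f (Ph v σ τ p)).comp L, b3.hasFDerivAt.comp p (hL' p), ?_⟩
  calc p.2 * ‖(fderiv ℝ f (Ph v σ τ p)).comp L‖ ≤ p.2 * (‖fderiv ℝ f (Ph v σ τ p)‖ * ‖L‖) := by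
        gcongr; exact ContinuousLinearMap.opNorm_comp_le _ _
    _ ≤ p.2 * (‖fderiv ℝ f (Ph v σ τ p)‖ * 2) := by gcongr
    _ = 2 * (p.2 * ‖fderiv ℝ f (Ph v σ τ p)‖) := by ring
    _ ≤ 2 * (C * p.2 ^ k) := by gcongr
    _ = _ := by ring

theorem nrm2_cont : Continuous nrm2 := by unfold nrm2; fun_prop

theorem nrm2_smul (b : ℝ) (hb : 0 < b) (w : ℝ × ℝ) : nrm2 (b • w) = b * nrm2 w := by
  unfold nrm2
  have : (b • w).1 ^ 2 + (b • w).2 ^ 2 = b ^ 2 * (w.1 ^ 2 + w.2 ^ 2) := by simp; ring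
  rw [this, Real.sqrt_mul (by positivity), Real.sqrt_sq hb.le]

theorem noFrontier {v : ℝ × ℝ} (hv : nrm2 v = 1) {σ τ : ℝ} (hσ : σ = 1 ∨ σ = -1) (hτ : τ = 1 ∨ τ = -1)
    (S : Set (ℝ × ℝ)) (hS : ¬ IsTangentDirAt S (perp2 v)) :
    ∃ ρ > (0:ℝ), ∀ p ∈ coneII ρ ρ, Ph v σ τ p ∉ S := by
  by_contra! hcon
  choose p hp hpS using fun n : ℕ => hcon (1 / ((n:ℝ) + 1)) (by positivity)
  have h1 : ∀ n, 0 < (p n).2 := fun n => (hp n).1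
  have hlim := tendsto_one_div_add_atTop_nhds_zero_nat (𝕜 := ℝ)
  have hx : ∀ n, |(p n).1 / (p n).2| ≤ 1 / ((n:ℝ) + 1) := by
    intro n
    rw [abs_div, abs_of_pos (h1 n), div_le_iff₀ (h1 n)]
    exact (hp n).2.2.le
  have hw : Tendsto (fun n => Ph v σ τ ((p n).1 / (p n).2, 1)) atTop (𝓝 (τ • perp2 v)) := by
    rw [tendsto_iff_norm_sub_tendsto_zero]
    exact squeeze_zero (fun n => norm_nonneg _) (fun n => (Ph_near hv hσ _).trans (hx n)) hlim
  have hn1 : nrm2 (τ • perp2 v) = 1 := by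
    have h := unit_sq hv
    have : (τ • perp2 v).1 ^ 2 + (τ • perp2 v).2 ^ 2 = 1 := by
      rcases hτ with rfl | rfl <;> simp [perp2] <;> linarith
    unfold nrm2; rw [this, Real.sqrt_one]
  have hnw : Tendsto (fun n => (nrm2 (Ph v σ τ ((p n).1 / (p n).2, 1)))⁻¹) atTop (𝓝 1) := by
    have := ((nrm2_cont.tendsto _).comp hw).inv₀ (by rw [hn1]; norm_num)
    rw [hn1, inv_one] at this
    exact this
  have hq : Tendsto (fun n => (nrm2 (Ph v σ τ (p n)))⁻¹ • Ph v σ τ (p n)) atTop (𝓝 (τ • perp2 v)) := by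
    have := hnw.smul hw
    rw [one_smul] at this
    refine this.congr fun n => ?_
    rw [Ph_polar (p n) (h1 n), nrm2_smul _ (h1 n), smul_smul]
    congr 1
    have := (h1 n).ne'
    by_cases h0 : nrm2 (Ph v σ τ ((p n).1 / (p n).2, 1)) = 0
    · simp [h0]
    · field_simp
  apply hS
  refine ⟨fun n => Ph v σ τ (p n), fun n => ⟨hpS n, fun h => ?_⟩, ?_, ?_⟩
  · have : p n = 0 := by
      apply (PhH hv hσ hτ).injective
      show Ph v σ τ (p n) = Ph v σ τ 0
      have h' : Ph v σ τ (p n) = 0 := h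
      rw [h']; ext <;> simp [Ph, Rv, flip2]
    have := h1 n
    simp_all
  · rw [tendsto_zero_iff_norm_tendsto_zero]
    have l2 := hlim.const_mul 2
    rw [mul_zero] at l2
    refine squeeze_zero (fun n => norm_nonneg _) (fun n => (Ph_norm hv hσ hτ _).trans ?_) l2
    obtain ⟨a1, a2, a3⟩ := hp n
    have e : (1:ℝ) / ((n:ℝ) + 1) ≤ 1 := by
      rw [div_le_one (by positivity)]; linarith [(Nat.cast_nonneg n : (0:ℝ) ≤ n)]
    gcongr
    rw [Prod.norm_def]
    apply max_le
    · show |(p n).1| ≤ _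
      nlinarith
    · show |(p n).2| ≤ _
      rw [abs_of_pos a1]; exact a2.le
  · rcases hτ with rfl | rfl
    · left; simpa using hq
    · right; simpa using hq

theorem exists_pos_le_fin {n : ℕ} (ρ : Fin n → ℝ) (h : ∀ i, 0 < ρ i) : ∃ r > (0:ℝ), ∀ i, r ≤ ρ i := by
  have h1 : ∀ᶠ r in 𝓝[>] (0:ℝ), ∀ i, r ≤ ρ i := by
    rw [eventually_all]
    intro i
    exact ((eventually_lt_nhds (h i)).filter_mono nhdsWithin_le_nhds).mono fun _ h => h.le
  obtain ⟨r, h1, h2⟩ := (h1.and self_mem_nhdsWithin).exists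
  exact ⟨r, h2, h1⟩

/-- uniform cone data in the frame `(σ, τ)`. -/
def Frame {n : ℕ} (f : Fin n → ℝ × ℝ → ℝ) (E : Set (ℝ × ℝ)) (v : ℝ × ℝ) (σ τ κ ρ : ℝ) : Prop :=
  ∃ (k : Fin n → ℕ) (c C : Fin n → ℝ), (∀ i, 0 < c i) ∧
    (∀ i, ConeBd (fun p => f i (Ph v σ τ p)) (k i) (c i) (C i) κ ρ) ∧
    ∀ p ∈ coneII κ ρ, p ∉ frontier (Ph v σ τ ⁻¹' E)

theorem Frame.mono {n : ℕ} {f : Fin n → ℝ × ℝ → ℝ} {E : Set (ℝ × ℝ)} {v : ℝ × ℝ} {σ τ κ ρ κ' ρ' : ℝ}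
    (h : Frame f E v σ τ κ ρ) (hκ : κ' ≤ κ) (hρ : ρ' ≤ ρ) : Frame f E v σ τ κ' ρ' := by
  obtain ⟨k, c, C, h1, h2, h3⟩ := h
  exact ⟨k, c, C, h1, fun i => (h2 i).mono hκ hρ, fun p hp => h3 p (coneII_mono hκ hρ hp)⟩

theorem frame_one {n : ℕ} (f : Fin n → ℝ × ℝ → ℝ) (E : Set (ℝ × ℝ)) (hf : ∀ i, AnalyticAt ℝ (f i) 0)
    {v : ℝ × ℝ} (hv : nrm2 v = 1) (hperp : ¬ ExceptionalDir n f E (perp2 v)) {σ τ : ℝ}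
    (hσ : σ = 1 ∨ σ = -1) (hτ : τ = 1 ∨ τ = -1) : ∃ ρ > (0:ℝ), Frame f E v σ τ ρ ρ := by
  unfold ExceptionalDir at hperp
  push Not at hperp
  choose k c C ρ hc hρ H using fun i => coneBd_one hv hσ hτ (f i) (hf i) (hperp.1 i)
  obtain ⟨r, hr, hrρ⟩ := exists_pos_le_fin ρ hρ
  obtain ⟨r', hr', H'⟩ := noFrontier hv hσ hτ _ hperp.2
  refine ⟨min r r', lt_min hr hr', k, c, C, hc, fun i => (H i).mono ?_ ?_, fun p hp => ?_⟩
  · exact (min_le_left _ _).trans (hrρ i)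
  · exact (min_le_left _ _).trans (hrρ i)
  · rw [frontier_Ph hv hσ hτ]
    exact H' p (coneII_mono (min_le_right _ _) (min_le_right _ _) hp)

theorem frame_all {n : ℕ} (f : Fin n → ℝ × ℝ → ℝ) (E : Set (ℝ × ℝ)) (hf : ∀ i, AnalyticAt ℝ (f i) 0)
    {v : ℝ × ℝ} (hv : nrm2 v = 1) (hperp : ¬ ExceptionalDir n f E (perp2 v)) :
    ∃ ρ > (0:ℝ), ρ ≤ 1 ∧ ∀ σ τ : ℝ, (σ = 1 ∨ σ = -1) → (τ = 1 ∨ τ = -1) → Frame f E v σ τ ρ ρ := by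
  have h1 : (1:ℝ) = 1 ∨ (1:ℝ) = -1 := Or.inl rfl
  have h2 : (-1:ℝ) = 1 ∨ (-1:ℝ) = -1 := Or.inr rfl
  obtain ⟨a, ha, Ha⟩ := frame_one f E hf hv hperp h1 h1
  obtain ⟨b, hb, Hb⟩ := frame_one f E hf hv hperp h1 h2
  obtain ⟨c, hc, Hc⟩ := frame_one f E hf hv hperp h2 h1
  obtain ⟨d, hd, Hd⟩ := frame_one f E hf hv hperp h2 h2
  refine ⟨min 1 (min (min a b) (min c d)), by positivity, min_le_left _ _, ?_⟩
  have e : min 1 (min (min a b) (min c d)) ≤ min (min a b) (min c d) := min_le_right _ _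
  set m := min 1 (min (min a b) (min c d))
  obtain ⟨⟨ea, eb⟩, ⟨ec, ed⟩⟩ : (m ≤ a ∧ m ≤ b) ∧ m ≤ c ∧ m ≤ d := by simpa only [le_min_iff] using e
  rintro σ τ (rfl | rfl) (rfl | rfl)
  · exact Ha.mono ea ea
  · exact Hb.mono eb eb
  · exact Hc.mono ec ec
  · exact Hd.mono ed ed

theorem stdFun_Ph {n : ℕ} (f : Fin n → ℝ × ℝ → ℝ) (γ : Fin n → ℝ) (E : Set (ℝ × ℝ)) (v : ℝ × ℝ) (σ τ : ℝ)
    (p : ℝ × ℝ) : stdFun n (fun i p => f i (Ph v σ τ p)) γ (Ph v σ τ ⁻¹' E) p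
      = stdFun n f γ E (Rv v (flip2 σ τ p)) := rfl

theorem ball_flip {σ τ : ℝ} (hσ : σ = 1 ∨ σ = -1) (hτ : τ = 1 ∨ τ = -1) (R : ℝ) :
    flip2 σ τ ⁻¹' ball 0 R = ball 0 R := by
  ext p; simp [norm_flip2 hσ hτ]

theorem intOn_flip {g : ℝ × ℝ → ℝ} {σ τ : ℝ} (hσ : σ = 1 ∨ σ = -1) (hτ : τ = 1 ∨ τ = -1) {D : Set (ℝ × ℝ)}
    (h : IntegrableOn g D) : IntegrableOn (fun p => g (flip2 σ τ p)) (flip2 σ τ ⁻¹' D) :=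
  ((mp_flip2 hσ hτ).integrableOn_comp_preimage (emb_flip2 hσ hτ)).2 h

theorem good_I {n : ℕ} (f : Fin n → ℝ × ℝ → ℝ) (γ : Fin n → ℝ) (E : Set (ℝ × ℝ))
    (hf : ∀ i, AnalyticAt ℝ (f i) 0) (hE : IsStdDomain E)
    {v : ℝ × ℝ} (hv : nrm2 v = 1) {κ ρ : ℝ} (hκ : 0 < κ) (hρ : 0 < ρ) {σ : ℝ} (hσ : σ = 1 ∨ σ = -1)
    (hF : Frame f E v σ 1 κ ρ) (R : ℝ) (hR : 0 < R)
    (hi : IntegrableOn (fun p => stdFun n f γ E (Rv v p)) (ball 0 R)) :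
    ∃ a > (0:ℝ), coneI (1 / κ) a ⊆ ball 0 R ∧
      Good (fun p => stdFun n f γ E (Rv v p)) (a / 2) (flip2 σ 1 ⁻¹' coneI (1 / κ) a) := by
  have h1 : (1:ℝ) = 1 ∨ (1:ℝ) = -1 := Or.inl rfl
  obtain ⟨M, hM, bs, hed⟩ := edge_dom (κ := 1 / κ) (by positivity) hv hσ h1 E hE
  obtain ⟨k, c, C, hc, hB, -⟩ := hF
  have hi' := intOn_flip hσ h1 hi
  rw [ball_flip hσ h1] at hi'
  obtain ⟨L, -, hL, hL'⟩ := Ph_fderiv hv hσ h1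
  obtain ⟨a, ha, hsub, hG⟩ := typeI (fun i p => f i (Ph v σ 1 p)) γ (Ph v σ 1 ⁻¹' E) (fun i => by
      have hL2 : Ph v σ 1 = L := by ext1 q; exact (hL q).symm
      have h0 : Ph v σ 1 0 = 0 := by rw [← hL, map_zero]
      refine AnalyticAt.fun_comp (g := f i) (f := Ph v σ 1) ?_ ?_
      · rw [h0]; exact hf i
      · rw [hL2]; exact L.analyticAt 0)
    (fun i hev => by
      obtain ⟨t, ht, H⟩ := ev_Ioo (hev.filter_mono nhdsWithin_le_nhds : ∀ᶠ b in 𝓝[>] (0:ℝ), _)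
      have hb : 0 < min t ρ / 2 := by positivity
      have e1 : min t ρ / 2 < t := by linarith [min_le_left t ρ]
      have e2 : min t ρ / 2 < ρ := by linarith [min_le_right t ρ]
      have hz := H _ hb e1
      have := (hB i (0, min t ρ / 2) ⟨hb, e2, by simpa using mul_pos hκ hb⟩).1
      dsimp only at this
      rw [hz, abs_zero] at this
      have := mul_pos (hc i) (pow_pos hb (k i))
      linarith)
    (1 / κ) (by positivity) M hM bs hed (ball 0 R) (ball_mem_nhds _ hR) hi'
  exact ⟨a, ha, hsub, Good.flip hσ h1 hG⟩

theorem coneII_ball {κ r R : ℝ} (hκ1 : κ ≤ 1) (hR : r ≤ R) : coneII κ r ⊆ ball 0 R := by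
  rintro p ⟨h1, h2, h3⟩
  rw [mem_ball_zero_iff, Prod.norm_def]
  apply max_lt
  · show |p.1| < R
    nlinarith
  · show |p.2| < R
    rw [abs_of_pos h1]; linarith

theorem good_II {n : ℕ} (f : Fin n → ℝ × ℝ → ℝ) (γ : Fin n → ℝ) (E : Set (ℝ × ℝ))
    {v : ℝ × ℝ} {κ ρ : ℝ} (hκ : 0 < κ) (hκ1 : κ ≤ 1) (hρ : 0 < ρ) {τ : ℝ}
    (hτ : τ = 1 ∨ τ = -1) (hF : Frame f E v 1 τ κ ρ) (R : ℝ) (hR : ρ ≤ R)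
    (hi : IntegrableOn (fun p => stdFun n f γ E (Rv v p)) (ball 0 R)) :
    Good (fun p => stdFun n f γ E (Rv v p)) (ρ / 2) (flip2 1 τ ⁻¹' coneII κ ρ) := by
  have h1 : (1:ℝ) = 1 ∨ (1:ℝ) = -1 := Or.inl rfl
  obtain ⟨k, c, C, hc, hB, hfr⟩ := hF
  have hi' := intOn_flip h1 hτ hi
  rw [ball_flip h1 hτ] at hi'
  exact Good.flip h1 hτ (typeII _ γ _ κ ρ hκ hκ1 hρ k c C hc hB hfr (hi'.mono_set (coneII_ball hκ1 hR)))

theorem null_line (κ : ℝ) : volume {p : ℝ × ℝ | p.1 = κ * p.2} = 0 := by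
  set L : ℝ × ℝ →ₗ[ℝ] ℝ := LinearMap.fst ℝ ℝ ℝ - κ • LinearMap.snd ℝ ℝ ℝ with hL
  have e : {p : ℝ × ℝ | p.1 = κ * p.2} = (LinearMap.ker L : Set (ℝ × ℝ)) := by
    ext p; simp [hL, sub_eq_zero]
  rw [e]
  apply Measure.addHaar_submodule
  intro h
  have : ((1, 0) : ℝ × ℝ) ∈ LinearMap.ker L := by rw [h]; trivial
  simp [hL] at this

theorem osc_bound {n : ℕ} (f : Fin n → ℝ × ℝ → ℝ) (γ : Fin n → ℝ) (E : Set (ℝ × ℝ))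
    (hf : ∀ i, AnalyticAt ℝ (f i) 0) (hE : IsStdDomain E)
    {v : ℝ × ℝ} (hv : nrm2 v = 1) (hperp : ¬ ExceptionalDir n f E (perp2 v)) (R : ℝ) (hR : 0 < R)
    (hi : IntegrableOn (fun p => stdFun n f γ E (Rv v p)) (ball 0 R)) :
    ∃ r > (0:ℝ), r ≤ R ∧ ∃ C : ℝ, 0 ≤ C ∧ ∀ M Ψ, Tame M r Ψ → ∀ s : ℝ,
      ‖∫ p, oscI (fun p => stdFun n f γ E (Rv v p)) Ψ s p‖
        ≤ C * M * ∫ p in ball 0 R, wtI (fun p => stdFun n f γ E (Rv v p)) s p := by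
  have h1 : (1:ℝ) = 1 ∨ (1:ℝ) = -1 := Or.inl rfl
  have h2 : (-1:ℝ) = 1 ∨ (-1:ℝ) = -1 := Or.inr rfl
  obtain ⟨κ, hκ, hκ1, HF⟩ := frame_all f E hf hv hperp
  obtain ⟨a, ha, has, Ga⟩ := good_I f γ E hf hE hv hκ hκ h1 (HF _ _ h1 h1) R hR hi
  obtain ⟨b, hb, hbs, Gb⟩ := good_I f γ E hf hE hv hκ hκ h2 (HF _ _ h2 h1) R hR hi
  set ρ := min κ R with hρd
  have hρ : 0 < ρ := lt_min hκ hR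
  have Gc := good_II f γ E hκ hκ1 hρ h1 ((HF _ _ h1 h1).mono le_rfl (min_le_left κ R)) R (min_le_right _ _) hi
  have Gd := good_II f γ E hκ hκ1 hρ h2 ((HF _ _ h1 h2).mono le_rfl (min_le_left κ R)) R (min_le_right _ _) hi
  set g := fun p => stdFun n f γ E (Rv v p) with hg
  have hg0 : ∀ p, 0 ≤ g p := fun p => stdFun_nonneg n f γ E _
  set r := min (min (a / 2) (b / 2)) (ρ / 2) with hr
  have hr0 : 0 < r := by positivity
  have ra : r ≤ a / 2 := (min_le_left _ _).trans (min_le_left _ _)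
  have rb : r ≤ b / 2 := (min_le_left _ _).trans (min_le_right _ _)
  have rρ : r ≤ ρ / 2 := min_le_right _ _
  have cI : ∀ a, MeasurableSet (coneI (1 / κ) a) := fun a => coneI_meas _ _
  have sub : ∀ {σ τ : ℝ} (_ : σ = 1 ∨ σ = -1) (_ : τ = 1 ∨ τ = -1) {D : Set (ℝ × ℝ)}, D ⊆ ball 0 R →
      flip2 σ τ ⁻¹' D ⊆ ball 0 R := by
    intro σ τ hσ hτ D hD
    rw [← ball_flip hσ hτ R]; exact preimage_mono hD
  have s1 := sub h1 h1 has
  have s2 := sub h2 h1 hbs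
  have s3 := sub h1 h1 (coneII_ball hκ1 (min_le_right κ R))
  have s4 := sub h1 h2 (coneII_ball hκ1 (min_le_right κ R))
  set D1 := flip2 1 1 ⁻¹' coneI (1 / κ) a with hD1
  set D2 := flip2 (-1) 1 ⁻¹' coneI (1 / κ) b with hD2
  set D3 := flip2 1 1 ⁻¹' coneII κ ρ with hD3
  set D4 := flip2 1 (-1) ⁻¹' coneII κ ρ with hD4
  have m1 : MeasurableSet D1 := (flip2_cont _ _).measurable (coneI_meas _ _)
  have m2 : MeasurableSet D2 := (flip2_cont _ _).measurable (coneI_meas _ _)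
  have m3 : MeasurableSet D3 := (flip2_cont _ _).measurable (coneII_meas _ _)
  have m4 : MeasurableSet D4 := (flip2_cont _ _).measurable (coneII_meas _ _)
  have kd : ∀ x y : ℝ, 0 < x → |y| < 1 / κ * x → |x| < κ * |y| → False := by
    intro x y hx h3 h4
    rw [abs_of_pos hx] at h4
    have : κ * |y| < κ * (1 / κ * x) := by gcongr
    have e : κ * (1 / κ * x) = x := by field_simp
    linarith
  have d12 : Disjoint D1 D2 := by
    rw [Set.disjoint_left]
    rintro p ⟨p1, -, -⟩ ⟨q1, -, -⟩
    simp [flip2] at p1 q1; linarith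
  have d34 : Disjoint D3 D4 := by
    rw [Set.disjoint_left]
    rintro p ⟨p1, -, -⟩ ⟨q1, -, -⟩
    simp [flip2] at p1 q1; linarith
  have x3 : ∀ p ∈ D3 ∪ D4, |p.1| < κ * |p.2| := by
    rintro p (⟨p1, -, p3⟩ | ⟨p1, -, p3⟩) <;> simp [flip2] at p1 p3
    · rwa [abs_of_pos p1]
    · rw [abs_of_neg p1]; linarith
  have d1234 : Disjoint (D1 ∪ D2) (D3 ∪ D4) := by
    rw [Set.disjoint_left]
    rintro p h h'
    have h3 := x3 p h'
    rcases h with ⟨p1, -, p3⟩ | ⟨p1, -, p3⟩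
    · simp only [flip2, one_mul] at p1 p3
      exact kd _ _ p1 p3 h3
    · simp only [flip2, one_mul, neg_mul] at p1 p3
      exact kd _ _ p1 p3 (by rwa [abs_neg])
  have G12 := (Ga.mono ra).union hg0 (Gb.mono rb) d12 m2 (hi.mono_set s1) (hi.mono_set s2)
  have G34 := (Gc.mono rρ).union hg0 (Gd.mono rρ) d34 m4 (hi.mono_set s3) (hi.mono_set s4)
  have i12 : IntegrableOn g (D1 ∪ D2) := hi.mono_set (union_subset s1 s2)
  have i34 : IntegrableOn g (D3 ∪ D4) := hi.mono_set (union_subset s3 s4)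
  obtain ⟨C, hC, H⟩ := G12.union hg0 G34 d1234 (m3.union m4) i12 i34
  set D := D1 ∪ D2 ∪ (D3 ∪ D4) with hD
  have sD : D ⊆ ball 0 R := union_subset (union_subset s1 s2) (union_subset s3 s4)
  have mD : MeasurableSet D := (m1.union m2).union (m3.union m4)
  refine ⟨r, hr0, ?_, C, hC, fun M Ψ hΨ s => ?_⟩
  · have := min_le_right κ R
    linarith
  have cover : ∀ p : ℝ × ℝ, ‖p‖ < r → p.1 ≠ κ * p.2 → p.1 ≠ (-κ) * p.2 → p ∈ D := by
    intro p hp n1 n2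
    have a1 : |p.1| ≤ ‖p‖ := norm_fst_le p
    have a2 : |p.2| ≤ ‖p‖ := norm_snd_le p
    rcases lt_or_ge |p.1| (κ * |p.2|) with h | h
    · right
      have : 0 < |p.2| := by
        by_contra! hc
        nlinarith [abs_nonneg p.1]
      rcases lt_or_gt_of_ne (abs_pos.1 this) with hn | hn
      · right
        rw [abs_of_neg hn] at h a2
        refine ⟨?_, ?_, ?_⟩ <;> simp [flip2] <;> linarith
      · left
        rw [abs_of_pos hn] at h a2
        refine ⟨?_, ?_, ?_⟩ <;> simp [flip2] <;> linarith
    · left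
      have h' : κ * |p.2| < |p.1| := by
        refine lt_of_le_of_ne h fun he => ?_
        rcases abs_cases p.1 with ⟨e1, _⟩ | ⟨e1, _⟩ <;> rcases abs_cases p.2 with ⟨e2, _⟩ | ⟨e2, _⟩ <;>
          rw [e1, e2] at he
        · exact n1 he.symm
        · exact n2 (by linarith)
        · exact n2 (by linarith)
        · exact n1 (by linarith)
      have h4 : |p.2| < 1 / κ * |p.1| := by
        rw [one_div, ← div_eq_inv_mul, lt_div_iff₀ hκ]; linarith
      have : 0 < |p.1| := lt_of_le_of_lt (by positivity) h'
      rcases lt_or_gt_of_ne (abs_pos.1 this) with hn | hn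
      · right
        rw [abs_of_neg hn] at h4 a1
        refine ⟨?_, ?_, ?_⟩ <;> simp only [flip2, one_mul, neg_mul] <;> linarith
      · left
        rw [abs_of_pos hn] at h4 a1
        refine ⟨?_, ?_, ?_⟩ <;> simp only [flip2, one_mul] <;> linarith
  have hae : ∀ᵐ p : ℝ × ℝ, p.1 ≠ κ * p.2 ∧ p.1 ≠ (-κ) * p.2 := by
    have e1 : ∀ᵐ p : ℝ × ℝ, p.1 ≠ κ * p.2 := by
      rw [ae_iff]; simpa using null_line κ
    have e2 : ∀ᵐ p : ℝ × ℝ, p.1 ≠ (-κ) * p.2 := by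
      rw [ae_iff]; simpa using null_line (-κ)
    exact e1.and e2
  have eq : ∫ p, oscI g Ψ s p = ∫ p in D, oscI g Ψ s p := by
    rw [← integral_indicator mD]
    apply integral_congr_ae
    filter_upwards [hae] with p hp
    by_cases hpD : p ∈ D
    · rw [indicator_of_mem hpD]
    · rw [indicator_of_notMem hpD]
      have : r ≤ ‖p‖ := by
        by_contra! hlt
        exact hpD (cover p hlt hp.1 hp.2)
      simp [oscI, hΨ.2.2.2 p this]
  rw [eq]
  refine (H M Ψ hΨ s).trans ?_
  have hM := hΨ.1
  refine mul_le_mul_of_nonneg_left ?_ (by positivity)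
  exact setIntegral_mono_set (wtI_integrable hi s) (Eventually.of_forall (wtI_nonneg hg0 s)) sD.eventuallyLE

theorem rpow_between {c C γ z : ℝ} (hc : 0 < c) (h1 : c ≤ z) (h2 : z ≤ C) :
    min (c ^ γ) (C ^ γ) ≤ z ^ γ ∧ z ^ γ ≤ max (c ^ γ) (C ^ γ) := by
  have hz : 0 < z := hc.trans_le h1
  rcases le_total 0 γ with h | h
  · exact ⟨(min_le_left _ _).trans (Real.rpow_le_rpow hc.le h1 h),
      (Real.rpow_le_rpow hz.le h2 h).trans (le_max_right _ _)⟩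
  · exact ⟨(min_le_right _ _).trans (Real.rpow_le_rpow_of_nonpos hz h2 h),
      (Real.rpow_le_rpow_of_nonpos hc h1 h).trans (le_max_left _ _)⟩

theorem prod_cone {n : ℕ} (F : Fin n → ℝ × ℝ → ℝ) (γ : Fin n → ℝ) (κ ρ : ℝ) (k : Fin n → ℕ) (c C : Fin n → ℝ)
    (hc : ∀ i, 0 < c i) (hF : ∀ i, ConeBd (F i) (k i) (c i) (C i) κ ρ) (s : Finset (Fin n)) :
    ∃ m c0 C0 : ℝ, 0 < c0 ∧ 0 < C0 ∧ ∀ p ∈ coneII κ ρ, c0 * p.2 ^ m ≤ ∏ i ∈ s, |F i p| ^ γ i ∧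
      ∏ i ∈ s, |F i p| ^ γ i ≤ C0 * p.2 ^ m := by
  induction s using Finset.induction_on with
  | empty => exact ⟨0, 1, 1, one_pos, one_pos, fun p hp => by simp⟩
  | insert i s his ih =>
    obtain ⟨m, c0, C0, h1, h2, h3⟩ := ih
    set C' := max (c i) (C i) with hC'
    have hC0 : 0 < C' := (hc i).trans_le (le_max_left _ _)
    have q1 : 0 < min (c i ^ γ i) (C' ^ γ i) := lt_min (Real.rpow_pos_of_pos (hc i) _) (Real.rpow_pos_of_pos hC0 _)
    have q2 : 0 < max (c i ^ γ i) (C' ^ γ i) := lt_max_of_lt_left (Real.rpow_pos_of_pos (hc i) _)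
    refine ⟨k i * γ i + m, min (c i ^ γ i) (C' ^ γ i) * c0, max (c i ^ γ i) (C' ^ γ i) * C0,
      mul_pos q1 h1, mul_pos q2 h2, fun p hp => ?_⟩
    obtain ⟨e1, e2, -⟩ := hF i p hp
    obtain ⟨e3, e4⟩ := h3 p hp
    have hp2 : 0 < p.2 := hp.1
    have hpk : 0 < p.2 ^ (k i) := pow_pos hp2 _
    have hz := rpow_between (γ := γ i) (hc i) (z := |F i p| / p.2 ^ (k i)) (C := C')
      ((le_div_iff₀ hpk).2 e1) ((div_le_iff₀ hpk).2 (e2.trans (by gcongr; exact le_max_right _ _)))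
    have hFe : |F i p| ^ γ i = (|F i p| / p.2 ^ (k i)) ^ γ i * p.2 ^ (k i * γ i) := by
      rw [Real.div_rpow (abs_nonneg _) hpk.le, Real.rpow_mul hp2.le, Real.rpow_natCast]
      have : 0 < (p.2 ^ k i) ^ γ i := Real.rpow_pos_of_pos hpk _
      field_simp
    have t1 : 0 < p.2 ^ (k i * γ i) := Real.rpow_pos_of_pos hp2 _
    have t2 : 0 < p.2 ^ m := Real.rpow_pos_of_pos hp2 _
    rw [Finset.prod_insert his, Real.rpow_add hp2, hFe]
    set z := (|F i p| / p.2 ^ (k i)) ^ γ i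
    have hz0 : 0 ≤ z := q1.le.trans hz.1
    constructor
    · calc _ = (min (c i ^ γ i) (C' ^ γ i) * p.2 ^ (k i * γ i)) * (c0 * p.2 ^ m) := by ring
        _ ≤ _ := by
          gcongr
          exact hz.1
    · calc _ ≤ (max (c i ^ γ i) (C' ^ γ i) * p.2 ^ (k i * γ i)) * (C0 * p.2 ^ m) := by
            refine mul_le_mul ?_ e4 ((by positivity : 0 ≤ c0 * p.2 ^ m).trans e3) (by positivity)
            gcongr
            exact hz.2
        _ = _ := by ring

theorem cone_alt {n : ℕ} (f : Fin n → ℝ × ℝ → ℝ) (γ : Fin n → ℝ) (E : Set (ℝ × ℝ)) {v : ℝ × ℝ} {κ ρ τ : ℝ}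
    (hF : Frame f E v 1 τ κ ρ) :
    ∃ m c0 C0 : ℝ, 0 < c0 ∧ 0 < C0 ∧ ((∀ p ∈ coneII κ ρ, stdFun n f γ E (Rv v (flip2 1 τ p)) = 0) ∨
      ∀ p ∈ coneII κ ρ, c0 * p.2 ^ m ≤ stdFun n f γ E (Rv v (flip2 1 τ p)) ∧
        stdFun n f γ E (Rv v (flip2 1 τ p)) ≤ C0 * p.2 ^ m) := by
  obtain ⟨k, c, C, hc, hB, hfr⟩ := hF
  obtain ⟨m, c0, C0, h1, h2, h3⟩ := prod_cone _ γ κ ρ k c C hc hB Finset.univ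
  refine ⟨m, c0, C0, h1, h2, ?_⟩
  rcases cone_subset_or hfr with h | h
  · right
    intro p hp
    have hm : Rv v (flip2 1 τ p) ∈ E := h hp
    rw [stdFun, indicator_of_mem hm]
    exact h3 p hp
  · left
    intro p hp
    have hm : Rv v (flip2 1 τ p) ∉ E := h p hp
    rw [stdFun, indicator_of_notMem hm]

theorem disk2_flip {σ τ : ℝ} (hσ : σ = 1 ∨ σ = -1) (hτ : τ = 1 ∨ τ = -1) (r : ℝ) :
    flip2 σ τ ⁻¹' disk2 r = disk2 r := by
  rcases hσ with rfl | rfl <;> rcases hτ with rfl | rfl <;> ext p <;> simp [flip2, disk2]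

theorem disk2_ball {r R : ℝ} (hr : 0 < r) (h : r ≤ R) : disk2 r ⊆ ball 0 R := by
  intro p (hp : p.1 ^ 2 + p.2 ^ 2 < r ^ 2)
  rw [mem_ball_zero_iff, Prod.norm_def]
  apply max_lt
  · exact (abs_lt_of_sq_lt_sq (by nlinarith [sq_nonneg p.2]) hr.le).trans_le h
  · exact (abs_lt_of_sq_lt_sq (by nlinarith [sq_nonneg p.1]) hr.le).trans_le h

theorem disk2_meas (r : ℝ) : MeasurableSet (disk2 r) :=
  (isOpen_lt (f := fun p : ℝ × ℝ => p.1 ^ 2 + p.2 ^ 2) (g := fun _ => r ^ 2) (by fun_prop) (by fun_prop)).measurableSet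

theorem half_rpow {b y m : ℝ} (hb : 0 < b) (h1 : b / 2 < y) (h2 : y < b) : (2:ℝ) ^ (-|m|) * b ^ m ≤ y ^ m := by
  have h := (rpow_between (γ := m) (c := 1 / 2) (C := 1) (z := y / b) (by norm_num)
    (by rw [le_div_iff₀ hb]; linarith) (by rw [div_le_one hb]; exact h2.le)).1
  have e : y ^ m = (y / b) ^ m * b ^ m := by
    rw [Real.div_rpow (by linarith) hb.le]
    have := Real.rpow_pos_of_pos hb m
    field_simp
  rw [e]
  gcongr
  refine le_trans (le_min ?_ ?_) h
  · rw [one_div, Real.inv_rpow (by norm_num), ← Real.rpow_neg (by norm_num)]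
    apply Real.rpow_le_rpow_of_exponent_le (by norm_num)
    linarith [le_abs_self m]
  · rw [Real.one_rpow]
    exact Real.rpow_le_one_of_one_le_of_nonpos (by norm_num) (by simp)

theorem cone_pt {g : ℝ × ℝ → ℝ} (hg : ∀ p, 0 ≤ g p) {ε : ℝ} {d : ℕ} {κ ρ τ : ℝ} (hκ : 0 < κ) (hκ1 : κ ≤ 1)
    (hτ : τ = 1 ∨ τ = -1) {m c0 C0 R c₂ c₃ : ℝ} (hc0 : 0 < c0) (hC0 : 0 < C0) (hc2 : 0 < c₂)
    (hcone : (∀ p ∈ coneII κ ρ, g (flip2 1 τ p) = 0) ∨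
      ∀ p ∈ coneII κ ρ, c0 * p.2 ^ m ≤ g (flip2 1 τ p) ∧ g (flip2 1 τ p) ≤ C0 * p.2 ^ m)
    (hi : IntegrableOn g (ball 0 R))
    (hball : ∀ r : ℝ, 0 < r → r < c₃ → (∫ p in disk2 r, g p) ≤ c₂ * r ^ ε * |Real.log r| ^ d) :
    ∃ K > (0:ℝ), ∀ p ∈ coneII κ ρ, 2 * p.2 < c₃ → 2 * p.2 ≤ R → 2 * p.2 ≤ 1 →
      g (flip2 1 τ p) ≤ K * (p.2 ^ (ε - 2) * |Real.log p.2| ^ d) := by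
  have h1 : (1:ℝ) = 1 ∨ (1:ℝ) = -1 := Or.inl rfl
  rcases hcone with h | h
  · refine ⟨1, one_pos, fun p hp _ _ _ => ?_⟩
    have : 0 < p.2 := hp.1
    rw [h p hp]; positivity
  have hw : (0:ℝ) < 2 ^ (-|m|) := Real.rpow_pos_of_pos (by norm_num) _
  have hK : 0 < C0 * (c₂ * 2 ^ ε) * (c0 * 2 ^ (-|m|) * (κ / 2))⁻¹ := by positivity
  refine ⟨_, hK, fun p hp hp1 hp2 hp3 => ?_⟩
  refine (h p hp).2.trans ?_
  set b := p.2 with hb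
  have hb0 : 0 < b := hp.1
  have hbρ : b < ρ := hp.2.1
  set Q : Set (ℝ × ℝ) := Ioo (-(κ * b / 2)) (κ * b / 2) ×ˢ Ioo (b / 2) b with hQ
  have mQ : MeasurableSet Q := measurableSet_Ioo.prod measurableSet_Ioo
  have hQc : ∀ q ∈ Q, q ∈ coneII κ ρ := by
    rintro q ⟨⟨q1, q2⟩, q3, q4⟩
    refine ⟨by linarith, by linarith, ?_⟩
    have : |q.1| < κ * b / 2 := abs_lt.2 ⟨q1, q2⟩
    nlinarith
  have hQd : Q ⊆ disk2 (2 * b) := by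
    rintro q ⟨⟨q1, q2⟩, q3, q4⟩
    show q.1 ^ 2 + q.2 ^ 2 < (2 * b) ^ 2
    have : κ * b ≤ b := by nlinarith
    nlinarith
  have hid : IntegrableOn (fun p => g (flip2 1 τ p)) (disk2 (2 * b)) := by
    have := intOn_flip h1 hτ (hi.mono_set (disk2_ball (by linarith) hp2))
    rwa [disk2_flip h1 hτ] at this
  have e1 : ∫ p in disk2 (2 * b), g (flip2 1 τ p) = ∫ p in disk2 (2 * b), g p := by
    have := setInt_flip h1 hτ (flip2 1 τ ⁻¹' disk2 (2 * b)) g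
    rw [disk2_flip h1 hτ, disk2_flip h1 hτ] at this
    exact this.symm
  have vQ : volume.real Q = κ * b * (b / 2) := by
    rw [hQ, Measure.real, Measure.volume_eq_prod, Measure.prod_prod, Real.volume_Ioo, Real.volume_Ioo,
      ENNReal.toReal_mul, ENNReal.toReal_ofReal (by nlinarith), ENNReal.toReal_ofReal (by linarith)]
    ring
  have low : (c0 * (2 ^ (-|m|) * b ^ m)) * volume.real Q ≤ ∫ p in Q, g (flip2 1 τ p) := by
    apply setIntegral_ge_of_const_le_real mQ
    · rw [hQ, Measure.volume_eq_prod, Measure.prod_prod, Real.volume_Ioo, Real.volume_Ioo]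
      exact ENNReal.mul_ne_top ENNReal.ofReal_ne_top ENNReal.ofReal_ne_top
    · intro q hq
      refine le_trans ?_ (h q (hQc q hq)).1
      gcongr
      exact half_rpow hb0 hq.2.1 hq.2.2
    · exact hid.mono_set hQd
  have up : ∫ p in Q, g (flip2 1 τ p) ≤ ∫ p in disk2 (2 * b), g (flip2 1 τ p) :=
    setIntegral_mono_set hid (Eventually.of_forall fun p => hg _) hQd.eventuallyLE
  have hb2 := hball (2 * b) (by linarith) hp1
  rw [e1] at up
  rw [vQ] at low
  have hlog : |Real.log (2 * b)| ≤ |Real.log b| := by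
    rw [abs_of_nonpos (Real.log_nonpos (by linarith) hp3), abs_of_nonpos (Real.log_nonpos (by linarith) (by linarith))]
    linarith [Real.log_le_log hb0 (by linarith : b ≤ 2 * b)]
  have t := low.trans (up.trans hb2)
  rw [Real.mul_rpow (by norm_num) hb0.le] at t
  have t2 : c0 * (2 ^ (-|m|) * b ^ m) * (κ * b * (b / 2)) ≤ c₂ * (2 ^ ε * b ^ ε) * |Real.log b| ^ d :=
    t.trans (by gcongr)
  have eb : b ^ ε = b ^ (ε - 2) * b ^ 2 := by
    rw [← Real.rpow_natCast b 2, ← Real.rpow_add hb0]; norm_num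
  rw [eb] at t2
  have hcc : 0 < c0 * 2 ^ (-|m|) * (κ / 2) := by positivity
  have t3 : (c0 * 2 ^ (-|m|) * (κ / 2)) * b ^ m ≤ c₂ * 2 ^ ε * (b ^ (ε - 2) * |Real.log b| ^ d) := by
    have hb2 : 0 < b ^ 2 := by positivity
    refine le_of_mul_le_mul_right ?_ hb2
    calc _ = c0 * (2 ^ (-|m|) * b ^ m) * (κ * b * (b / 2)) := by ring
      _ ≤ _ := t2
      _ = _ := by ring
  have t4 : b ^ m ≤ (c0 * 2 ^ (-|m|) * (κ / 2))⁻¹ * (c₂ * 2 ^ ε * (b ^ (ε - 2) * |Real.log b| ^ d)) := by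
    rw [← div_eq_inv_mul, le_div_iff₀ hcc]; linarith
  calc C0 * b ^ m ≤ C0 * ((c0 * 2 ^ (-|m|) * (κ / 2))⁻¹ * (c₂ * 2 ^ ε * (b ^ (ε - 2) * |Real.log b| ^ d))) := by
        gcongr
    _ = _ := by ring

theorem setInt_union_le {g : ℝ × ℝ → ℝ} (hg : ∀ p, 0 ≤ g p) {A B : Set (ℝ × ℝ)} (mA : MeasurableSet A)
    (mB : MeasurableSet B) (iA : IntegrableOn g A) (iB : IntegrableOn g B) :
    ∫ p in A ∪ B, g p ≤ (∫ p in A, g p) + ∫ p in B, g p := by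
  rw [← Set.union_diff_self, setIntegral_union disjoint_sdiff_right (mB.diff mA) iA (iB.mono_set diff_subset)]
  refine add_le_add_right ?_ _
  exact setIntegral_mono_set iB (Eventually.of_forall fun p => hg p) diff_subset.eventuallyLE

theorem rect_int {ε K L r c ρ : ℝ} (hε : ε < 1) (hr : 0 < r) (hc : r ≤ c) (hK : 0 ≤ K) (hL : 0 ≤ L) :
    IntegrableOn (fun p : ℝ × ℝ => K * (p.2 ^ (ε - 2) * L)) (Ioo (-r) r ×ˢ Ioo c ρ) ∧
    ∫ p in Ioo (-r) r ×ˢ Ioo c ρ, K * (p.2 ^ (ε - 2) * L) ≤ 2 * K / (1 - ε) * (r ^ ε * L) := by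
  have hc0 : 0 < c := hr.trans_le hc
  have i0 : IntegrableOn (fun b : ℝ => b ^ (ε - 2)) (Ioi c) := integrableOn_Ioi_rpow_of_lt (by linarith) hc0
  have i1 : IntegrableOn (fun b : ℝ => K * (b ^ (ε - 2) * L)) (Ioo c ρ) :=
    ((i0.mono_set Ioo_subset_Ioi_self).mul_const L).const_mul K
  have e : (fun p : ℝ × ℝ => K * (p.2 ^ (ε - 2) * L)) =
      fun p : ℝ × ℝ => (fun _ : ℝ => (1:ℝ)) p.1 * (fun b : ℝ => K * (b ^ (ε - 2) * L)) p.2 := by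
    ext p; simp
  constructor
  · rw [e, IntegrableOn, Measure.volume_eq_prod, ← Measure.prod_restrict]
    exact Integrable.mul_prod (f := fun _ : ℝ => (1:ℝ)) (g := fun b : ℝ => K * (b ^ (ε - 2) * L)) (integrable_const _) i1
  · rw [e, Measure.volume_eq_prod, setIntegral_prod_mul (fun _ : ℝ => (1:ℝ)) (fun b : ℝ => K * (b ^ (ε - 2) * L))]
    have e1 : ∫ x in Ioo (-r) r, (1:ℝ) = 2 * r := by
      simp [Measure.real, Real.volume_Ioo]
      rw [ENNReal.toReal_ofReal (by linarith)]; ring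
    have e2 : ∫ b in Ioo c ρ, K * (b ^ (ε - 2) * L) ≤ K * (r ^ (ε - 1) / (1 - ε) * L) := by
      rw [integral_const_mul, integral_mul_const]
      gcongr
      calc ∫ b in Ioo c ρ, b ^ (ε - 2) ≤ ∫ b in Ioi c, b ^ (ε - 2) := by
            refine setIntegral_mono_set i0 ?_ Ioo_subset_Ioi_self.eventuallyLE
            filter_upwards [ae_restrict_mem measurableSet_Ioi] with b hb
            exact (Real.rpow_pos_of_pos (hc0.trans hb) _).le
        _ = c ^ (ε - 1) / (1 - ε) := by
            rw [integral_Ioi_rpow_of_lt (by linarith) hc0, show ε - 2 + 1 = -(1 - ε) by ring, neg_div_neg_eq,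
              show ε - 1 = -(1 - ε) by ring]
        _ ≤ r ^ (ε - 1) / (1 - ε) := by
            have : 0 < 1 - ε := by linarith
            gcongr ?_ / _
            exact Real.rpow_le_rpow_of_nonpos hr hc (by linarith)
    rw [e1]
    calc 2 * r * ∫ b in Ioo c ρ, K * (b ^ (ε - 2) * L) ≤ 2 * r * (K * (r ^ (ε - 1) / (1 - ε) * L)) := by gcongr
      _ = 2 * K / (1 - ε) * ((r ^ (ε - 1) * r) * L) := by ring
      _ = _ := by
        have : r ^ (ε - 1) * r = r ^ ε := by
          nth_rewrite 2 [← Real.rpow_one r]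
          rw [← Real.rpow_add hr]; congr 1; ring
        rw [this]

theorem strip_abs {g : ℝ × ℝ → ℝ} (hg : ∀ p, 0 ≤ g p) {ε : ℝ} {d : ℕ} {κ ρ K c₂ c₃ : ℝ} (hκ : 0 < κ)
    (hκ1 : κ ≤ 1) (hρ : 0 < ρ) (hρ1 : ρ ≤ 1) (hK : 0 < K) (hc2 : 0 < c₂) (hc3 : 0 < c₃) (hε : ε < 1)
    (hpt : ∀ τ : ℝ, (τ = 1 ∨ τ = -1) → ∀ p ∈ coneII κ ρ,
      g (flip2 1 τ p) ≤ K * (p.2 ^ (ε - 2) * |Real.log p.2| ^ d))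
    (hi : IntegrableOn g (ball 0 ρ))
    (hball : ∀ r : ℝ, 0 < r → r < c₃ → (∫ p in disk2 r, g p) ≤ c₂ * r ^ ε * |Real.log r| ^ d) :
    ∃ C > (0:ℝ), ∃ r₂ > (0:ℝ), ∀ r, 0 < r → r < r₂ →
      ∫ p in ball 0 ρ ∩ {p | |p.1| < r}, g p ≤ C * (r ^ ε * |Real.log r| ^ d) := by
  have h1 : (1:ℝ) = 1 ∨ (1:ℝ) = -1 := Or.inl rfl
  have h2 : (-1:ℝ) = 1 ∨ (-1:ℝ) = -1 := Or.inr rfl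
  have hε' : 0 < 1 - ε := by linarith
  refine ⟨c₂ * (2 / κ) ^ ε + 2 * K / (1 - ε) + 2 * K / (1 - ε), by positivity,
    min (c₃ * κ / 2) (ρ * κ / 2), by positivity, fun r hr hr2 => ?_⟩
  have k1 : r < c₃ * κ / 2 := hr2.trans_le (min_le_left _ _)
  have k2 : r < ρ * κ / 2 := hr2.trans_le (min_le_right _ _)
  have k3 : 2 * r / κ < c₃ := by rw [div_lt_iff₀ hκ]; linarith
  have k4 : 2 * r / κ < ρ := by rw [div_lt_iff₀ hκ]; linarith
  have k5 : r ≤ r / κ := by rw [le_div_iff₀ hκ]; nlinarith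
  have k6 : r / κ ≤ 2 * r / κ := by gcongr; linarith
  have hrρ : r < ρ := by linarith
  set L := |Real.log r| ^ d with hL
  have hL0 : 0 ≤ L := by positivity
  set D : Set (ℝ × ℝ) := Ioo (-r) r ×ˢ Ioo (r / κ) ρ with hD
  have mD : MeasurableSet D := measurableSet_Ioo.prod measurableSet_Ioo
  have hDc : ∀ p ∈ D, p ∈ coneII κ ρ := by
    rintro p ⟨p1, p2, p3⟩
    have : |p.1| < r := abs_lt.2 p1
    rw [div_lt_iff₀ hκ] at p2
    refine ⟨?_, p3, by linarith⟩
    by_contra! hc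
    nlinarith
  obtain ⟨ri, rb⟩ := rect_int (ρ := ρ) hε hr k5 hK.le hL0
  have hlog : ∀ y, r ≤ y → y ≤ 1 → |Real.log y| ≤ |Real.log r| := by
    intro y hy hy1
    rw [abs_of_nonpos (Real.log_nonpos (by linarith) hy1), abs_of_nonpos (Real.log_nonpos (by linarith) (by linarith))]
    linarith [Real.log_le_log hr hy]
  have sub : ∀ τ : ℝ, (τ = 1 ∨ τ = -1) → flip2 1 τ ⁻¹' D ⊆ ball 0 ρ := by
    intro τ hτ
    rw [← ball_flip h1 hτ ρ]
    exact preimage_mono fun p hp => coneII_ball hκ1 le_rfl (hDc p hp)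
  have mT : ∀ τ : ℝ, MeasurableSet (flip2 1 τ ⁻¹' D) := fun τ => (flip2_cont _ _).measurable mD
  have hT : ∀ τ : ℝ, (τ = 1 ∨ τ = -1) → ∫ p in flip2 1 τ ⁻¹' D, g p ≤ 2 * K / (1 - ε) * (r ^ ε * L) := by
    intro τ hτ
    rw [setInt_flip h1 hτ]
    refine le_trans (setIntegral_mono_on ?_ ri mD ?_) rb
    · have := intOn_flip h1 hτ (hi.mono_set (sub τ hτ))
      rwa [← preimage_comp, show flip2 1 τ ∘ flip2 1 τ = id by ext1 p; exact flip2_flip2 h1 hτ p,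
        preimage_id] at this
    · intro p hp
      refine (hpt τ hτ p (hDc p hp)).trans ?_
      have hp0 : 0 < p.2 := (hDc p hp).1
      have hrp : r ≤ p.2 := k5.trans hp.2.1.le
      have := hlog _ hrp (hp.2.2.le.trans hρ1)
      rw [hL]
      gcongr
  have hdisk : ∫ p in disk2 (2 * r / κ), g p ≤ c₂ * (2 / κ) ^ ε * (r ^ ε * L) := by
    have hq : 0 < 2 * r / κ := by positivity
    refine (hball _ hq k3).trans ?_
    have e : (2 * r / κ) ^ ε = (2 / κ) ^ ε * r ^ ε := by
      rw [← Real.mul_rpow (by positivity) hr.le]; congr 1; ring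
    have := hlog _ (k5.trans k6) (k4.le.trans hρ1)
    rw [e, ← mul_assoc, ← mul_assoc, hL]
    gcongr
  have sdisk : disk2 (2 * r / κ) ⊆ ball 0 ρ := disk2_ball (by positivity) k4.le
  have cover : ball 0 ρ ∩ {p : ℝ × ℝ | |p.1| < r} ⊆
      disk2 (2 * r / κ) ∪ (flip2 1 1 ⁻¹' D ∪ flip2 1 (-1) ⁻¹' D) := by
    rintro p ⟨hp, hp1⟩
    have hp1 : |p.1| < r := hp1
    rw [mem_ball_zero_iff] at hp
    have a2 : |p.2| ≤ ‖p‖ := norm_snd_le p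
    rcases le_or_gt |p.2| (r / κ) with h | h
    · left
      show p.1 ^ 2 + p.2 ^ 2 < (2 * r / κ) ^ 2
      have e : 2 * r / κ = 2 * (r / κ) := by ring
      rw [e, ← sq_abs p.1, ← sq_abs p.2]
      have q : 0 < r / κ := by positivity
      have := abs_nonneg p.1
      have := abs_nonneg p.2
      nlinarith
    · right
      have hp1 := abs_lt.1 hp1
      rcases abs_cases p.2 with ⟨e, _⟩ | ⟨e, _⟩
      · left
        rw [e] at h a2
        refine ⟨⟨?_, ?_⟩, ?_, ?_⟩ <;> simp only [flip2, one_mul] <;> linarith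
      · right
        rw [e] at h a2
        refine ⟨⟨?_, ?_⟩, ?_, ?_⟩ <;> simp only [flip2, one_mul, neg_mul] <;> linarith
  have i1 := hi.mono_set sdisk
  have i2 := hi.mono_set (sub 1 h1)
  have i3 := hi.mono_set (sub (-1) h2)
  calc ∫ p in ball 0 ρ ∩ {p | |p.1| < r}, g p
      ≤ ∫ p in disk2 (2 * r / κ) ∪ (flip2 1 1 ⁻¹' D ∪ flip2 1 (-1) ⁻¹' D), g p :=
        setIntegral_mono_set (i1.union (i2.union i3)) (Eventually.of_forall fun p => hg p) cover.eventuallyLE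
    _ ≤ (∫ p in disk2 (2 * r / κ), g p) + ∫ p in flip2 1 1 ⁻¹' D ∪ flip2 1 (-1) ⁻¹' D, g p :=
        setInt_union_le hg (disk2_meas _) ((mT 1).union (mT (-1))) i1 (i2.union i3)
    _ ≤ (∫ p in disk2 (2 * r / κ), g p) + ((∫ p in flip2 1 1 ⁻¹' D, g p) + ∫ p in flip2 1 (-1) ⁻¹' D, g p) := by
        gcongr
        exact setInt_union_le hg (mT 1) (mT (-1)) i2 i3
    _ ≤ _ := by
        have := hT 1 h1
        have := hT (-1) h2
        linarith

theorem int_Rv {g : ℝ × ℝ → ℝ} {v : ℝ × ℝ} (hv : nrm2 v = 1) {U : Set (ℝ × ℝ)} (hU : U ∈ 𝓝 0)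
    (hi : IntegrableOn g U) : ∃ R > (0:ℝ), IntegrableOn (fun p => g (Rv v p)) (ball 0 R) := by
  have h0 : Rv v 0 = 0 := by ext <;> simp [Rv]
  have h1 : Rv v ⁻¹' U ∈ 𝓝 0 := (Rv_cont v).continuousAt.preimage_mem_nhds (by rwa [h0])
  obtain ⟨R, hR, hs⟩ := Metric.mem_nhds_iff.1 h1
  exact ⟨R, hR, (((mp_Rv hv).integrableOn_comp_preimage (emb_Rv hv)).2 hi).mono_set hs⟩

theorem disk2_Rv {v : ℝ × ℝ} (hv : nrm2 v = 1) (r : ℝ) : Rv v ⁻¹' disk2 r = disk2 r := by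
  ext p; simp only [disk2, mem_preimage, mem_setOf_eq, Rv_sq hv]

theorem strip_upper {n : ℕ} (f : Fin n → ℝ × ℝ → ℝ) (γ : Fin n → ℝ) (E : Set (ℝ × ℝ))
    (hsf : StandardForm n f γ E) (ε : ℝ) (d : ℕ) (hball : BallBound (stdFun n f γ E) ε d) (hε : ε < 1 / 2)
    {v : ℝ × ℝ} (hv : nrm2 v = 1) (hperp : ¬ ExceptionalDir n f E (perp2 v)) :
    ∃ R > (0:ℝ), R ≤ 1 ∧ IntegrableOn (fun p => stdFun n f γ E (Rv v p)) (ball 0 R) ∧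
    ∃ C > (0:ℝ), ∃ r₂ > (0:ℝ), ∀ r, 0 < r → r < r₂ →
      ∫ p in ball 0 R ∩ {p | |p.1| < r}, stdFun n f γ E (Rv v p) ≤ C * (r ^ ε * |Real.log r| ^ d) := by
  have h1 : (1:ℝ) = 1 ∨ (1:ℝ) = -1 := Or.inl rfl
  have h2 : (-1:ℝ) = 1 ∨ (-1:ℝ) = -1 := Or.inr rfl
  obtain ⟨U, hU, hi⟩ := hsf.integ
  obtain ⟨V, hV, hf⟩ := hsf.analytic
  have hf0 : ∀ i, AnalyticAt ℝ (f i) 0 := fun i => hf i 0 (mem_of_mem_nhds hV)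
  obtain ⟨R, hR, hiR⟩ := int_Rv hv hU hi
  obtain ⟨κ, hκ, hκ1, HF⟩ := frame_all f E hf0 hv hperp
  obtain ⟨-, -, c₁, -, c₂, hc2, c₃, hc3, hb⟩ := hball
  have hg0 : ∀ p, 0 ≤ stdFun n f γ E (Rv v p) := fun p => stdFun_nonneg n f γ E _
  have hb' : ∀ r : ℝ, 0 < r → r < c₃ →
      (∫ p in disk2 r, stdFun n f γ E (Rv v p)) ≤ c₂ * r ^ ε * |Real.log r| ^ d := by
    intro r hr hr3
    have := setInt_Rv hv (disk2 r) (stdFun n f γ E)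
    rw [disk2_Rv hv] at this
    rw [this]; exact (hb r hr hr3).2
  obtain ⟨m, c0, C0, hc0, hC0, ha⟩ := cone_alt f γ E (HF _ _ h1 h1)
  obtain ⟨m', c0', C0', hc0', hC0', ha'⟩ := cone_alt f γ E (HF _ _ h1 h2)
  obtain ⟨K, hK, H⟩ := cone_pt (g := fun p => stdFun n f γ E (Rv v p)) hg0 hκ hκ1 h1 hc0 hC0 hc2 ha hiR hb'
  obtain ⟨K', hK', H'⟩ := cone_pt (g := fun p => stdFun n f γ E (Rv v p)) hg0 hκ hκ1 h2 hc0' hC0' hc2 ha' hiR hb'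
  set ρ := min (min κ (c₃ / 2)) (min (R / 2) (1 / 2)) with hρd
  have hρ : 0 < ρ := by positivity
  have q1 : ρ ≤ κ := (min_le_left _ _).trans (min_le_left _ _)
  have q2 : ρ ≤ c₃ / 2 := (min_le_left _ _).trans (min_le_right _ _)
  have q3 : ρ ≤ R / 2 := (min_le_right _ _).trans (min_le_left _ _)
  have q4 : ρ ≤ 1 / 2 := (min_le_right _ _).trans (min_le_right _ _)
  have hi' : IntegrableOn (fun p => stdFun n f γ E (Rv v p)) (ball 0 ρ) :=
    hiR.mono_set (ball_subset_ball (by linarith))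
  refine ⟨ρ, hρ, by linarith, hi', ?_⟩
  refine strip_abs (g := fun p => stdFun n f γ E (Rv v p)) hg0 (K := max K K') hκ hκ1 hρ (by linarith)
    (lt_max_of_lt_left hK) hc2 hc3 (by linarith) ?_ hi' hb'
  intro τ hτ p hp
  have hp' : p ∈ coneII κ κ := coneII_mono le_rfl q1 hp
  have hp0 : 0 < p.2 := hp.1
  have hpρ : p.2 < ρ := hp.2.1
  rcases hτ with rfl | rfl
  · refine (H p hp' (by linarith) (by linarith) (by linarith)).trans ?_
    gcongr; exact le_max_left _ _
  · refine (H' p hp' (by linarith) (by linarith) (by linarith)).trans ?_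
    gcongr; exact le_max_right _ _

theorem exp_cmp {a b x y r₀ : ℝ} {i j : ℕ} (ha : 0 < a) (hb : 0 < b) (hj : j ≤ 1) (hr0 : 0 < r₀)
    (h : ∀ r, 0 < r → r < r₀ → a * r ^ x * |Real.log r| ^ i ≤ b * r ^ y * |Real.log r| ^ j) : y ≤ x := by
  by_contra! hxy
  have hη : 0 < y - x := by linarith
  have t1 : Tendsto (fun r : ℝ => r ^ (y - x)) (𝓝[>] 0) (𝓝 0) := by
    have := (Real.continuousAt_rpow_const 0 (y - x) (Or.inr hη.le)).tendsto
    rw [Real.zero_rpow hη.ne'] at this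
    exact this.mono_left nhdsWithin_le_nhds
  have t2 := (tendsto_log_mul_rpow_nhdsGT_zero hη).norm
  have t3 := (t1.add t2).const_mul b
  simp only [norm_zero, add_zero, mul_zero] at t3
  obtain ⟨r1, hr1, H⟩ := ev_Ioo (t3.eventually (eventually_lt_nhds ha))
  obtain ⟨r, hr, hrlt⟩ := exists_between (show 0 < min (min r₀ r1) (Real.exp (-1)) by positivity)
  have k1 : r < r₀ := hrlt.trans_le ((min_le_left _ _).trans (min_le_left _ _))
  have k2 : r < r1 := hrlt.trans_le ((min_le_left _ _).trans (min_le_right _ _))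
  have k3 : r < Real.exp (-1) := hrlt.trans_le (min_le_right _ _)
  have hl : 1 ≤ |Real.log r| := by
    have : Real.log r < -1 := by rw [Real.log_lt_iff_lt_exp hr]; exact k3
    rw [abs_of_neg (by linarith)]; linarith
  have hx : 0 < r ^ x := Real.rpow_pos_of_pos hr _
  have hyx : 0 < r ^ (y - x) := Real.rpow_pos_of_pos hr _
  have e : r ^ y = r ^ x * r ^ (y - x) := by rw [← Real.rpow_add hr]; congr 1; ring
  have hlj : |Real.log r| ^ j ≤ 1 + |Real.log r| := by
    interval_cases j
    · simp
    · simp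
  have h3 := H r hr k2
  rw [Real.norm_eq_abs, abs_mul, abs_of_pos hyx] at h3
  have h4 : a * r ^ x ≤ (b * (r ^ (y - x) * (1 + |Real.log r|))) * r ^ x := by
    calc a * r ^ x ≤ a * r ^ x * |Real.log r| ^ i := le_mul_of_one_le_right (by positivity) (one_le_pow₀ hl)
      _ ≤ b * r ^ y * |Real.log r| ^ j := h r hr k1
      _ ≤ b * r ^ y * (1 + |Real.log r|) := by gcongr
      _ = _ := by rw [e]; ring
  have h5 := le_of_mul_le_mul_right h4 hx
  nlinarith

theorem strip2_Rv {v : ℝ × ℝ} (hv : nrm2 v = 1) (r c : ℝ) :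
    Rv v ⁻¹' strip2 v r c = {p : ℝ × ℝ | |p.1| < r ∧ |p.2| < c} := by
  ext p
  have e := Rv_Rv hv p
  have e1 : dot2 (Rv v p) v = p.1 := by conv_rhs => rw [← e]
                                        rfl
  have e2 : dot2 (Rv v p) (perp2 v) = p.2 := by
    conv_rhs => rw [← e]
    simp only [dot2, perp2, Rv]; ring
  simp only [strip2, mem_preimage, mem_setOf_eq, e1, e2]

theorem delta_eq {g : ℝ × ℝ → ℝ} (hg : ∀ p, 0 ≤ g p) {v : ℝ × ℝ} (hv : nrm2 v = 1) {ε δ : ℝ} {d e : ℕ}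
    (hball : BallBound g ε d) (hstrip : StripBound g v δ e) {R C r₂ : ℝ} (hR : 0 < R) (hC : 0 < C) (hr2 : 0 < r₂)
    (hi : IntegrableOn (fun p => g (Rv v p)) (ball 0 R))
    (H : ∀ r, 0 < r → r < r₂ →
      ∫ p in ball 0 R ∩ {p | |p.1| < r}, g (Rv v p) ≤ C * (r ^ ε * |Real.log r| ^ d)) : δ = ε := by
  obtain ⟨-, hd, c₁, hc1, c₂, hc2, c₃, hc3, hb⟩ := hball
  obtain ⟨-, he, cv, hcv, hs⟩ := hstrip
  have hc : 0 < min cv R / 2 := by positivity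
  have hccv : min cv R / 2 < cv := by linarith [min_le_left cv R]
  have hcR : min cv R / 2 < R := by linarith [min_le_right cv R]
  obtain ⟨a, ha, b, hb', hs⟩ := hs _ hc hccv
  set c := min cv R / 2 with hcd
  have hsub : ∀ r, r < c → {p : ℝ × ℝ | |p.1| < r ∧ |p.2| < c} ⊆ ball 0 R := by
    rintro r hr p ⟨p1, p2⟩
    rw [mem_ball_zero_iff, Prod.norm_def]
    apply max_lt
    · show |p.1| < R
      linarith
    · show |p.2| < R
      linarith
  have hst : ∀ r, ∫ p in strip2 v r c, g p = ∫ p in {p : ℝ × ℝ | |p.1| < r ∧ |p.2| < c}, g (Rv v p) := by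
    intro r
    rw [← strip2_Rv hv]; exact (setInt_Rv hv _ g).symm
  apply le_antisymm
  · refine exp_cmp (i := d) (r₀ := min c c₃) hc1 hb' he (by positivity) fun r hr hrl => ?_
    have l1 : r < c := hrl.trans_le (min_le_left _ _)
    refine (hb r hr (hrl.trans_le (min_le_right _ _))).1.trans (le_trans ?_ (hs r hr l1).2)
    rw [hst]
    have := setInt_Rv hv (disk2 r) g
    rw [disk2_Rv hv] at this
    rw [← this]
    refine setIntegral_mono_set (hi.mono_set (hsub r l1)) (Eventually.of_forall fun p => hg _)
      (HasSubset.Subset.eventuallyLE ?_)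
    intro p (hp : p.1 ^ 2 + p.2 ^ 2 < r ^ 2)
    exact ⟨abs_lt_of_sq_lt_sq (by nlinarith [sq_nonneg p.2]) hr.le,
      (abs_lt_of_sq_lt_sq (by nlinarith [sq_nonneg p.1]) hr.le).trans l1⟩
  · refine exp_cmp (i := e) (r₀ := min c r₂) ha hC hd (by positivity) fun r hr hrl => ?_
    have l1 : r < c := hrl.trans_le (min_le_left _ _)
    refine (hs r hr l1).1.trans ?_
    rw [hst, mul_assoc]
    refine le_trans ?_ (H r hr (hrl.trans_le (min_le_right _ _)))
    refine setIntegral_mono_set (hi.mono_set inter_subset_left) (Eventually.of_forall fun p => hg _)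
      (HasSubset.Subset.eventuallyLE ?_)
    intro p hp
    exact ⟨hsub r l1 hp, hp.1⟩

theorem dyad_pt (y : ℝ) (J : ℕ) : (Real.sqrt (1 + y ^ 2))⁻¹ ≤
    (∑ j ∈ Finset.range (J + 1), if |y| < 2 ^ j then 2 * ((2:ℝ) ^ j)⁻¹ else 0) + ((2:ℝ) ^ J)⁻¹ := by
  induction J with
  | zero =>
    refine (inv_sqrt_le_one y).trans ?_
    simp
    split_ifs <;> norm_num
  | succ J ih =>
    rw [Finset.sum_range_succ]
    set S := ∑ j ∈ Finset.range (J + 1), if |y| < 2 ^ j then 2 * ((2:ℝ) ^ j)⁻¹ else 0 with hS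
    have hS0 : 0 ≤ S := Finset.sum_nonneg fun j _ => by split_ifs <;> positivity
    split_ifs with h
    · refine ih.trans ?_
      rw [pow_succ, mul_inv]
      have : 0 < ((2:ℝ) ^ J)⁻¹ := by positivity
      linarith
    · push Not at h
      have hp : (0:ℝ) < 2 ^ (J + 1) := by positivity
      have : (2:ℝ) ^ (J + 1) ≤ Real.sqrt (1 + y ^ 2) := by
        refine h.trans ?_
        rw [← Real.sqrt_sq_eq_abs]
        exact Real.sqrt_le_sqrt (by linarith)
      have : (Real.sqrt (1 + y ^ 2))⁻¹ ≤ ((2:ℝ) ^ (J + 1))⁻¹ := by gcongr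
      linarith

theorem dyadic_bound {g : ℝ × ℝ → ℝ} (hg : ∀ p, 0 ≤ g p) {ε R C r₂ : ℝ} {d : ℕ} (hε0 : 0 < ε) (hε : ε < 1)
    (hC : 0 < C) (hr2 : 0 < r₂) (hi : IntegrableOn g (ball 0 R))
    (H : ∀ r, 0 < r → r < r₂ → ∫ p in ball 0 R ∩ {p | |p.1| < r}, g p ≤ C * (r ^ ε * |Real.log r| ^ d)) :
    ∃ C' > (0:ℝ), ∀ s : ℝ, 3 ≤ |s| → ∫ p in ball 0 R, wtI g s p ≤ C' * (|s| ^ (-ε) * (Real.log |s|) ^ d) := by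
  set I := ∫ p in ball 0 R, g p with hI
  have hI0 : 0 ≤ I := integral_nonneg fun p => hg p
  set q : ℝ := 2 ^ (ε - 1) with hq
  have hq0 : 0 < q := Real.rpow_pos_of_pos (by norm_num) _
  have hq1 : q < 1 := Real.rpow_lt_one_of_one_lt_of_neg (by norm_num) (by linarith)
  set t := min r₂ 1 with ht
  have ht0 : 0 < t := by positivity
  have hq2 : 0 < (1 - q)⁻¹ := inv_pos.2 (by linarith)
  refine ⟨I * (2 / t) ^ ε + (2 * C * (1 - q)⁻¹ + 4 / t * I), by positivity, fun s hs => ?_⟩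
  set z := |s| with hz
  have hz0 : 0 < z := by linarith
  have hlz : 1 ≤ Real.log z := by
    rw [Real.le_log_iff_exp_le hz0]; linarith [Real.exp_one_lt_d9]
  have hLd : 1 ≤ (Real.log z) ^ d := one_le_pow₀ hlz
  have hze : 0 < z ^ (-ε) := Real.rpow_pos_of_pos hz0 _
  have hWI : ∫ p in ball 0 R, wtI g s p ≤ I := by
    refine integral_mono (wtI_integrable hi s) hi fun p => ?_
    exact mul_le_of_le_one_right (hg p) (inv_sqrt_le_one _)
  have hA : z ^ (-ε) ≤ z ^ (-ε) * (Real.log z) ^ d := le_mul_of_one_le_right hze.le hLd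
  have hA0 : 0 ≤ z ^ (-ε) * (Real.log z) ^ d := hze.le.trans hA
  rcases lt_or_ge (z * t / 2) 1 with hy | hy
  · have k : z < 2 / t := by rw [lt_div_iff₀ ht0]; linarith
    have k2 : 1 ≤ (2 / t) ^ ε * z ^ (-ε) := by
      rw [Real.rpow_neg hz0.le, ← div_eq_mul_inv, one_le_div (Real.rpow_pos_of_pos hz0 _)]
      exact Real.rpow_le_rpow hz0.le k.le hε0.le
    calc _ ≤ I := hWI
      _ ≤ I * ((2 / t) ^ ε * z ^ (-ε)) := le_mul_of_one_le_right hI0 k2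
      _ ≤ I * ((2 / t) ^ ε * (z ^ (-ε) * (Real.log z) ^ d)) := by gcongr
      _ = (I * (2 / t) ^ ε + 0) * (z ^ (-ε) * (Real.log z) ^ d) := by ring
      _ ≤ _ := by gcongr; positivity
  · obtain ⟨J, hJ1, hJ2⟩ := exists_nat_pow_near hy (by norm_num : (1:ℝ) < 2)
    have hJ3 : ((2:ℝ) ^ J)⁻¹ ≤ 4 / t * z ^ (-ε) := by
      have : z * t / 4 ≤ 2 ^ J := by rw [pow_succ] at hJ2; linarith
      calc ((2:ℝ) ^ J)⁻¹ ≤ (z * t / 4)⁻¹ := by gcongr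
        _ = 4 / t * z ^ (-1:ℝ) := by rw [Real.rpow_neg_one]; field_simp
        _ ≤ 4 / t * z ^ (-ε) := by
          gcongr <;> linarith
    have hG : ∀ j ≤ J, ∫ p in ball 0 R ∩ {p | |p.1| < 2 ^ j / z}, g p
        ≤ C * (((2:ℝ) ^ ε) ^ j * (z ^ (-ε) * (Real.log z) ^ d)) := by
      intro j hj
      have j0 : (1:ℝ) ≤ 2 ^ j := one_le_pow₀ (by norm_num)
      have j1 : (2:ℝ) ^ j ≤ 2 ^ J := pow_le_pow_right₀ (by norm_num) hj
      have j2 : (2:ℝ) ^ j / z ≤ t / 2 := by rw [div_le_iff₀ hz0]; linarith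
      have j3 : 0 < (2:ℝ) ^ j / z := by positivity
      have j4 : t ≤ r₂ := min_le_left _ _
      have j5 : t ≤ 1 := min_le_right _ _
      refine (H _ j3 (by linarith)).trans ?_
      have e1 : ((2:ℝ) ^ j / z) ^ ε = ((2:ℝ) ^ ε) ^ j * z ^ (-ε) := by
        rw [Real.div_rpow (by positivity) hz0.le, Real.rpow_neg hz0.le, div_eq_mul_inv,
          Real.rpow_pow_comm (by norm_num)]
      have e2 : |Real.log ((2:ℝ) ^ j / z)| ≤ Real.log z := by
        rw [abs_of_nonpos (Real.log_nonpos j3.le (by linarith)), Real.log_div (by positivity) hz0.ne']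
        linarith [Real.log_nonneg j0]
      rw [e1, mul_assoc]
      gcongr
    have hpt : ∀ p, wtI g s p ≤ (∑ j ∈ Finset.range (J + 1),
        2 * ((2:ℝ) ^ j)⁻¹ * ({p : ℝ × ℝ | |p.1| < 2 ^ j / z}.indicator g p)) + ((2:ℝ) ^ J)⁻¹ * g p := by
      intro p
      have := mul_le_mul_of_nonneg_left (dyad_pt (s * p.1) J) (hg p)
      refine this.trans (le_of_eq ?_)
      rw [mul_add, Finset.mul_sum, mul_comm (g p) (((2:ℝ) ^ J)⁻¹)]
      congr 1
      apply Finset.sum_congr rfl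
      intro j _
      have e : (|s * p.1| < 2 ^ j) ↔ p ∈ {p : ℝ × ℝ | |p.1| < 2 ^ j / z} := by
        rw [mem_setOf_eq, lt_div_iff₀ hz0, abs_mul, mul_comm]
      by_cases hm : p ∈ {p : ℝ × ℝ | |p.1| < 2 ^ j / z}
      · rw [indicator_of_mem hm, if_pos (e.2 hm)]; ring
      · rw [indicator_of_notMem hm, if_neg (fun h => hm (e.1 h))]; ring
    have mS : ∀ j : ℕ, MeasurableSet {p : ℝ × ℝ | |p.1| < 2 ^ j / z} := fun j =>
      (isOpen_lt (f := fun p : ℝ × ℝ => |p.1|) (g := fun _ => (2:ℝ) ^ j / z) (by fun_prop) (by fun_prop)).measurableSet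
    have i1 : ∀ j ∈ Finset.range (J + 1), IntegrableOn (fun p => 2 * ((2:ℝ) ^ j)⁻¹ *
        ({p : ℝ × ℝ | |p.1| < 2 ^ j / z}.indicator g p)) (ball 0 R) := fun j _ =>
      (hi.indicator (mS j)).const_mul _
    have hsum : ∑ j ∈ Finset.range (J + 1), q ^ j ≤ (1 - q)⁻¹ := by
      rw [← tsum_geometric_of_lt_one hq0.le hq1]
      exact (summable_geometric_of_lt_one hq0.le hq1).sum_le_tsum _ (fun j _ => by positivity)
    calc ∫ p in ball 0 R, wtI g s p ≤ ∫ p in ball 0 R, ((∑ j ∈ Finset.range (J + 1),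
        2 * ((2:ℝ) ^ j)⁻¹ * ({p : ℝ × ℝ | |p.1| < 2 ^ j / z}.indicator g p)) + ((2:ℝ) ^ J)⁻¹ * g p) :=
          integral_mono (wtI_integrable hi s) ((integrable_finset_sum _ i1).add (hi.const_mul _)) hpt
      _ = (∑ j ∈ Finset.range (J + 1), 2 * ((2:ℝ) ^ j)⁻¹ *
          ∫ p in ball 0 R ∩ {p | |p.1| < 2 ^ j / z}, g p) + ((2:ℝ) ^ J)⁻¹ * I := by
          rw [integral_add (integrable_finset_sum _ i1) (hi.const_mul _), integral_finset_sum _ i1,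
            integral_const_mul]
          congr 1
          apply Finset.sum_congr rfl
          intro j _
          rw [integral_const_mul, setIntegral_indicator (mS j)]
      _ ≤ (∑ j ∈ Finset.range (J + 1), 2 * C * (z ^ (-ε) * (Real.log z) ^ d) * q ^ j)
          + 4 / t * z ^ (-ε) * I := by
          refine add_le_add (Finset.sum_le_sum fun j hj => ?_) (mul_le_mul_of_nonneg_right hJ3 hI0)
          have := hG j (by simpa [Nat.lt_succ_iff] using hj)
          calc _ ≤ 2 * ((2:ℝ) ^ j)⁻¹ * (C * (((2:ℝ) ^ ε) ^ j * (z ^ (-ε) * (Real.log z) ^ d))) :=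
                mul_le_mul_of_nonneg_left this (by positivity)
            _ = 2 * C * (z ^ (-ε) * (Real.log z) ^ d) * (((2:ℝ) ^ j)⁻¹ * ((2:ℝ) ^ ε) ^ j) := by ring
            _ = _ := by
              congr 1
              rw [hq, Real.rpow_sub (by norm_num), Real.rpow_one, div_pow]; field_simp
      _ = 2 * C * (z ^ (-ε) * (Real.log z) ^ d) * (∑ j ∈ Finset.range (J + 1), q ^ j)
          + 4 / t * z ^ (-ε) * I := by rw [Finset.mul_sum]
      _ ≤ 2 * C * (z ^ (-ε) * (Real.log z) ^ d) * (1 - q)⁻¹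
          + 4 / t * (z ^ (-ε) * (Real.log z) ^ d) * I := by gcongr
      _ = (0 + (2 * C * (1 - q)⁻¹ + 4 / t * I)) * (z ^ (-ε) * (Real.log z) ^ d) := by ring
      _ ≤ _ := by gcongr; positivity

theorem norm_le_nrm2 (q : ℝ × ℝ) : ‖q‖ ≤ nrm2 q := by
  unfold nrm2
  rw [Prod.norm_def]
  refine max_le ?_ ?_
  · rw [Real.norm_eq_abs]; exact Real.abs_le_sqrt (by nlinarith [sq_nonneg q.2])
  · rw [Real.norm_eq_abs]; exact Real.abs_le_sqrt (by nlinarith [sq_nonneg q.1])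

theorem cexp_one (x : ℝ) : ‖Complex.exp (Complex.I * (x : ℂ))‖ = 1 := by
  rw [mul_comm]; exact Complex.norm_exp_ofReal_mul_I x

theorem cutoff_tame {φ α : ℝ × ℝ → ℝ} {A : ℝ} (hA : 0 < A) (hα : AlphaBound α A) (hφ : ContDiff ℝ (⊤ : ℕ∞) φ)
    (hc : HasCompactSupport φ) {v : ℝ × ℝ} (hv : nrm2 v = 1) (c : ℝ × ℝ) {r : ℝ} (hr : 0 < r)
    (hsupp : ∀ q, r ≤ ‖q‖ → c + Rv v q ∉ tsupport φ) {H : ℝ} (hH : 0 < H) :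
    ∃ M, ∀ w : ℝ, |w| ≤ H → Tame M r (fun q => ((φ (c + Rv v q) * α (Rv v q) : ℝ) : ℂ) *
      Complex.exp (Complex.I * ((w * q.2 : ℝ) : ℂ))) := by
  obtain ⟨B, hB⟩ := hc.exists_bound_of_continuous hφ.continuous
  obtain ⟨B', hB'⟩ := (hc.fderiv (𝕜 := ℝ)).exists_bound_of_continuous
    (hφ.continuous_fderiv (by simp))
  have hB0 : 0 ≤ B := (norm_nonneg _).trans (hB 0)
  have hB0' : 0 ≤ B' := (norm_nonneg _).trans (hB' 0)
  obtain ⟨hα1, hα2, hα3⟩ := hα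
  obtain ⟨L, hL1, hL2, hL3⟩ := Ph_fderiv hv (Or.inl rfl : (1:ℝ) = 1 ∨ (1:ℝ) = -1) (Or.inl rfl : (1:ℝ) = 1 ∨ (1:ℝ) = -1)
  have hPh : Ph v 1 1 = Rv v := by
    funext q; simp [Ph, flip2]
  rw [hPh] at hL3
  have hz : ∀ q, r ≤ ‖q‖ → φ (c + Rv v q) = 0 := fun q hq => image_eq_zero_of_notMem_tsupport (hsupp q hq)
  refine ⟨B * A + B * A * H * r + 2 * B * A + 2 * A * B' * r, fun w hw => ⟨by positivity, fun q => ?_, fun q hq => ?_, fun q hq => ?_⟩⟩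
  · rw [norm_mul, cexp_one, mul_one, Complex.norm_real, norm_mul]
    have : ‖φ (c + Rv v q)‖ * ‖α (Rv v q)‖ ≤ B * A :=
      mul_le_mul (hB _) (hα2 _) (norm_nonneg _) hB0
    have : 0 ≤ B * A * H * r + 2 * B * A + 2 * A * B' * r := by positivity
    linarith
  · rcases lt_or_ge ‖q‖ r with hqr | hqr
    · have hRq : Rv v q ≠ 0 := by
        intro h
        apply hq
        rw [← Rv_Rv hv q, h]; simp [Rv]
      have dφ : HasFDerivAt (fun q => φ (c + Rv v q)) ((fderiv ℝ φ (c + Rv v q)).comp L) q := by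
        have h1 := (hφ.differentiable (by simp) (c + Rv v q)).hasFDerivAt
        exact h1.comp q ((hL3 q).const_add c)
      have dα : HasFDerivAt (fun q => α (Rv v q)) ((fderiv ℝ α (Rv v q)).comp L) q := by
        have h1 : DifferentiableAt ℝ α (Rv v q) :=
          (hα1.contDiffAt (isOpen_compl_singleton.mem_nhds hRq)).differentiableAt (by simp)
        exact h1.hasFDerivAt.comp q (hL3 q)
      have dF := (dφ.mul dα)
      have dFc := Complex.ofRealCLM.hasFDerivAt.comp q dF
      have dw : HasFDerivAt (fun q : ℝ × ℝ => w * q.2) (w • ContinuousLinearMap.snd ℝ ℝ ℝ) q :=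
        (hasFDerivAt_snd).const_mul w
      have dwc := Complex.ofRealCLM.hasFDerivAt.comp q dw
      have dE := (dwc.const_mul Complex.I).cexp
      have dT := dFc.mul dE
      refine ⟨_, dT, ?_⟩
      have hnR : ‖q‖ ≤ nrm2 (Rv v q) := by
        have : nrm2 (Rv v q) = nrm2 q := by unfold nrm2; rw [Rv_sq hv]
        rw [this]; exact norm_le_nrm2 q
      have hq0 : 0 < ‖q‖ := norm_pos_iff.2 hq
      have n1 : ‖(fderiv ℝ φ (c + Rv v q)).comp L‖ ≤ B' * 2 :=
        (ContinuousLinearMap.opNorm_comp_le _ _).trans (mul_le_mul (hB' _) hL1 (norm_nonneg _) hB0')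
      have n2 : ‖(fderiv ℝ α (Rv v q)).comp L‖ ≤ A * ‖q‖⁻¹ * 2 := by
        refine (ContinuousLinearMap.opNorm_comp_le _ _).trans (mul_le_mul ?_ hL1 (norm_nonneg _) (by positivity))
        refine (hα3 _ hRq).trans ?_
        gcongr
      have n3 : ‖Complex.ofRealCLM.comp (φ (c + Rv v q) • (fderiv ℝ α (Rv v q)).comp L +
          α (Rv v q) • (fderiv ℝ φ (c + Rv v q)).comp L)‖ ≤ B * (A * ‖q‖⁻¹ * 2) + A * (B' * 2) := by
        refine (ContinuousLinearMap.opNorm_comp_le _ _).trans ?_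
        rw [Complex.ofRealCLM_norm, one_mul]
        refine (norm_add_le _ _).trans (add_le_add ?_ ?_)
        · rw [norm_smul]; exact mul_le_mul (hB _) n2 (norm_nonneg _) hB0
        · rw [norm_smul]; exact mul_le_mul (hα2 _) n1 (norm_nonneg _) hA.le
      have n4 : ‖Complex.ofRealCLM.comp (w • ContinuousLinearMap.snd ℝ ℝ ℝ)‖ ≤ H := by
        refine (ContinuousLinearMap.opNorm_comp_le _ _).trans ?_
        rw [Complex.ofRealCLM_norm, one_mul, norm_smul]
        calc ‖w‖ * ‖ContinuousLinearMap.snd ℝ ℝ ℝ‖ ≤ H * 1 :=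
            mul_le_mul hw (ContinuousLinearMap.norm_snd_le ..) (norm_nonneg _) hH.le
          _ = H := mul_one _
      have n5 : ‖((φ (c + Rv v q) * α (Rv v q) : ℝ) : ℂ)‖ ≤ B * A := by
        rw [Complex.norm_real, norm_mul]
        exact mul_le_mul (hB _) (hα2 _) (norm_nonneg _) hB0
      have key : ∀ (a e : ℂ) (X Y : ℝ × ℝ →L[ℝ] ℂ) (b x y : ℝ), ‖a‖ ≤ b → ‖e‖ = 1 → ‖X‖ ≤ x → ‖Y‖ ≤ y →
          ‖a • (e • (Complex.I • Y)) + e • X‖ ≤ b * y + x := by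
        intro a e X Y b x y ha he hX hY
        refine (norm_add_le _ _).trans (add_le_add ?_ ?_)
        · rw [norm_smul, norm_smul, norm_smul, he, Complex.norm_I, one_mul, one_mul]
          exact mul_le_mul ha hY (norm_nonneg _) ((norm_nonneg _).trans ha)
        · rw [norm_smul, he, one_mul]; exact hX
      have := key _ _ _ _ _ _ _ n5 (cexp_one (w * q.2)) n3 n4
      calc _ ≤ (B * A * H + (B * (A * ‖q‖⁻¹ * 2) + A * (B' * 2))) * ‖q‖ :=
            mul_le_mul_of_nonneg_right this (norm_nonneg _)
        _ = B * A * H * ‖q‖ + 2 * B * A + 2 * A * B' * ‖q‖ := by field_simp; ring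
        _ ≤ B * A * H * r + 2 * B * A + 2 * A * B' * r := by gcongr
        _ ≤ _ := by have := mul_nonneg hB0 hA.le; linarith
    · refine ⟨0, ?_, by simp; positivity⟩
      refine (hasFDerivAt_const (0:ℂ) q).congr_of_eventuallyEq ?_
      have : ∀ᶠ q' in 𝓝 q, c + Rv v q' ∈ (tsupport φ)ᶜ := by
        have hcont : Continuous fun q' => c + Rv v q' := continuous_const.add (Rv_cont v)
        exact hcont.continuousAt.eventually_mem ((isClosed_tsupport φ).isOpen_compl.mem_nhds (hsupp q hqr))
      filter_upwards [this] with q' hq'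
      rw [image_eq_zero_of_notMem_tsupport hq']; simp
  · dsimp only
    rw [hz q hq]; simp

theorem Kphi_eq {φ m α g : ℝ × ℝ → ℝ} {v : ℝ × ℝ} (hv : nrm2 v = 1) (x₀ y₀ : ℝ) {U : Set (ℝ × ℝ)}
    (hm : ∀ p ∈ U, m ((x₀, y₀) + p) = α p * g p) (hsu : ∀ p, p ∉ U → φ ((x₀, y₀) + p) = 0) (t u : ℝ) :
    ‖Kphi φ m t u‖ = ‖∫ q, oscI (fun q => g (Rv v q)) (fun q => ((φ ((x₀, y₀) + Rv v q) * α (Rv v q) : ℝ) : ℂ) *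
      Complex.exp (Complex.I * ((dot2 (t, u) (perp2 v) * q.2 : ℝ) : ℂ))) (dot2 (t, u) v) q‖ := by
  have e1 : Kphi φ m t u = Complex.exp (Complex.I * ((t * x₀ + u * y₀ : ℝ) : ℂ)) *
      ∫ q, oscI (fun q => g (Rv v q)) (fun q => ((φ ((x₀, y₀) + Rv v q) * α (Rv v q) : ℝ) : ℂ) *
      Complex.exp (Complex.I * ((dot2 (t, u) (perp2 v) * q.2 : ℝ) : ℂ))) (dot2 (t, u) v) q := by
    unfold Kphi oscInt
    rw [setIntegral_univ, ← integral_add_left_eq_self _ ((x₀, y₀) : ℝ × ℝ),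
      ← (mp_Rv hv).integral_comp (emb_Rv hv), ← integral_const_mul]
    congr 1
    funext q
    have hpm : φ ((x₀, y₀) + Rv v q) * m ((x₀, y₀) + Rv v q)
        = φ ((x₀, y₀) + Rv v q) * (α (Rv v q) * g (Rv v q)) := by
      by_cases h : Rv v q ∈ U
      · rw [hm _ h]
      · rw [hsu _ h]; simp
    dsimp only
    rw [hpm]
    unfold oscI
    have e2 : Complex.I * ((t : ℂ) * ((((x₀, y₀) + Rv v q).1 : ℝ) : ℂ) + (u : ℂ) * ((((x₀, y₀) + Rv v q).2 : ℝ) : ℂ))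
        = Complex.I * ((t * x₀ + u * y₀ : ℝ) : ℂ) + Complex.I * ((dot2 (t, u) (perp2 v) * q.2 : ℝ) : ℂ)
          + Complex.I * ((dot2 (t, u) v * q.1 : ℝ) : ℂ) := by
      simp only [Rv, dot2, perp2, Prod.fst_add, Prod.snd_add]
      push_cast
      ring
    rw [e2, Complex.exp_add, Complex.exp_add]
    push_cast
    ring
  rw [e1, norm_mul, cexp_one, one_mul]

theorem final_bound {W : ℝ → ℝ} {ε C' I H : ℝ} {d : ℕ} (hε0 : 0 < ε) (hC' : 0 < C') (hI : 0 ≤ I) (hH : 0 < H)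
    (hd : d ≤ 1) (hW1 : ∀ s, W s ≤ I)
    (hW2 : ∀ s : ℝ, 3 ≤ |s| → W s ≤ C' * (|s| ^ (-ε) * (Real.log |s|) ^ d)) :
    ∃ C > (0:ℝ), ∀ s w N : ℝ, |w| ≤ H → |s| ≤ N → N ≤ |s| + |w| →
      W s ≤ C * (2 + N) ^ (-ε) * (Real.log (2 + N)) ^ d := by
  have hl2 : 0 < Real.log 2 := Real.log_pos (by norm_num)
  refine ⟨(I + 1) * (5 + H) ^ ε * (Real.log 2 ^ d)⁻¹ + C' * (5 + H) ^ ε, by positivity, fun s w N hw hN1 hN2 => ?_⟩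
  have hs0 := abs_nonneg s
  have hN0 : 0 < 2 + N := by linarith
  have hlog : Real.log 2 ≤ Real.log (2 + N) := Real.log_le_log (by norm_num) (by linarith)
  have hl0 : 0 < Real.log (2 + N) := hl2.trans_le hlog
  have hNe : 0 < (2 + N) ^ (-ε) := Real.rpow_pos_of_pos hN0 _
  have h5 : 0 < (5 + H) ^ ε := by positivity
  rcases lt_or_ge |s| 3 with h | h
  · have k1 : 1 ≤ (5 + H) ^ ε * (2 + N) ^ (-ε) := by
      rw [Real.rpow_neg hN0.le, ← div_eq_mul_inv, one_le_div (by positivity)]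
      exact Real.rpow_le_rpow hN0.le (by linarith) hε0.le
    have k2 : 1 ≤ (Real.log 2 ^ d)⁻¹ * (Real.log (2 + N)) ^ d := by
      rw [mul_comm, ← div_eq_mul_inv, one_le_div (by positivity)]
      gcongr
    calc W s ≤ (I + 1) * (1 * 1) := by linarith [hW1 s]
      _ ≤ (I + 1) * (((5 + H) ^ ε * (2 + N) ^ (-ε)) * ((Real.log 2 ^ d)⁻¹ * (Real.log (2 + N)) ^ d)) := by gcongr
      _ = ((I + 1) * (5 + H) ^ ε * (Real.log 2 ^ d)⁻¹ + 0) * (2 + N) ^ (-ε) * (Real.log (2 + N)) ^ d := by ring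
      _ ≤ _ := by gcongr; positivity
  · have hsp : 0 < |s| := by linarith
    have k1 : |s| ^ (-ε) ≤ (5 + H) ^ ε * (2 + N) ^ (-ε) := by
      rw [Real.rpow_neg hN0.le, Real.rpow_neg hsp.le, ← div_eq_mul_inv, inv_le_iff_one_le_mul₀ (by positivity),
        div_mul_eq_mul_div, one_le_div (by positivity), ← Real.mul_rpow (by positivity) hsp.le]
      exact Real.rpow_le_rpow hN0.le (by nlinarith) hε0.le
    have k2 : Real.log |s| ≤ Real.log (2 + N) := Real.log_le_log hsp (by linarith)
    have k3 : 0 ≤ Real.log |s| := Real.log_nonneg (by linarith)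
    calc W s ≤ _ := hW2 s h
      _ ≤ C' * (((5 + H) ^ ε * (2 + N) ^ (-ε)) * (Real.log (2 + N)) ^ d) := by gcongr
      _ = (0 + C' * (5 + H) ^ ε) * (2 + N) ^ (-ε) * (Real.log (2 + N)) ^ d := by ring
      _ ≤ _ := by gcongr; positivity

theorem kernel_aux {n : ℕ} (f : Fin n → ℝ × ℝ → ℝ)
    (γ : Fin n → ℝ) (E : Set (ℝ × ℝ)) (hsf : StandardForm n f γ E)
    (x₀ y₀ A : ℝ) (hA : 0 < A) (α m : ℝ × ℝ → ℝ) (hα : AlphaBound α A)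
    (U : Set (ℝ × ℝ)) (hU : U ∈ 𝓝 (0:ℝ×ℝ))
    (hm : ∀ p ∈ U, m ((x₀, y₀) + p) = α p * stdFun n f γ E p)
    (ε : ℝ) (d : ℕ) (hball : BallBound (stdFun n f γ E) ε d) (hε : ε < 1/2)
    (v : ℝ × ℝ) (hv : nrm2 v = 1) (δv : ℝ) (ev : ℕ)
    (hstrip : StripBound (stdFun n f γ E) v δv ev)
    (hperp : ¬ ExceptionalDir n f E (perp2 v))
    (H : ℝ) (hH : 0 < H) :
    δv = ε ∧
    ∃ r₁ > (0:ℝ), ∀ φ : ℝ × ℝ → ℝ, IsBump φ x₀ y₀ r₁ →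
      ∃ C > (0:ℝ), ∀ t u : ℝ, |dot2 (t, u) (perp2 v)| ≤ H →
        ‖Kphi φ m t u‖ ≤ C * (2 + nrm2 (t, u)) ^ (-ε) *
          (Real.log (2 + nrm2 (t, u))) ^ d := by
  obtain ⟨V, hV, hf⟩ := hsf.analytic
  have hf0 : ∀ i, AnalyticAt ℝ (f i) 0 := fun i => hf i 0 (mem_of_mem_nhds hV)
  obtain ⟨R, hR, hR1, hi, C₀, hC0, r₂, hr2, hS⟩ := strip_upper f γ E hsf ε d hball hε hv hperp
  have hg : ∀ p, 0 ≤ stdFun n f γ E p := stdFun_nonneg n f γ E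
  refine ⟨delta_eq hg hv hball hstrip hR hC0 hr2 hi hS, ?_⟩
  have hε0 := hball.1
  obtain ⟨C', hC', hW⟩ := dyadic_bound (g := fun p => stdFun n f γ E (Rv v p)) (fun p => hg _) hε0 (by linarith) hC0 hr2 hi hS
  obtain ⟨r, hr, hrR, C₁, hC1, hosc⟩ := osc_bound f γ E hf0 hsf.domain hv hperp R hR hi
  obtain ⟨ρ, hρ, hρU⟩ := Metric.mem_nhds_iff.1 hU
  refine ⟨min r ρ, by positivity, fun φ hφ => ?_⟩
  obtain ⟨hφ1, hφ2, -, hφ4⟩ := hφ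
  have hns : ∀ p : ℝ × ℝ, min r ρ ≤ nrm2 p → (x₀, y₀) + p ∉ tsupport φ := by
    intro p hp h
    have h1 := hφ4 h
    simp only [mem_setOf_eq, Prod.fst_add, Prod.snd_add, add_sub_cancel_left] at h1
    have : nrm2 p < min r ρ := by
      unfold nrm2
      rw [Real.sqrt_lt' (by positivity)]
      exact h1
    linarith
  have hsupp : ∀ q, r ≤ ‖q‖ → (x₀, y₀) + Rv v q ∉ tsupport φ := by
    intro q hq
    apply hns
    have : nrm2 (Rv v q) = nrm2 q := by unfold nrm2; rw [Rv_sq hv]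
    rw [this]
    exact (min_le_left _ _).trans (hq.trans (norm_le_nrm2 q))
  have hsu : ∀ p, p ∉ U → φ ((x₀, y₀) + p) = 0 := by
    intro p hp
    apply image_eq_zero_of_notMem_tsupport
    apply hns
    have : ρ ≤ ‖p‖ := by
      by_contra! h
      exact hp (hρU (by simpa using h))
    exact (min_le_right _ _).trans (this.trans (norm_le_nrm2 p))
  obtain ⟨M, hM⟩ := cutoff_tame hA hα hφ1 hφ2 hv (x₀, y₀) hr hsupp hH
  have hM0 : 0 ≤ M := (hM 0 (by simpa using hH.le)).1
  set W : ℝ → ℝ := fun s => ∫ p in ball 0 R, wtI (fun p => stdFun n f γ E (Rv v p)) s p with hWd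
  have hW1 : ∀ s, W s ≤ ∫ p in ball 0 R, stdFun n f γ E (Rv v p) := by
    intro s
    refine integral_mono (wtI_integrable hi s) hi fun p => ?_
    exact mul_le_of_le_one_right (hg _) (inv_sqrt_le_one _)
  obtain ⟨C₂, hC2, hfin⟩ := final_bound (H := H) hε0 hC' (integral_nonneg fun p => hg _) hH hball.2.1 hW1 hW
  refine ⟨(C₁ * M + 1) * C₂, by positivity, fun t u htu => ?_⟩
  rw [Kphi_eq hv x₀ y₀ hm hsu t u]
  refine (hosc M _ (hM _ htu) _).trans ?_
  have hsq : nrm2 (t, u) = Real.sqrt (dot2 (t, u) v ^ 2 + dot2 (t, u) (perp2 v) ^ 2) := by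
    unfold nrm2
    congr 1
    rw [← Rv_sq hv (t, u)]
    simp only [Rv, dot2, perp2]; ring
  have h1 : |dot2 (t, u) v| ≤ nrm2 (t, u) := by
    rw [hsq]; exact Real.abs_le_sqrt (by nlinarith [sq_nonneg (dot2 (t, u) (perp2 v))])
  have h2 : nrm2 (t, u) ≤ |dot2 (t, u) v| + |dot2 (t, u) (perp2 v)| := by
    rw [hsq]
    refine Real.sqrt_le_iff.2 ⟨by positivity, ?_⟩
    rw [← sq_abs (dot2 (t, u) v), ← sq_abs (dot2 (t, u) (perp2 v))]
    nlinarith [abs_nonneg (dot2 (t, u) v), abs_nonneg (dot2 (t, u) (perp2 v)),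
      mul_nonneg (abs_nonneg (dot2 (t, u) v)) (abs_nonneg (dot2 (t, u) (perp2 v)))]
  have h3 := hfin _ _ _ htu h1 h2
  have hW0 : 0 ≤ W (dot2 (t, u) v) := integral_nonneg fun p => wtI_nonneg (fun p => hg _) _ p
  calc C₁ * M * W (dot2 (t, u) v) ≤ (C₁ * M + 1) * W (dot2 (t, u) v) := by nlinarith
    _ ≤ (C₁ * M + 1) * (C₂ * (2 + nrm2 (t, u)) ^ (-ε) * (Real.log (2 + nrm2 (t, u))) ^ d) :=
      mul_le_mul_of_nonneg_left h3 (by positivity)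
    _ = _ := by ring

/-- **Theorem 1.3 a), generic directions.** In the local multiplier setup, if the ball
exponent satisfies `ε < 1/2` and the unit direction `v` of the line `l` is not
perpendicular to any of the lines `l₁, …, l_p`, then `δ_v = ε`, and for bump functions `φ`
with sufficiently small support there is a constant `C` such that on the strip `l_H` one
has `|K_φ(t,u)| ≤ C (2+|(t,u)|)^{−ε} (ln(2+|(t,u)|))^{d}`. -/
theorem kernel_bound_generic_direction {n : ℕ} (f : Fin n → ℝ × ℝ → ℝ)
    (γ : Fin n → ℝ) (E : Set (ℝ × ℝ)) (hsf : StandardForm n f γ E)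
    (x₀ y₀ A : ℝ) (hA : 0 < A) (α m : ℝ × ℝ → ℝ) (hα : AlphaBound α A)
    (U : Set (ℝ × ℝ)) (hU : U ∈ 𝓝 (0:ℝ×ℝ))
    (hm : ∀ p ∈ U, m ((x₀, y₀) + p) = α p * stdFun n f γ E p)
    (ε : ℝ) (d : ℕ) (hball : BallBound (stdFun n f γ E) ε d) (hε : ε < 1/2)
    (v : ℝ × ℝ) (hv : nrm2 v = 1) (δv : ℝ) (ev : ℕ)
    (hstrip : StripBound (stdFun n f γ E) v δv ev)
    (hperp : ¬ ExceptionalDir n f E (perp2 v))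
    (H : ℝ) (hH : 0 < H) :
    δv = ε ∧
    ∃ r₁ > (0:ℝ), ∀ φ : ℝ × ℝ → ℝ, IsBump φ x₀ y₀ r₁ →
      ∃ C > (0:ℝ), ∀ t u : ℝ, |dot2 (t, u) (perp2 v)| ≤ H →
        ‖Kphi φ m t u‖ ≤ C * (2 + nrm2 (t, u)) ^ (-ε) *
          (Real.log (2 + nrm2 (t, u))) ^ d := by
  exact kernel_aux f γ E hsf x₀ y₀ A hA α m hα U hU hm ε d hball hε v hv δv ev hstrip hperp H hH
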